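/- Let n ≥ 1 and α > 0. Let F : S → ℂ be a bounded smooth function with L_α F = 0, and let f : H^n → ℂ be a smooth bounded function which is the boundary value of F. Then F is holomorphic if and only if ℒ_n f = 0. -/

import Mathlib

noncomputable section
open MeasureTheory Filter Set
open scoped Topology BigOperators

/-- The Heisenberg group `H^n = ℂ^n × ℝ` as a set. -/
abbrev Hn (n : ℕ) : Type := (Fin n → ℂ) × ℝ

/-- The extension `S = H^n × (0,∞)`; we use `H^n × ℝ` and restrict to `a > 0`. -/
abbrev Sg (n : ℕ) : Type := Hn n × ℝ

/-- Directional derivative of a complex valued function in direction `v`. -/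
def dirD {E : Type} [NormedAddCommGroup E] [NormedSpace ℝ E]
    (v : E) (f : E → ℂ) (p : E) : ℂ := fderiv ℝ f p v

def eX (n : ℕ) (j : Fin n) : Hn n := (fun i => if i = j then (1 : ℂ) else 0, 0)
def eY (n : ℕ) (j : Fin n) : Hn n := (fun i => if i = j then Complex.I else 0, 0)
def eT (n : ℕ) : Hn n := (0, 1)

/-- `X_j = ∂_{x_j} + 2 y_j ∂_t` on `H^n`. -/
def XH (n : ℕ) (j : Fin n) (f : Hn n → ℂ) (p : Hn n) : ℂ :=
  dirD (eX n j) f p + 2 * ((p.1 j).im : ℂ) * dirD (eT n) f p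

/-- `Y_j = ∂_{y_j} - 2 x_j ∂_t` on `H^n`. -/
def YH (n : ℕ) (j : Fin n) (f : Hn n → ℂ) (p : Hn n) : ℂ :=
  dirD (eY n j) f p - 2 * ((p.1 j).re : ℂ) * dirD (eT n) f p

/-- `T = ∂_t` on `H^n`. -/
def TH (n : ℕ) (f : Hn n → ℂ) (p : Hn n) : ℂ := dirD (eT n) f p

/-- `ℒ_α = -(1/4) Σ (X_j² + Y_j²) + i α T` on `H^n`. -/
def LH (n : ℕ) (α : ℝ) (f : Hn n → ℂ) (p : Hn n) : ℂ :=
  -(1/4) * ∑ j, (XH n j (XH n j f) p + YH n j (YH n j f) p) + Complex.I * (α : ℂ) * TH n f p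

/-- `Z̄_j = (1/2)(X_j + i Y_j)` on `H^n`. -/
def ZbarH (n : ℕ) (j : Fin n) (f : Hn n → ℂ) (p : Hn n) : ℂ :=
  (1/2) * (XH n j f p + Complex.I * YH n j f p)

/-- A function is bounded. -/
def BddFun {X : Type} (f : X → ℂ) : Prop := ∃ C, ∀ p, ‖f p‖ ≤ C

def eXS (n : ℕ) (j : Fin n) : Sg n := (eX n j, 0)
def eYS (n : ℕ) (j : Fin n) : Sg n := (eY n j, 0)
def eTS (n : ℕ) : Sg n := (eT n, 0)
def eA (n : ℕ) : Sg n := (0, 1)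

/-- `X_j` on `S`. -/
def XS (n : ℕ) (j : Fin n) (F : Sg n → ℂ) (p : Sg n) : ℂ :=
  dirD (eXS n j) F p + 2 * ((p.1.1 j).im : ℂ) * dirD (eTS n) F p

/-- `Y_j` on `S`. -/
def YS (n : ℕ) (j : Fin n) (F : Sg n → ℂ) (p : Sg n) : ℂ :=
  dirD (eYS n j) F p - 2 * ((p.1.1 j).re : ℂ) * dirD (eTS n) F p

/-- `T = ∂_t` on `S`. -/
def TS (n : ℕ) (F : Sg n → ℂ) (p : Sg n) : ℂ := dirD (eTS n) F p

/-- `∂_a` on `S`. -/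
def DA (n : ℕ) (F : Sg n → ℂ) : Sg n → ℂ := fun p => dirD (eA n) F p

/-- `ℒ = -(1/4) Σ (X_j² + Y_j²)` acting in the `H^n`-variables on `S`. -/
def LS0 (n : ℕ) (F : Sg n → ℂ) (p : Sg n) : ℂ :=
  -(1/4) * ∑ j, (XS n j (XS n j F) p + YS n j (YS n j F) p)

/-- `L_α = -α a (ℒ + n ∂_a) + a² (∂_a² + T²)` on `S`. -/
def Lalpha (n : ℕ) (α : ℝ) (F : Sg n → ℂ) (p : Sg n) : ℂ :=
  -(α : ℂ) * (p.2 : ℂ) * (LS0 n F p + (n : ℂ) * DA n F p)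
    + (p.2 : ℂ) ^ 2 * (DA n (DA n F) p + TS n (TS n F) p)

/-- The complex space `ℂ^{n+1}` in which the Siegel upper half-plane lives. -/
abbrev Vn (n : ℕ) : Type := (Fin n → ℂ) × ℂ

/-- The Siegel upper half-plane `U^n`. -/
def Un (n : ℕ) : Set (Vn n) := {z | ∑ j, ‖z.1 j‖ ^ 2 < z.2.im}

/-- The function `F_u` on the Siegel upper half-plane corresponding to a function `F` on `S`,
via `F[ζ,t,a] = F_u(ζ, t + i|ζ|² + ia)`, i.e.
`F_u(z', z_{n+1}) = F(z', Re z_{n+1}, Im z_{n+1} - |z'|²)`. -/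
def Fu (n : ℕ) (F : Sg n → ℂ) : Vn n → ℂ :=
  fun z => F ((z.1, z.2.re), z.2.im - ∑ j, ‖z.1 j‖ ^ 2)

/-- `F` is holomorphic if `F_u` is holomorphic on `U^n`. -/
def IsHolo (n : ℕ) (F : Sg n → ℂ) : Prop := DifferentiableOn ℂ (Fu n F) (Un n)

/-- `F` is anti-holomorphic if the conjugate of `F_u` is holomorphic on `U^n`. -/
def IsAntiHolo (n : ℕ) (F : Sg n → ℂ) : Prop :=
  DifferentiableOn ℂ (fun z => (starRingEnd ℂ) (Fu n F z)) (Un n)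

/-- Wirtinger derivative `∂_z` in complex direction `v`. -/
def dzV (n : ℕ) (v : Vn n) (f : Vn n → ℂ) (p : Vn n) : ℂ :=
  (1/2) * (fderiv ℝ f p v - Complex.I * fderiv ℝ f p (Complex.I • v))

/-- Wirtinger derivative `∂_{z̄}` in complex direction `v`. -/
def dzbarV (n : ℕ) (v : Vn n) (f : Vn n → ℂ) (p : Vn n) : ℂ :=
  (1/2) * (fderiv ℝ f p v + Complex.I * fderiv ℝ f p (Complex.I • v))

/-- The standard complex basis vectors of `ℂ^{n+1} = ℂ^n × ℂ`. -/
def basisV (n : ℕ) (k : Fin (n + 1)) : Vn n :=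
  if _h : (k : ℕ) < n then (fun i => if (i : ℕ) = (k : ℕ) then (1 : ℂ) else 0, 0) else (0, 1)

/-- `F` is pluriharmonic if `∂_{z_k} ∂_{z̄_j} F_u = 0` on `U^n` for all `1 ≤ j,k ≤ n+1`. -/
def IsPluriharmonic (n : ℕ) (F : Sg n → ℂ) : Prop :=
  ∀ p ∈ Un n, ∀ j k : Fin (n + 1),
    dzV n (basisV n k) (dzbarV n (basisV n j) (Fu n F)) p = 0

/-- `f` is the boundary value of `F` : for every `φ ∈ L¹(H^n)`,
`∫ F(w,a) φ(w) dw → ∫ f(w) φ(w) dw` as `a → 0⁺`. -/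
def IsBoundaryValue (n : ℕ) (F : Sg n → ℂ) (f : Hn n → ℂ) : Prop :=
  ∀ φ : Hn n → ℂ, Integrable φ →
    Tendsto (fun a : ℝ => ∫ w : Hn n, F (w, a) * φ w) (𝓝[>] (0 : ℝ))
      (𝓝 (∫ w : Hn n, f w * φ w))

section

lemma osgood_step {E : Type} [NormedAddCommGroup E] [NormedSpace ℂ E] [FiniteDimensional ℂ E]
    {U : Set E} (hU : IsOpen U) {f : E → ℂ} (hf : DifferentiableOn ℂ f U) (e : E) :
    DifferentiableOn ℂ (fun z => fderiv ℂ f z e) U := by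
  have : ProperSpace E := FiniteDimensional.proper ℂ E
  have : ProperSpace (E →L[ℂ] ℂ) := FiniteDimensional.proper ℂ _
  have : SecondCountableTopology (E →L[ℂ] ℂ) := secondCountable_of_proper
  let : MeasurableSpace E := borel E
  have : BorelSpace E := ⟨rfl⟩
  intro z0 hz0
  obtain ⟨r, hr, hrU⟩ := Metric.isOpen_iff.1 hU z0 hz0
  set ρ := r / 4 with hρ
  have hρ0 : 0 < ρ := by positivity
  have hsub : Metric.closedBall z0 (3*ρ) ⊆ U :=
    (Metric.closedBall_subset_ball (by rw [hρ]; linarith)).trans hrU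
  obtain ⟨M, hM⟩ := (isCompact_closedBall z0 (3*ρ)).exists_bound_of_continuousOn
    (hf.continuousOn.mono hsub)
  set R := ρ / (‖e‖ + 1) with hR
  have hR0 : 0 < R := by positivity
  have hRe : R * ‖e‖ ≤ ρ := by
    rw [hR, div_mul_eq_mul_div, div_le_iff₀ (by positivity)]
    nlinarith [norm_nonneg e]
  have hmem : ∀ z ∈ Metric.ball z0 ρ, ∀ w : ℂ, ‖w‖ ≤ R →
      z + w • e ∈ Metric.closedBall z0 (2*ρ) := by
    intro z hz w hw
    rw [mem_closedBall_iff_norm]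
    rw [mem_ball_iff_norm] at hz
    calc ‖z + w • e - z0‖ = ‖(z - z0) + w • e‖ := by congr 1; abel
      _ ≤ ‖z - z0‖ + ‖w • e‖ := norm_add_le _ _
      _ ≤ ρ + R * ‖e‖ := by rw [norm_smul]; gcongr
      _ ≤ 2 * ρ := by linarith
  have hUmem : ∀ y ∈ Metric.closedBall z0 (2*ρ), y ∈ U := fun y hy =>
    hsub (Metric.closedBall_subset_closedBall (by linarith) hy)
  have hdiff : ∀ y ∈ U, DifferentiableAt ℂ f y := fun y hy => hf.differentiableAt (hU.mem_nhds hy)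
  have hbd : ∀ y ∈ Metric.closedBall z0 (2*ρ), ‖fderiv ℂ f y‖ ≤ (2*M)/ρ := by
    intro y hy
    have hb : Metric.ball y ρ ⊆ Metric.closedBall z0 (3*ρ) := by
      refine (Metric.ball_subset_ball' ?_).trans (Metric.ball_subset_closedBall (ε := 3*ρ))
      rw [Metric.mem_closedBall] at hy
      linarith
    refine Complex.norm_fderiv_le_div_of_mapsTo_ball (hf.mono (hb.trans hsub)) ?_ hρ0
    intro x hx
    rw [mem_closedBall_iff_norm]
    have h1 := hM x (hb hx)
    have h2 := hM y (hb (Metric.mem_ball_self hρ0))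
    linarith [norm_sub_le (f x) (f y)]
  -- Cauchy formula
  have hc : ∀ z ∈ Metric.ball z0 ρ, fderiv ℂ f z e = (2 * Real.pi * Complex.I)⁻¹ *
      ∫ θ in (0:ℝ)..2*Real.pi, (deriv (circleMap 0 R) θ * (1 / (circleMap 0 R θ)^2)) •
        f (z + circleMap 0 R θ • e) := by
    intro z hz
    have h1 : HasDerivAt (fun w : ℂ => f (z + w • e)) (fderiv ℂ f z e) 0 := by
      have hz' : z ∈ U := by
        have := hUmem _ (hmem z hz 0 (by simpa using hR0.le)); simpa using this
      have h2 : HasDerivAt (fun w : ℂ => z + w • e) e 0 := by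
        simpa using ((hasDerivAt_id (0:ℂ)).smul_const e).const_add z
      have h3 : HasFDerivAt f (fderiv ℂ f z) (z + (0:ℂ) • e) := by
        simpa using (hdiff z hz').hasFDerivAt
      exact h3.comp_hasDerivAt (0:ℂ) h2
    have h2 : DiffContOnCl ℂ (fun w : ℂ => f (z + w • e)) (Metric.ball 0 R) := by
      apply DifferentiableOn.diffContOnCl
      intro w hw
      have hw' : ‖w‖ ≤ R := by
        have := Metric.closure_ball_subset_closedBall hw
        simpa using this
      refine DifferentiableAt.differentiableWithinAt ?_
      refine DifferentiableAt.comp w (g := f) (f := fun w : ℂ => z + w • e) (hdiff _ (hUmem _ (hmem z hz w hw'))) ?_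
      fun_prop
    have h3 := h2.deriv_eq_smul_circleIntegral hR0
    rw [h1.deriv] at h3
    rw [eq_inv_mul_iff_mul_eq₀ Complex.two_pi_I_ne_zero, ← smul_eq_mul, ← h3, circleIntegral]
    refine intervalIntegral.integral_congr (fun θ _ => ?_)
    simp [mul_assoc]
  set k : ℝ → ℂ := fun θ => deriv (circleMap 0 R) θ * (1 / (circleMap 0 R θ)^2) with hk
  have hcm : ∀ θ, ‖circleMap 0 R θ‖ ≤ R := by intro θ; simp [abs_of_pos hR0]
  have hkc : Continuous k := by
    have : ∀ θ, (circleMap 0 R θ)^2 ≠ 0 := fun θ => pow_ne_zero _ (circleMap_ne_center hR0.ne')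
    have hcc : Continuous (circleMap 0 R) := continuous_circleMap 0 R
    simp only [hk, deriv_circleMap]
    exact (hcc.mul continuous_const).mul (continuous_const.div (hcc.pow 2) this)
  have hcontF : ∀ z ∈ Metric.ball z0 ρ, Continuous (fun θ => k θ • f (z + circleMap 0 R θ • e)) := by
    intro z hz
    refine hkc.smul ?_
    rw [← continuousOn_univ]
    refine ContinuousOn.comp (t := U) hf.continuousOn ?_ ?_
    · exact ((continuous_const.add ((continuous_circleMap 0 R).smul continuous_const))).continuousOn
    · intro θ _; exact hUmem _ (hmem z hz _ (hcm θ))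
  have key : HasFDerivAt (fun z => ∫ θ in (0:ℝ)..2*Real.pi, k θ • f (z + circleMap 0 R θ • e))
      (∫ θ in (0:ℝ)..2*Real.pi, k θ • fderiv ℂ f (z0 + circleMap 0 R θ • e)) z0 := by
    refine intervalIntegral.hasFDerivAt_integral_of_dominated_of_fderiv_le
      (F' := fun z θ => k θ • fderiv ℂ f (z + circleMap 0 R θ • e))
      (bound := fun θ => ‖k θ‖ * ((2*M)/ρ)) (Metric.ball_mem_nhds z0 hρ0) ?_ ?_ ?_ ?_ ?_ ?_
    · filter_upwards [Metric.ball_mem_nhds z0 hρ0] with z hz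
      exact (hcontF z hz).aestronglyMeasurable
    · exact (hcontF z0 (Metric.mem_ball_self hρ0)).intervalIntegrable _ _
    · refine hkc.aestronglyMeasurable.smul ?_
      refine Measurable.aestronglyMeasurable ?_
      refine (measurable_fderiv ℂ f).comp ?_
      exact (continuous_const.add ((continuous_circleMap 0 R).smul continuous_const)).measurable
    · refine Eventually.of_forall (fun θ _ z hz => ?_)
      rw [norm_smul]
      gcongr
      exact hbd _ (hmem z hz _ (hcm θ))
    · exact (hkc.norm.mul continuous_const).intervalIntegrable _ _
    · refine Eventually.of_forall (fun θ _ z hz => ?_)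
      have h1 := (hdiff _ (hUmem _ (hmem z hz _ (hcm θ)))).hasFDerivAt
      exact ((hasFDerivAt_comp_add_right _).2 h1).const_smul (k θ)
  have : DifferentiableAt ℂ (fun z => fderiv ℂ f z e) z0 := by
    refine (key.differentiableAt.const_mul (2 * Real.pi * Complex.I)⁻¹).congr_of_eventuallyEq ?_
    filter_upwards [Metric.ball_mem_nhds z0 hρ0] with z hz
    exact hc z hz
  exact this.differentiableWithinAt

lemma osgood {E : Type} [NormedAddCommGroup E] [NormedSpace ℂ E] [FiniteDimensional ℂ E]
    {U : Set E} (hU : IsOpen U) (m : ℕ) : ∀ {f : E → ℂ}, DifferentiableOn ℂ f U →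
    ContDiffOn ℂ m f U := by
  induction m with
  | zero => intro f hf; exact contDiffOn_zero.2 hf.continuousOn
  | succ m ih =>
    intro f hf
    push_cast
    rw [contDiffOn_succ_iff_fderiv_of_isOpen hU]
    refine ⟨hf, by simp, ?_⟩
    rw [contDiffOn_clm_apply]
    intro y
    exact ih (osgood_step hU hf y)
end

section

instance volHaar (n : ℕ) : (volume : Measure (Hn n)).IsAddHaarMeasure :=
  Measure.prod.instIsAddHaarMeasure (volume : Measure (Fin n → ℂ)) (volume : Measure ℝ)

def vX (n : ℕ) (j : Fin n) (p : Hn n) : Hn n := eX n j + (2 * (p.1 j).im) • eT n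
def vY (n : ℕ) (j : Fin n) (p : Hn n) : Hn n := eY n j + (-(2 * (p.1 j).re)) • eT n

lemma XH_eq (n : ℕ) (j : Fin n) (f : Hn n → ℂ) (p : Hn n) :
    XH n j f p = fderiv ℝ f p (vX n j p) := by
  simp [XH, vX, dirD, map_add, map_smul, Complex.real_smul]

lemma YH_eq (n : ℕ) (j : Fin n) (f : Hn n → ℂ) (p : Hn n) :
    YH n j f p = fderiv ℝ f p (vY n j p) := by
  simp only [YH, vY, dirD, map_add, map_smul, Complex.real_smul]
  push_cast; ring

lemma contDiff_dirD {n : ℕ} {m : WithTop ℕ∞} {f : Hn n → ℂ} (hf : ContDiff ℝ (m+1) f) (v : Hn n) :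
    ContDiff ℝ m (fun p => dirD v f p) := by
  unfold dirD
  exact (hf.fderiv_right le_rfl).clm_apply contDiff_const

lemma contDiff_im {n : ℕ} {m : WithTop ℕ∞} (j : Fin n) :
    ContDiff ℝ m (fun p : Hn n => ((p.1 j).im : ℂ)) := by
  have h : ContDiff ℝ m (fun p : Hn n => p.1 j) := by fun_prop
  exact Complex.ofRealCLM.contDiff.comp (Complex.imCLM.contDiff.comp h)

lemma contDiff_re {n : ℕ} {m : WithTop ℕ∞} (j : Fin n) :
    ContDiff ℝ m (fun p : Hn n => ((p.1 j).re : ℂ)) := by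
  have h : ContDiff ℝ m (fun p : Hn n => p.1 j) := by fun_prop
  exact Complex.ofRealCLM.contDiff.comp (Complex.reCLM.contDiff.comp h)

lemma contDiff_XH {n : ℕ} {m : WithTop ℕ∞} {f : Hn n → ℂ} (hf : ContDiff ℝ (m+1) f) (j : Fin n) :
    ContDiff ℝ m (XH n j f) := by
  unfold XH
  exact (contDiff_dirD hf _).add ((contDiff_const.mul (contDiff_im j)).mul (contDiff_dirD hf _))

lemma contDiff_YH {n : ℕ} {m : WithTop ℕ∞} {f : Hn n → ℂ} (hf : ContDiff ℝ (m+1) f) (j : Fin n) :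
    ContDiff ℝ m (YH n j f) := by
  unfold YH
  exact (contDiff_dirD hf _).sub ((contDiff_const.mul (contDiff_re j)).mul (contDiff_dirD hf _))

lemma contDiff_TH {n : ℕ} {m : WithTop ℕ∞} {f : Hn n → ℂ} (hf : ContDiff ℝ (m+1) f) :
    ContDiff ℝ m (TH n f) := contDiff_dirD hf _

lemma hcs_fderiv {n : ℕ} {f : Hn n → ℂ} (hf : HasCompactSupport f) (v : Hn n → Hn n) :
    HasCompactSupport (fun p => fderiv ℝ f p (v p)) :=
  (hf.fderiv ℝ).mono' (by
    intro p hp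
    refine subset_tsupport _ ?_
    intro h
    apply hp
    simp [h])

lemma hcs_XH {n : ℕ} {f : Hn n → ℂ} (hf : HasCompactSupport f) (j : Fin n) :
    HasCompactSupport (XH n j f) := by
  have := hcs_fderiv hf (vX n j)
  convert this using 1; ext p; exact XH_eq n j f p

lemma hcs_YH {n : ℕ} {f : Hn n → ℂ} (hf : HasCompactSupport f) (j : Fin n) :
    HasCompactSupport (YH n j f) := by
  have := hcs_fderiv hf (vY n j)
  convert this using 1; ext p; exact YH_eq n j f p

lemma integral_dirD_zero {n : ℕ} {f : Hn n → ℂ} (hf : ContDiff ℝ 1 f) (hc : HasCompactSupport f)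
    (v : Hn n) : ∫ p, fderiv ℝ f p v = 0 := by
  have h1 := integral_mul_fderiv_eq_neg_fderiv_mul_of_integrable (𝕜 := ℂ) (μ := (volume : Measure (Hn n)))
    (f := fun _ => (1:ℂ)) (g := f) (v := v) (by simp) ?_ ?_ (by simp)
    (fun x _ => hf.differentiable one_ne_zero x)
  · simpa using h1
  · simp only [one_mul]
    refine Continuous.integrable_of_hasCompactSupport ?_ (hcs_fderiv hc (fun _ => v))
    exact (hf.continuous_fderiv one_ne_zero).clm_apply continuous_const
  · simp only [one_mul]
    exact hf.continuous.integrable_of_hasCompactSupport hc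

lemma hasFDerivAt_im {n : ℕ} (j : Fin n) (p : Hn n) :
    HasFDerivAt (fun p : Hn n => ((p.1 j).im : ℂ)) (Complex.ofRealCLM.comp (Complex.imCLM.comp
      ((ContinuousLinearMap.proj j).comp (ContinuousLinearMap.fst ℝ (Fin n → ℂ) ℝ)))) p :=
  ContinuousLinearMap.hasFDerivAt (Complex.ofRealCLM.comp (Complex.imCLM.comp
      ((ContinuousLinearMap.proj j).comp (ContinuousLinearMap.fst ℝ (Fin n → ℂ) ℝ))))

lemma hasFDerivAt_re {n : ℕ} (j : Fin n) (p : Hn n) :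
    HasFDerivAt (fun p : Hn n => ((p.1 j).re : ℂ)) (Complex.ofRealCLM.comp (Complex.reCLM.comp
      ((ContinuousLinearMap.proj j).comp (ContinuousLinearMap.fst ℝ (Fin n → ℂ) ℝ)))) p :=
  ContinuousLinearMap.hasFDerivAt (Complex.ofRealCLM.comp (Complex.reCLM.comp
      ((ContinuousLinearMap.proj j).comp (ContinuousLinearMap.fst ℝ (Fin n → ℂ) ℝ))))

lemma integral_XH_zero {n : ℕ} {f : Hn n → ℂ} (hf : ContDiff ℝ 1 f) (hc : HasCompactSupport f)
    (j : Fin n) : ∫ p, XH n j f p = 0 := by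
  have h : ∀ p, XH n j f p = fderiv ℝ f p (eX n j) +
      fderiv ℝ (fun p : Hn n => (2 * ((p.1 j).im : ℂ)) * f p) p (eT n) := by
    intro p
    have h1 := (((hasFDerivAt_im j p).const_mul 2).mul
      (hf.differentiable one_ne_zero p).hasFDerivAt).fderiv
    unfold XH dirD
    erw [h1]
    simp [eT]
  simp_rw [h]
  have c1 : ContDiff ℝ 1 (fun p : Hn n => (2 * ((p.1 j).im : ℂ)) * f p) :=
    (contDiff_const.mul (contDiff_im j)).mul hf
  have c2 : HasCompactSupport (fun p : Hn n => (2 * ((p.1 j).im : ℂ)) * f p) := hc.mul_left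
  rw [integral_add, integral_dirD_zero hf hc, integral_dirD_zero c1 c2, add_zero]
  · exact ((hf.continuous_fderiv one_ne_zero).clm_apply
      continuous_const).integrable_of_hasCompactSupport (hcs_fderiv hc (fun _ => eX n j))
  · exact ((c1.continuous_fderiv one_ne_zero).clm_apply
      continuous_const).integrable_of_hasCompactSupport (hcs_fderiv c2 (fun _ => eT n))

lemma integral_YH_zero {n : ℕ} {f : Hn n → ℂ} (hf : ContDiff ℝ 1 f) (hc : HasCompactSupport f)
    (j : Fin n) : ∫ p, YH n j f p = 0 := by
  have h : ∀ p, YH n j f p = fderiv ℝ f p (eY n j) -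
      fderiv ℝ (fun p : Hn n => (2 * ((p.1 j).re : ℂ)) * f p) p (eT n) := by
    intro p
    have h1 := (((hasFDerivAt_re j p).const_mul 2).mul
      (hf.differentiable one_ne_zero p).hasFDerivAt).fderiv
    unfold YH dirD
    erw [h1]
    simp [eT]
  simp_rw [h]
  have c1 : ContDiff ℝ 1 (fun p : Hn n => (2 * ((p.1 j).re : ℂ)) * f p) :=
    (contDiff_const.mul (contDiff_re j)).mul hf
  have c2 : HasCompactSupport (fun p : Hn n => (2 * ((p.1 j).re : ℂ)) * f p) := hc.mul_left
  rw [integral_sub, integral_dirD_zero hf hc, integral_dirD_zero c1 c2, sub_zero]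
  · exact ((hf.continuous_fderiv one_ne_zero).clm_apply
      continuous_const).integrable_of_hasCompactSupport (hcs_fderiv hc (fun _ => eY n j))
  · exact ((c1.continuous_fderiv one_ne_zero).clm_apply
      continuous_const).integrable_of_hasCompactSupport (hcs_fderiv c2 (fun _ => eT n))

lemma fderiv_mul_C {E : Type} [NormedAddCommGroup E] [NormedSpace ℝ E] {f g : E → ℂ} {p : E}
    (hf : DifferentiableAt ℝ f p) (hg : DifferentiableAt ℝ g p) (v : E) :
    fderiv ℝ (fun x => f x * g x) p v = fderiv ℝ f p v * g p + f p * fderiv ℝ g p v := by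
  rw [fderiv_fun_mul hf hg]
  simp; ring

/-- Abstract integration by parts. -/
lemma ibp_gen {n : ℕ} (D : (Hn n → ℂ) → Hn n → ℂ) (v : Hn n → Hn n)
    (hD : ∀ f p, D f p = fderiv ℝ f p (v p))
    (hcd : ∀ f, ContDiff ℝ 1 f → Continuous (D f))
    (h0 : ∀ f, ContDiff ℝ 1 f → HasCompactSupport f → ∫ p, D f p = 0)
    {f g : Hn n → ℂ} (hf : ContDiff ℝ 1 f) (hg : ContDiff ℝ 1 g) (hc : HasCompactSupport g) :
    ∫ p, D f p * g p = - ∫ p, f p * D g p := by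
  have h1 := h0 (fun p => f p * g p) (hf.mul hg) hc.mul_left
  have h2 : ∀ p, D (fun p => f p * g p) p = D f p * g p + f p * D g p := by
    intro p
    simp only [hD]
    exact fderiv_mul_C (hf.differentiable one_ne_zero p) (hg.differentiable one_ne_zero p) _
  simp_rw [h2] at h1
  have hDg : HasCompactSupport (D g) := by
    have := hcs_fderiv hc v
    convert this using 1; ext p; exact hD g p
  rw [integral_add] at h1
  · exact eq_neg_of_add_eq_zero_left h1
  · exact ((hcd f hf).mul hg.continuous).integrable_of_hasCompactSupport hc.mul_left
  · exact (hf.continuous.mul (hcd g hg)).integrable_of_hasCompactSupport hDg.mul_left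

lemma ibp_XH {n : ℕ} (j : Fin n) {f g : Hn n → ℂ} (hf : ContDiff ℝ 1 f) (hg : ContDiff ℝ 1 g)
    (hc : HasCompactSupport g) : ∫ p, XH n j f p * g p = - ∫ p, f p * XH n j g p :=
  ibp_gen (XH n j) (vX n j) (XH_eq n j)
    (fun f hf => (contDiff_XH (m := 0) (by simpa using hf) j).continuous)
    (fun f hf hc => integral_XH_zero hf hc j) hf hg hc

lemma ibp_YH {n : ℕ} (j : Fin n) {f g : Hn n → ℂ} (hf : ContDiff ℝ 1 f) (hg : ContDiff ℝ 1 g)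
    (hc : HasCompactSupport g) : ∫ p, YH n j f p * g p = - ∫ p, f p * YH n j g p :=
  ibp_gen (YH n j) (vY n j) (YH_eq n j)
    (fun f hf => (contDiff_YH (m := 0) (by simpa using hf) j).continuous)
    (fun f hf hc => integral_YH_zero hf hc j) hf hg hc

lemma ibp_TH {n : ℕ} {f g : Hn n → ℂ} (hf : ContDiff ℝ 1 f) (hg : ContDiff ℝ 1 g)
    (hc : HasCompactSupport g) : ∫ p, TH n f p * g p = - ∫ p, f p * TH n g p :=
  ibp_gen (TH n) (fun _ => eT n) (fun _ _ => rfl)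
    (fun f hf => (contDiff_TH (m := 0) (by simpa using hf)).continuous)
    (fun f hf hc => integral_dirD_zero hf hc _) hf hg hc

lemma weak_identity {n : ℕ} {f g : Hn n → ℂ} (hf : ContDiff ℝ 2 f) (hg : ContDiff ℝ 2 g)
    (hc : HasCompactSupport g) (α : ℝ) :
    ∫ p, LH n α f p * g p = ∫ p, f p * LH n (-α) g p := by
  have e2 : (2 : WithTop ℕ∞) = 1 + 1 := by norm_num
  have hf1 : ContDiff ℝ 1 f := hf.of_le (by norm_num)
  have hg1 : ContDiff ℝ 1 g := hg.of_le (by norm_num)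
  rw [e2] at hf hg
  have xf := fun j => contDiff_XH hf j
  have xg := fun j => contDiff_XH hg j
  have yf := fun j => contDiff_YH hf j
  have yg := fun j => contDiff_YH hg j
  have cX : ∀ {h : Hn n → ℂ} (_ : ContDiff ℝ 1 h) j, Continuous (XH n j h) := fun hh j =>
    (contDiff_XH (m := 0) (by simpa using hh) j).continuous
  have cY : ∀ {h : Hn n → ℂ} (_ : ContDiff ℝ 1 h) j, Continuous (YH n j h) := fun hh j =>
    (contDiff_YH (m := 0) (by simpa using hh) j).continuous
  have cT : ∀ {h : Hn n → ℂ} (_ : ContDiff ℝ 1 h), Continuous (TH n h) := fun hh =>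
    (contDiff_TH (m := 0) (by simpa using hh)).continuous
  have X2 : ∀ j, ∫ p, XH n j (XH n j f) p * g p = ∫ p, f p * XH n j (XH n j g) p := by
    intro j
    rw [ibp_XH j (xf j) hg1 hc, ibp_XH j hf1 (xg j) (hcs_XH hc j), neg_neg]
  have Y2 : ∀ j, ∫ p, YH n j (YH n j f) p * g p = ∫ p, f p * YH n j (YH n j g) p := by
    intro j
    rw [ibp_YH j (yf j) hg1 hc, ibp_YH j hf1 (yg j) (hcs_YH hc j), neg_neg]
  have iX1 : ∀ j, Integrable (fun p => XH n j (XH n j f) p * g p) := fun j =>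
    ((cX (xf j) j).mul hg.continuous).integrable_of_hasCompactSupport hc.mul_left
  have iY1 : ∀ j, Integrable (fun p => YH n j (YH n j f) p * g p) := fun j =>
    ((cY (yf j) j).mul hg.continuous).integrable_of_hasCompactSupport hc.mul_left
  have iX2 : ∀ j, Integrable (fun p => f p * XH n j (XH n j g) p) := fun j =>
    (hf.continuous.mul (cX (xg j) j)).integrable_of_hasCompactSupport
      (hcs_XH (hcs_XH hc j) j).mul_left
  have iY2 : ∀ j, Integrable (fun p => f p * YH n j (YH n j g) p) := fun j =>
    (hf.continuous.mul (cY (yg j) j)).integrable_of_hasCompactSupport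
      (hcs_YH (hcs_YH hc j) j).mul_left
  have iT1 : Integrable (fun p => TH n f p * g p) :=
    ((cT hf1).mul hg.continuous).integrable_of_hasCompactSupport hc.mul_left
  have hcT : HasCompactSupport (TH n g) := hcs_fderiv hc (fun _ => eT n)
  have iT2 : Integrable (fun p => f p * TH n g p) :=
    (hf.continuous.mul (cT hg1)).integrable_of_hasCompactSupport hcT.mul_left
  have e1 : ∀ p, LH n α f p * g p = -(1/4) * ∑ j, (XH n j (XH n j f) p * g p
      + YH n j (YH n j f) p * g p) + Complex.I * (α:ℂ) * (TH n f p * g p) := by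
    intro p; unfold LH; rw [add_mul, mul_assoc, Finset.sum_mul]; simp only [add_mul]; ring
  have e3 : ∀ p, f p * LH n (-α) g p = -(1/4) * ∑ j, (f p * XH n j (XH n j g) p
      + f p * YH n j (YH n j g) p) - Complex.I * (α:ℂ) * (f p * TH n g p) := by
    intro p; unfold LH; rw [mul_add, mul_left_comm, Finset.mul_sum]; simp only [mul_add]
    push_cast; ring
  simp_rw [e1, e3]
  rw [integral_add, integral_sub, integral_const_mul, integral_const_mul, integral_const_mul,
    integral_const_mul, ibp_TH hf1 hg1 hc, integral_finsetSum, integral_finsetSum]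
  · have : ∀ j, ∫ p, (XH n j (XH n j f) p * g p + YH n j (YH n j f) p * g p)
        = ∫ p, (f p * XH n j (XH n j g) p + f p * YH n j (YH n j g) p) := by
      intro j
      rw [integral_add (iX1 j) (iY1 j), integral_add (iX2 j) (iY2 j), X2, Y2]
    simp_rw [this]
    ring
  · exact fun j _ => (iX2 j).add (iY2 j)
  · exact fun j _ => (iX1 j).add (iY1 j)
  · exact (integrable_finsetSum _ (fun j _ => (iX2 j).add (iY2 j))).const_mul _
  · exact iT2.const_mul _
  · exact (integrable_finsetSum _ (fun j _ => (iX1 j).add (iY1 j))).const_mul _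
  · exact iT1.const_mul _
end

section

lemma two_le_inf : (2 : WithTop ℕ∞) ≤ ((⊤ : ℕ∞) : WithTop ℕ∞) := by
  exact WithTop.coe_le_coe.2 (le_top : (2:ℕ∞) ≤ ⊤)

/-- map `S → ℂ^{n+1}` -/
def psi (n : ℕ) (p : Sg n) : Vn n := (p.1.1, (p.1.2 : ℂ) + Complex.I * ((p.2 + ∑ j, ‖p.1.1 j‖ ^ 2 : ℝ) : ℂ))

lemma psi_mem {n : ℕ} {p : Sg n} (hp : 0 < p.2) : psi n p ∈ Un n := by
  simp only [psi, Un, mem_ofPred_eq, Complex.add_im, Complex.ofReal_im, Complex.mul_im, Complex.I_re,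
    Complex.I_im, Complex.ofReal_re]
  linarith

lemma Fu_psi (n : ℕ) (F : Sg n → ℂ) (p : Sg n) : Fu n F (psi n p) = F p := by
  simp only [Fu, psi, Complex.add_im, Complex.ofReal_im, Complex.mul_im, Complex.I_re,
    Complex.I_im, Complex.ofReal_re, Complex.add_re, Complex.mul_re]
  congr 1
  ext <;> simp

def psi' (n : ℕ) (p : Sg n) : Sg n →L[ℝ] Vn n :=
  ((ContinuousLinearMap.fst ℝ (Fin n → ℂ) ℝ).comp (ContinuousLinearMap.fst ℝ (Hn n) ℝ)).prod
   ((Complex.ofRealCLM.comp ((ContinuousLinearMap.snd ℝ (Fin n → ℂ) ℝ).comp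
      (ContinuousLinearMap.fst ℝ (Hn n) ℝ))) +
    (Complex.I • (Complex.ofRealCLM.comp (ContinuousLinearMap.snd ℝ (Hn n) ℝ +
      ∑ j, (((2 * (p.1.1 j).re) • (Complex.reCLM.comp ((ContinuousLinearMap.proj j).comp
      ((ContinuousLinearMap.fst ℝ (Fin n → ℂ) ℝ).comp (ContinuousLinearMap.fst ℝ (Hn n) ℝ)))))
      + ((2 * (p.1.1 j).im) • (Complex.imCLM.comp ((ContinuousLinearMap.proj j).comp
      ((ContinuousLinearMap.fst ℝ (Fin n → ℂ) ℝ).comp (ContinuousLinearMap.fst ℝ (Hn n) ℝ)))))))))) 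

lemma hasFDerivAt_psi (n : ℕ) (p : Sg n) : HasFDerivAt (psi n) (psi' n p) p := by
  unfold psi psi'
  have h1 : HasFDerivAt (fun p : Sg n => p.1.1) ((ContinuousLinearMap.fst ℝ (Fin n → ℂ) ℝ).comp (ContinuousLinearMap.fst ℝ (Hn n) ℝ)) p :=
    ContinuousLinearMap.hasFDerivAt ((ContinuousLinearMap.fst ℝ (Fin n → ℂ) ℝ).comp (ContinuousLinearMap.fst ℝ (Hn n) ℝ))
  refine h1.prodMk ?_
  refine HasFDerivAt.add ?_ ?_
  · exact ContinuousLinearMap.hasFDerivAt (Complex.ofRealCLM.comp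
      ((ContinuousLinearMap.snd ℝ (Fin n → ℂ) ℝ).comp (ContinuousLinearMap.fst ℝ (Hn n) ℝ)))
  · have key : HasFDerivAt (fun p : Sg n => (p.2 + ∑ j, ‖p.1.1 j‖ ^ 2 : ℝ))
        (ContinuousLinearMap.snd ℝ (Hn n) ℝ +
      ∑ j, (((2 * (p.1.1 j).re) • (Complex.reCLM.comp ((ContinuousLinearMap.proj j).comp
      ((ContinuousLinearMap.fst ℝ (Fin n → ℂ) ℝ).comp (ContinuousLinearMap.fst ℝ (Hn n) ℝ)))))
      + ((2 * (p.1.1 j).im) • (Complex.imCLM.comp ((ContinuousLinearMap.proj j).comp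
      ((ContinuousLinearMap.fst ℝ (Fin n → ℂ) ℝ).comp (ContinuousLinearMap.fst ℝ (Hn n) ℝ))))))) p := by
      refine HasFDerivAt.add (ContinuousLinearMap.hasFDerivAt (ContinuousLinearMap.snd ℝ (Hn n) ℝ)) ?_
      refine HasFDerivAt.fun_sum (fun j _ => ?_)
      have e : ∀ p : Sg n, ‖p.1.1 j‖^2 = (p.1.1 j).re^2 + (p.1.1 j).im^2 := by
        intro p; rw [← Complex.normSq_eq_norm_sq, Complex.normSq_apply]; ring
      simp_rw [e]
      have hr := ContinuousLinearMap.hasFDerivAt (x := p) (Complex.reCLM.comp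
        ((ContinuousLinearMap.proj (R := ℝ) (φ := fun _ : Fin n => ℂ) j).comp
        ((ContinuousLinearMap.fst ℝ (Fin n → ℂ) ℝ).comp (ContinuousLinearMap.fst ℝ (Hn n) ℝ))))
      have hi := ContinuousLinearMap.hasFDerivAt (x := p) (Complex.imCLM.comp
        ((ContinuousLinearMap.proj (R := ℝ) (φ := fun _ : Fin n => ℂ) j).comp
        ((ContinuousLinearMap.fst ℝ (Fin n → ℂ) ℝ).comp (ContinuousLinearMap.fst ℝ (Hn n) ℝ))))
      have := (hr.pow 2).add (hi.pow 2)
      refine this.congr_fderiv ?_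
      apply ContinuousLinearMap.ext
      intro v
      simp
    exact ((Complex.ofRealCLM.hasFDerivAt.comp p key).const_mul Complex.I)

def bV (n : ℕ) (j : Fin n) : Vn n := (fun i => if i = j then (1 : ℂ) else 0, 0)
def b0 (n : ℕ) : Vn n := (0, 1)

lemma fderiv_comp_psi {n : ℕ} {G : Vn n → ℂ} {p : Sg n} (hG : DifferentiableAt ℂ G (psi n p))
    (v : Sg n) : fderiv ℝ (fun p => G (psi n p)) p v = fderiv ℂ G (psi n p) (psi' n p v) := by
  have h := (hG.hasFDerivAt.restrictScalars ℝ).comp p (hasFDerivAt_psi n p)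
  have h2 : HasFDerivAt (fun p => G (psi n p)) _ p := h
  rw [h2.fderiv]; rfl

lemma TS_psi {n : ℕ} {G : Vn n → ℂ} {p : Sg n} (hG : DifferentiableAt ℂ G (psi n p)) :
    TS n (fun p => G (psi n p)) p = fderiv ℂ G (psi n p) (b0 n) := by
  unfold TS dirD
  rw [fderiv_comp_psi hG]
  congr 1
  ext <;> simp [psi', eTS, eT, b0]

lemma DA_psi {n : ℕ} {G : Vn n → ℂ} {p : Sg n} (hG : DifferentiableAt ℂ G (psi n p)) :
    DA n (fun p => G (psi n p)) p = Complex.I * fderiv ℂ G (psi n p) (b0 n) := by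
  unfold DA dirD
  rw [fderiv_comp_psi hG, ← smul_eq_mul, ← map_smul]
  congr 1
  ext <;> simp [psi', eA, b0]

lemma XS_psi {n : ℕ} {G : Vn n → ℂ} {p : Sg n} (hG : DifferentiableAt ℂ G (psi n p)) (j : Fin n) :
    XS n j (fun p => G (psi n p)) p = fderiv ℂ G (psi n p) (bV n j) +
      2 * Complex.I * (starRingEnd ℂ) (p.1.1 j) * fderiv ℂ G (psi n p) (b0 n) := by
  have hT := TS_psi hG
  unfold TS dirD at hT
  unfold XS dirD
  rw [hT, fderiv_comp_psi hG]
  have : psi' n p (eXS n j) = bV n j + (2 * Complex.I * (p.1.1 j).re) • b0 n := by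
    ext i
    · simp [psi', eXS, eX, bV, b0]
    · simp [psi', eXS, eX, bV, b0, apply_ite]; ring
  rw [this, map_add, map_smul, smul_eq_mul]
  have h2 : (starRingEnd ℂ) (p.1.1 j) = (p.1.1 j).re - Complex.I * (p.1.1 j).im := by
    apply Complex.ext <;> simp
  rw [h2]
  linear_combination (-2 * ((p.1.1 j).im : ℂ) * fderiv ℂ G (psi n p) (b0 n)) * (-Complex.I_sq)

lemma YS_psi {n : ℕ} {G : Vn n → ℂ} {p : Sg n} (hG : DifferentiableAt ℂ G (psi n p)) (j : Fin n) :
    YS n j (fun p => G (psi n p)) p = Complex.I * (fderiv ℂ G (psi n p) (bV n j) +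
      2 * Complex.I * (starRingEnd ℂ) (p.1.1 j) * fderiv ℂ G (psi n p) (b0 n)) := by
  have hT := TS_psi hG
  unfold TS dirD at hT
  unfold YS dirD
  rw [hT, fderiv_comp_psi hG]
  have : psi' n p (eYS n j) = Complex.I • bV n j + (2 * Complex.I * (p.1.1 j).im) • b0 n := by
    ext i
    · simp [psi', eYS, eY, bV, b0]
    · simp [psi', eYS, eY, bV, b0, apply_ite]; ring
  rw [this, map_add, map_smul, map_smul, smul_eq_mul, smul_eq_mul]
  have h2 : (starRingEnd ℂ) (p.1.1 j) = (p.1.1 j).re - Complex.I * (p.1.1 j).im := by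
    apply Complex.ext <;> simp
  rw [h2]
  linear_combination (fderiv ℂ G (psi n p) (b0 n)) * (-2 * (p.1.1 j).re + 2 * Complex.I * (p.1.1 j).im) * (Complex.I_sq)

lemma isOpen_Un (n : ℕ) : IsOpen (Un n) := by
  unfold Un
  refine isOpen_lt ?_ ?_ <;> fun_prop

lemma isOpen_S (n : ℕ) : IsOpen {p : Sg n | 0 < p.2} := isOpen_lt continuous_const continuous_snd

/-- derivations are local on `S` -/
lemma fderiv_congr_S {n : ℕ} {F G : Sg n → ℂ} (h : ∀ p : Sg n, 0 < p.2 → F p = G p) {p : Sg n}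
    (hp : 0 < p.2) : fderiv ℝ F p = fderiv ℝ G p := by
  refine Filter.EventuallyEq.fderiv_eq ?_
  filter_upwards [(isOpen_S n).mem_nhds hp] with q hq using h q hq

lemma XS_congr {n : ℕ} (j : Fin n) {F G : Sg n → ℂ} (h : ∀ p : Sg n, 0 < p.2 → F p = G p) {p : Sg n}
    (hp : 0 < p.2) : XS n j F p = XS n j G p := by
  unfold XS dirD; rw [fderiv_congr_S h hp]
lemma YS_congr {n : ℕ} (j : Fin n) {F G : Sg n → ℂ} (h : ∀ p : Sg n, 0 < p.2 → F p = G p) {p : Sg n}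
    (hp : 0 < p.2) : YS n j F p = YS n j G p := by
  unfold YS dirD; rw [fderiv_congr_S h hp]
lemma TS_congr {n : ℕ} {F G : Sg n → ℂ} (h : ∀ p : Sg n, 0 < p.2 → F p = G p) {p : Sg n}
    (hp : 0 < p.2) : TS n F p = TS n G p := by
  unfold TS dirD; rw [fderiv_congr_S h hp]
lemma DA_congr {n : ℕ} {F G : Sg n → ℂ} (h : ∀ p : Sg n, 0 < p.2 → F p = G p) {p : Sg n}
    (hp : 0 < p.2) : DA n F p = DA n G p := by
  unfold DA dirD; rw [fderiv_congr_S h hp]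

lemma hasFDerivAt_conj {n : ℕ} (j : Fin n) (p : Sg n) :
    HasFDerivAt (fun p : Sg n => (starRingEnd ℂ) (p.1.1 j)) ((Complex.conjCLE : ℂ →L[ℝ] ℂ).comp
      ((ContinuousLinearMap.proj (R := ℝ) (φ := fun _ : Fin n => ℂ) j).comp
        ((ContinuousLinearMap.fst ℝ (Fin n → ℂ) ℝ).comp (ContinuousLinearMap.fst ℝ (Hn n) ℝ)))) p :=
  ContinuousLinearMap.hasFDerivAt ((Complex.conjCLE : ℂ →L[ℝ] ℂ).comp
      ((ContinuousLinearMap.proj (R := ℝ) (φ := fun _ : Fin n => ℂ) j).comp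
        ((ContinuousLinearMap.fst ℝ (Fin n → ℂ) ℝ).comp (ContinuousLinearMap.fst ℝ (Hn n) ℝ))))

lemma XS_mul {n : ℕ} (j : Fin n) {F G : Sg n → ℂ} {p : Sg n} (hF : DifferentiableAt ℝ F p)
    (hG : DifferentiableAt ℝ G p) : XS n j (fun p => F p * G p) p = XS n j F p * G p + F p * XS n j G p := by
  unfold XS dirD; rw [fderiv_mul_C hF hG, fderiv_mul_C hF hG]; ring
lemma YS_mul {n : ℕ} (j : Fin n) {F G : Sg n → ℂ} {p : Sg n} (hF : DifferentiableAt ℝ F p)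
    (hG : DifferentiableAt ℝ G p) : YS n j (fun p => F p * G p) p = YS n j F p * G p + F p * YS n j G p := by
  unfold YS dirD; rw [fderiv_mul_C hF hG, fderiv_mul_C hF hG]; ring
lemma XS_add {n : ℕ} (j : Fin n) {F G : Sg n → ℂ} {p : Sg n} (hF : DifferentiableAt ℝ F p)
    (hG : DifferentiableAt ℝ G p) : XS n j (fun p => F p + G p) p = XS n j F p + XS n j G p := by
  unfold XS dirD; rw [fderiv_fun_add hF hG]; simp; ring
lemma YS_add {n : ℕ} (j : Fin n) {F G : Sg n → ℂ} {p : Sg n} (hF : DifferentiableAt ℝ F p)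
    (hG : DifferentiableAt ℝ G p) : YS n j (fun p => F p + G p) p = YS n j F p + YS n j G p := by
  unfold YS dirD; rw [fderiv_fun_add hF hG]; simp; ring

lemma XS_cc {n : ℕ} (j : Fin n) (p : Sg n) :
    XS n j (fun p : Sg n => 2 * Complex.I * (starRingEnd ℂ) (p.1.1 j)) p = 2 * Complex.I := by
  unfold XS dirD
  rw [((hasFDerivAt_conj j p).const_mul (2 * Complex.I)).fderiv]
  simp [eXS, eX, eTS, eT]
lemma YS_cc {n : ℕ} (j : Fin n) (p : Sg n) :
    YS n j (fun p : Sg n => 2 * Complex.I * (starRingEnd ℂ) (p.1.1 j)) p = 2 := by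
  unfold YS dirD
  rw [((hasFDerivAt_conj j p).const_mul (2 * Complex.I)).fderiv]
  simp [eYS, eY, eTS, eT, mul_assoc]

section holo
variable {n : ℕ} {F : Sg n → ℂ}

lemma diffAt_psi {G : Vn n → ℂ} {p : Sg n} (hG : DifferentiableAt ℂ G (psi n p)) :
    DifferentiableAt ℝ (fun p => G (psi n p)) p :=
  ((hG.hasFDerivAt.restrictScalars ℝ).comp p (hasFDerivAt_psi n p)).differentiableAt

lemma holo_second {G : Vn n → ℂ} (hG : DifferentiableOn ℂ G (Un n)) {p : Sg n} (hp : 0 < p.2)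
    (j : Fin n) :
    XS n j (XS n j (fun p => G (psi n p))) p + YS n j (YS n j (fun p => G (psi n p))) p
      = 4 * Complex.I * TS n (fun p => G (psi n p)) p := by
  have hd : ∀ {K : Vn n → ℂ}, DifferentiableOn ℂ K (Un n) → ∀ p : Sg n, 0 < p.2 →
    DifferentiableAt ℂ K (psi n p) := fun hK p hp => hK.differentiableAt ((isOpen_Un n).mem_nhds (psi_mem hp))
  set A : Vn n → ℂ := fun z => fderiv ℂ G z (bV n j) with hA
  set B : Vn n → ℂ := fun z => fderiv ℂ G z (b0 n) with hB
  have dA : DifferentiableOn ℂ A (Un n) := osgood_step (isOpen_Un n) hG _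
  have dB : DifferentiableOn ℂ B (Un n) := osgood_step (isOpen_Un n) hG _
  have e1 : ∀ q : Sg n, 0 < q.2 → XS n j (fun p => G (psi n p)) q =
      (fun q => A (psi n q) + (2 * Complex.I * (starRingEnd ℂ) (q.1.1 j)) * B (psi n q)) q :=
    fun q hq => XS_psi (hd hG q hq) j
  have e2 : ∀ q : Sg n, 0 < q.2 → YS n j (fun p => G (psi n p)) q =
      (fun q => Complex.I * (A (psi n q) + (2 * Complex.I * (starRingEnd ℂ) (q.1.1 j)) * B (psi n q))) q :=
    fun q hq => YS_psi (hd hG q hq) j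
  have d1 := diffAt_psi (hd dA p hp)
  have d2 := diffAt_psi (hd dB p hp)
  have d3 := ((hasFDerivAt_conj j p).const_mul (2 * Complex.I)).differentiableAt
  have d4 : DifferentiableAt ℝ (fun q : Sg n => (2 * Complex.I * (starRingEnd ℂ) (q.1.1 j)) * B (psi n q)) p :=
    d3.mul d2
  have d5 : DifferentiableAt ℝ (fun q : Sg n => A (psi n q) + (2 * Complex.I * (starRingEnd ℂ) (q.1.1 j)) * B (psi n q)) p :=
    d1.add d4
  rw [XS_congr j e1 hp, YS_congr j e2 hp, TS_psi (hd hG p hp)]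
  rw [YS_mul j (F := fun _ => Complex.I) (differentiableAt_const _) d5,
    XS_add j d1 d4, YS_add j d1 d4, XS_mul j d3 d2, YS_mul j d3 d2, XS_cc, YS_cc,
    XS_psi (hd dA p hp), XS_psi (hd dB p hp), YS_psi (hd dA p hp), YS_psi (hd dB p hp)]
  have : YS n j (fun _ => Complex.I) p = 0 := by simp [YS, dirD]
  rw [this]
  have hBB : fderiv ℂ G (psi n p) (b0 n) = B (psi n p) := rfl
  rw [hBB]
  ring_nf
  simp only [Complex.I_sq]
  rw [show Complex.I^3 = -Complex.I by rw [pow_succ, Complex.I_sq]; ring, Complex.I_pow_four]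
  ring

lemma holo_Lalpha {G : Vn n → ℂ} (hG : DifferentiableOn ℂ G (Un n)) {p : Sg n} (hp : 0 < p.2)
    (α : ℝ) : Lalpha n α (fun p => G (psi n p)) p = 0 := by
  have hd : ∀ {K : Vn n → ℂ}, DifferentiableOn ℂ K (Un n) → ∀ p : Sg n, 0 < p.2 →
    DifferentiableAt ℂ K (psi n p) := fun hK p hp => hK.differentiableAt ((isOpen_Un n).mem_nhds (psi_mem hp))
  set B : Vn n → ℂ := fun z => fderiv ℂ G z (b0 n) with hB
  have dB : DifferentiableOn ℂ B (Un n) := osgood_step (isOpen_Un n) hG _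
  have dB' : DifferentiableOn ℂ (fun z => Complex.I * B z) (Un n) := dB.const_mul _
  have e1 : ∀ q : Sg n, 0 < q.2 → TS n (fun p => G (psi n p)) q = (fun q => B (psi n q)) q :=
    fun q hq => TS_psi (hd hG q hq)
  have e2 : ∀ q : Sg n, 0 < q.2 → DA n (fun p => G (psi n p)) q = (fun q => Complex.I * B (psi n q)) q :=
    fun q hq => DA_psi (hd hG q hq)
  have hL : LS0 n (fun p => G (psi n p)) p + (n:ℂ) * DA n (fun p => G (psi n p)) p = 0 := by
    unfold LS0
    simp_rw [fun j => holo_second hG hp j, e1 p hp, e2 p hp]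
    simp; ring
  unfold Lalpha
  rw [hL, DA_congr e2 hp, TS_congr e1 hp, DA_psi (G := fun z => Complex.I * B z) (hd dB' p hp),
    TS_psi (hd dB p hp), fderiv_const_mul (hd dB p hp)]
  simp only [smul_apply, smul_eq_mul, ← mul_assoc, Complex.I_mul_I]
  ring

lemma slice_fderiv {G : Sg n → ℂ} {w : Hn n} {a : ℝ} (hG : DifferentiableAt ℝ G (w,a)) (v : Hn n) :
    fderiv ℝ (fun w => G (w, a)) w v = fderiv ℝ G (w,a) (v, 0) := by
  have h := hG.hasFDerivAt.comp w (hasFDerivAt_prodMk_left (𝕜 := ℝ) w a)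
  have h2 : HasFDerivAt (fun w => G (w, a)) _ w := h
  rw [h2.fderiv]; simp

lemma XH_slice {G : Sg n → ℂ} {w : Hn n} {a : ℝ} (hG : DifferentiableAt ℝ G (w,a)) (j : Fin n) :
    XH n j (fun w => G (w, a)) w = XS n j G (w, a) := by
  unfold XH XS dirD; rw [slice_fderiv hG, slice_fderiv hG]; rfl
lemma YH_slice {G : Sg n → ℂ} {w : Hn n} {a : ℝ} (hG : DifferentiableAt ℝ G (w,a)) (j : Fin n) :
    YH n j (fun w => G (w, a)) w = YS n j G (w, a) := by
  unfold YH YS dirD; rw [slice_fderiv hG, slice_fderiv hG]; rfl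
lemma TH_slice {G : Sg n → ℂ} {w : Hn n} {a : ℝ} (hG : DifferentiableAt ℝ G (w,a)) :
    TH n (fun w => G (w, a)) w = TS n G (w, a) := by
  unfold TH TS dirD; rw [slice_fderiv hG]; rfl

lemma contDiffOn_dirS {F : Sg n → ℂ} {m : WithTop ℕ∞} (hF : ContDiffOn ℝ (m+1) F {p : Sg n | 0 < p.2})
    (v : Sg n) : ContDiffOn ℝ m (fun p => dirD v F p) {p : Sg n | 0 < p.2} := by
  unfold dirD
  exact (hF.fderiv_of_isOpen (isOpen_S n) le_rfl).clm_apply contDiffOn_const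

lemma contDiffOn_XS {F : Sg n → ℂ} {m : WithTop ℕ∞} (hF : ContDiffOn ℝ (m+1) F {p : Sg n | 0 < p.2})
    (j : Fin n) : ContDiffOn ℝ m (XS n j F) {p : Sg n | 0 < p.2} := by
  unfold XS
  refine (contDiffOn_dirS hF _).add ((contDiff_const.mul ?_).contDiffOn.mul (contDiffOn_dirS hF _))
  exact (contDiff_im j).comp contDiff_fst
lemma contDiffOn_YS {F : Sg n → ℂ} {m : WithTop ℕ∞} (hF : ContDiffOn ℝ (m+1) F {p : Sg n | 0 < p.2})
    (j : Fin n) : ContDiffOn ℝ m (YS n j F) {p : Sg n | 0 < p.2} := by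
  unfold YS
  refine (contDiffOn_dirS hF _).sub ((contDiff_const.mul ?_).contDiffOn.mul (contDiffOn_dirS hF _))
  exact (contDiff_re j).comp contDiff_fst

lemma diffAt_of_S {F : Sg n → ℂ} (hF : ContDiffOn ℝ 1 F {p : Sg n | 0 < p.2}) {p : Sg n} (hp : 0 < p.2) :
    DifferentiableAt ℝ F p :=
  (hF.differentiableOn one_ne_zero).differentiableAt ((isOpen_S n).mem_nhds hp)

lemma LH_slice {F : Sg n → ℂ} (hF : ContDiffOn ℝ 2 F {p : Sg n | 0 < p.2}) {a : ℝ} (ha : 0 < a)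
    (w : Hn n) (α : ℝ) :
    LH n α (fun w => F (w, a)) w = LS0 n F (w,a) + Complex.I * α * TS n F (w, a) := by
  have hF1 : ContDiffOn ℝ 1 F {p : Sg n | 0 < p.2} := hF.of_le (by norm_num)
  have hF2 : ContDiffOn ℝ (1+1) F {p : Sg n | 0 < p.2} := by
    rw [one_add_one_eq_two]; exact hF
  have e1 : ∀ j, XH n j (fun w => F (w, a)) = fun w => XS n j F (w, a) := fun j => by
    ext w; exact XH_slice (diffAt_of_S hF1 ha) j
  have e2 : ∀ j, YH n j (fun w => F (w, a)) = fun w => YS n j F (w, a) := fun j => by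
    ext w; exact YH_slice (diffAt_of_S hF1 ha) j
  unfold LH LS0
  simp_rw [e1, e2]
  rw [TH_slice (diffAt_of_S hF1 ha)]
  congr 3
  ext j
  rw [XH_slice (diffAt_of_S (contDiffOn_XS hF2 j) ha), YH_slice (diffAt_of_S (contDiffOn_YS hF2 j) ha)]

lemma holo_LH {F : Sg n → ℂ} (hF : ContDiffOn ℝ 2 F {p : Sg n | 0 < p.2}) (hh : IsHolo n F)
    {a : ℝ} (ha : 0 < a) (w : Hn n) : LH n (n:ℝ) (fun w => F (w, a)) w = 0 := by
  rw [LH_slice hF ha]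
  have e : F = fun p => Fu n F (psi n p) := by ext p; exact (Fu_psi n F p).symm
  set G := Fu n F
  have hG : DifferentiableOn ℂ G (Un n) := hh
  rw [e]
  unfold LS0
  have hp : 0 < ((w, a) : Sg n).2 := ha
  simp_rw [fun j => holo_second hG hp j]
  simp; ring

lemma slice_contDiff {F : Sg n → ℂ} {m : WithTop ℕ∞} (hF : ContDiffOn ℝ m F {p : Sg n | 0 < p.2})
    {a : ℝ} (ha : 0 < a) : ContDiff ℝ m (fun w : Hn n => F (w, a)) := by
  rw [← contDiffOn_univ]
  exact hF.comp (contDiff_id.prodMk contDiff_const).contDiffOn (fun w _ => ha)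
end holo

lemma contDiff_LH {n : ℕ} {f : Hn n → ℂ} (hf : ContDiff ℝ 2 f) (α : ℝ) : Continuous (LH n α f) := by
  have h2 : ContDiff ℝ (1+1) f := by rw [one_add_one_eq_two]; exact hf
  have h1 : ContDiff ℝ (0+1) f := hf.of_le (by norm_num)
  have cx := fun j => (contDiff_XH (m := 0) (by rw [zero_add]; exact contDiff_XH h2 j) j).continuous
  have cy := fun j => (contDiff_YH (m := 0) (by rw [zero_add]; exact contDiff_YH h2 j) j).continuous
  have ct := (contDiff_TH h1).continuous
  unfold LH
  fun_prop

theorem forward (n : ℕ) (F : Sg n → ℂ)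
    (hFsmooth : ContDiffOn ℝ (⊤ : ℕ∞) F {p : Sg n | 0 < p.2})
    (f : Hn n → ℂ) (hfsmooth : ContDiff ℝ (⊤ : ℕ∞) f)
    (hbv : IsBoundaryValue n F f) (hh : IsHolo n F) (w : Hn n) : LH n (n : ℝ) f w = 0 := by
  have hF2 : ContDiffOn ℝ 2 F {p : Sg n | 0 < p.2} := hFsmooth.of_le (two_le_inf)
  have hf2 : ContDiff ℝ 2 f := hfsmooth.of_le (two_le_inf)
  have hcont := contDiff_LH hf2 (n:ℝ)
  have hae : ∀ᵐ x, LH n (n:ℝ) f x = 0 := by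
    refine ae_eq_zero_of_integral_contDiff_smul_eq_zero hcont.locallyIntegrable ?_
    intro g hg hgc
    set φ : Hn n → ℂ := fun x => (g x : ℂ) with hφ
    have hφ2 : ContDiff ℝ 2 φ := Complex.ofRealCLM.contDiff.comp (hg.of_le (two_le_inf))
    have hφc : HasCompactSupport φ := hgc.comp_left (g := fun x : ℝ => (x:ℂ)) (by simp)
    have e : ∀ x, g x • LH n (n:ℝ) f x = LH n (n:ℝ) f x * φ x := by
      intro x; rw [Complex.real_smul, mul_comm]
    simp_rw [e]
    rw [weak_identity hf2 hφ2 hφc]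
    have hcs : HasCompactSupport (LH n (-(n:ℝ)) φ) := by
      unfold LH
      refine HasCompactSupport.add ?_ ?_
      · refine HasCompactSupport.mul_left ?_
        refine HasCompactSupport.intro hφc (fun x hx => ?_)
        refine Finset.sum_eq_zero (fun j _ => ?_)
        have hx1 : ∀ ψ : Hn n → ℂ, x ∉ tsupport ψ → fderiv ℝ ψ x = 0 := fun ψ h => by
          by_contra h3
          exact h (support_fderiv_subset ℝ h3)
        have t1 : x ∉ tsupport (XH n j φ) := by
          intro h
          apply hx
          refine closure_minimal ?_ (isClosed_tsupport _) h
          intro y hy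
          rw [Function.mem_support, XH_eq] at hy
          by_contra h4
          apply hy
          have : fderiv ℝ φ y = 0 := by
            by_contra h3
            exact h4 (support_fderiv_subset ℝ h3)
          simp [this]
        have t2 : x ∉ tsupport (YH n j φ) := by
          intro h
          apply hx
          refine closure_minimal ?_ (isClosed_tsupport _) h
          intro y hy
          rw [Function.mem_support, YH_eq] at hy
          by_contra h4
          apply hy
          have : fderiv ℝ φ y = 0 := by
            by_contra h3
            exact h4 (support_fderiv_subset ℝ h3)
          simp [this]
        rw [XH_eq, YH_eq, hx1 _ t1, hx1 _ t2]; simp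
      · exact HasCompactSupport.mul_left (hcs_fderiv hφc (fun _ => eT n))
    have hlim := hbv (LH n (-(n:ℝ)) φ) ((contDiff_LH hφ2 _).integrable_of_hasCompactSupport hcs)
    refine tendsto_nhds_unique hlim ?_
    refine tendsto_const_nhds.congr' ?_
    filter_upwards [self_mem_nhdsWithin] with a ha
    have ha : 0 < a := ha
    rw [← weak_identity (slice_contDiff hF2 ha) hφ2 hφc]
    simp [holo_LH hF2 hh ha]
  have := (hcont.ae_eq_iff_eq volume (continuous_const (y := (0:ℂ)))).1 hae
  exact congrFun this w
end

section

/-- group multiplication -/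
def gm {n : ℕ} (v w : Hn n) : Hn n :=
  (v.1 + w.1, v.2 + w.2 + 2 * (∑ k, v.1 k * (starRingEnd ℂ) (w.1 k)).im)

lemma continuous_gm {n : ℕ} : Continuous (fun p : Hn n × Hn n => gm p.1 p.2) := by
  unfold gm
  have : Continuous (fun p : Hn n × Hn n => ∑ k, p.1.1 k * (starRingEnd ℂ) (p.2.1 k)) := by
    refine continuous_finsetSum _ (fun k _ => ?_)
    refine Continuous.mul (by fun_prop) (Complex.continuous_conj.comp (by fun_prop))
  have h2 := Complex.continuous_im.comp this
  refine Continuous.prodMk (by fun_prop) ?_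
  exact (by fun_prop : Continuous (fun p : Hn n × Hn n => p.1.2 + p.2.2)).add (continuous_const.mul h2)

lemma shear_mp {n : ℕ} (c : Fin n → ℂ) (l : (Fin n → ℂ) → ℝ) (hl : Continuous l) :
    MeasurePreserving (fun p : Hn n => ((p.1 + c, p.2 + l p.1) : Hn n)) volume volume := by
  have h := MeasurePreserving.skew_product (μa := (volume : Measure (Fin n → ℂ)))
    (μb := (volume : Measure (Fin n → ℂ))) (μc := (volume : Measure ℝ)) (μd := (volume : Measure ℝ))
    (f := fun x => x + c) (measurePreserving_add_right volume c)
    (g := fun x t => t + l x) (by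
      unfold Function.uncurry
      exact (by fun_prop : Continuous (fun p : (Fin n → ℂ) × ℝ => p.2 + l p.1)).measurable)
    (Eventually.of_forall (fun x => (measurePreserving_add_right volume (l x)).map_eq))
  exact h

lemma gm_right_mp {n : ℕ} (w : Hn n) : MeasurePreserving (fun v : Hn n => gm v w) volume volume := by
  have h := shear_mp w.1 (fun ζ => w.2 + 2 * (∑ k, ζ k * (starRingEnd ℂ) (w.1 k)).im) (by
    refine continuous_const.add (continuous_const.mul (Complex.continuous_im.comp ?_))
    fun_prop)
  convert h using 1
  ext v <;> simp [gm, add_assoc]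

lemma gm_left_mp {n : ℕ} (v : Hn n) : MeasurePreserving (fun w : Hn n => gm v w) volume volume := by
  have h := shear_mp v.1 (fun ζ => v.2 + 2 * (∑ k, v.1 k * (starRingEnd ℂ) (ζ k)).im) (by
    refine continuous_const.add (continuous_const.mul (Complex.continuous_im.comp ?_))
    refine continuous_finsetSum _ (fun k _ => ?_)
    exact continuous_const.mul (Complex.continuous_conj.comp (by fun_prop)))
  convert h using 1
  ext w <;> simp [gm] <;> ring

def ginv {n : ℕ} (w : Hn n) : Hn n := (-w.1, -w.2)

lemma im_self {n : ℕ} (x : Fin n → ℂ) : (∑ k, x k * (starRingEnd ℂ) (x k)).im = 0 := by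
  simp [Complex.mul_conj]

lemma gm_ginv_cancel {n : ℕ} (v w : Hn n) : gm (gm v w) (ginv w) = v := by
  have h := im_self w.1
  simp only [Complex.im_sum] at h
  ext i
  · simp [gm, ginv]
  · simp only [gm, ginv, Pi.neg_apply, Pi.add_apply, map_neg, mul_neg, add_mul, Finset.sum_neg_distrib,
      Finset.sum_add_distrib, Complex.neg_im, Complex.add_im, Complex.im_sum]
    rw [h]; ring

lemma gm_ginv_cancel' {n : ℕ} (v w : Hn n) : gm (gm v (ginv w)) w = v := by
  have := gm_ginv_cancel v (ginv w)
  simpa [ginv] using this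

lemma ginv_gm_cancel {n : ℕ} (v w : Hn n) : gm (ginv v) (gm v w) = w := by
  have h := im_self v.1
  simp only [Complex.im_sum] at h
  ext i
  · simp [gm, ginv]
  · simp only [gm, ginv, Pi.neg_apply, Pi.add_apply, map_add, mul_add, neg_mul, Finset.sum_neg_distrib,
      Finset.sum_add_distrib, Complex.neg_im, Complex.add_im, Complex.im_sum]
    rw [h]; ring

lemma gm_ginv_cancel'' {n : ℕ} (v w : Hn n) : gm v (gm (ginv v) w) = w := by
  have := ginv_gm_cancel (ginv v) w
  simpa [ginv] using this

lemma continuous_ginv {n : ℕ} : Continuous (ginv : Hn n → Hn n) := by unfold ginv; fun_prop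

lemma continuous_gm_right {n : ℕ} (w : Hn n) : Continuous (fun v : Hn n => gm v w) :=
  continuous_gm.comp (continuous_id.prodMk continuous_const)
lemma continuous_gm_left {n : ℕ} (v : Hn n) : Continuous (fun w : Hn n => gm v w) :=
  continuous_gm.comp (continuous_const.prodMk continuous_id)

def gmRightHomeo {n : ℕ} (w : Hn n) : Hn n ≃ₜ Hn n where
  toFun v := gm v w
  invFun v := gm v (ginv w)
  left_inv v := gm_ginv_cancel v w
  right_inv v := gm_ginv_cancel' v w
  continuous_toFun := continuous_gm_right w
  continuous_invFun := continuous_gm_right _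

def gmLeftHomeo {n : ℕ} (v : Hn n) : Hn n ≃ₜ Hn n where
  toFun w := gm v w
  invFun w := gm (ginv v) w
  left_inv w := ginv_gm_cancel v w
  right_inv w := gm_ginv_cancel'' v w
  continuous_toFun := continuous_gm_left v
  continuous_invFun := continuous_gm_left _

lemma integral_gm_right {n : ℕ} (w : Hn n) (h : Hn n → ℂ) : ∫ v, h (gm v w) = ∫ v, h v :=
  (gm_right_mp w).integral_comp (gmRightHomeo w).measurableEmbedding h

lemma integral_gm_left {n : ℕ} (v : Hn n) (h : Hn n → ℂ) : ∫ w, h (gm v w) = ∫ w, h w :=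
  (gm_left_mp v).integral_comp (gmLeftHomeo v).measurableEmbedding h

/-- left translation on `S` -/
def GS {n : ℕ} (v : Hn n) (p : Sg n) : Sg n := (gm v p.1, p.2)

lemma continuous_GS {n : ℕ} : Continuous (fun q : Hn n × Sg n => GS q.1 q.2) := by
  unfold GS
  exact (continuous_gm.comp (continuous_fst.prodMk (continuous_fst.comp continuous_snd))).prodMk
    (continuous_snd.comp continuous_snd)

/-- Invariant vector field data. -/
structure IField (n : ℕ) where
  D : (Sg n → ℂ) → Sg n → ℂ
  V : Sg n → Sg n
  hD : ∀ f p, D f p = fderiv ℝ f p (V p)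
  hV : ∀ p (s : ℝ), V (p + s • V p) = V p
  hG : ∀ v p (s : ℝ), GS v (p + s • V p) = GS v p + s • V (GS v p)
  hC : ∀ (m : WithTop ℕ∞) f, ContDiffOn ℝ (m+1) f {p : Sg n | 0 < p.2} →
    ContDiffOn ℝ m (D f) {p : Sg n | 0 < p.2}

lemma sum_aux {n : ℕ} (v p : Fin n → ℂ) (j : Fin n) (s : ℝ) (e : ℂ) :
    (∑ k, v k * (starRingEnd ℂ) (p k + s * (if k = j then e else 0))).im =
    (∑ k, v k * (starRingEnd ℂ) (p k)).im + s * (v j * (starRingEnd ℂ) e).im := by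
  have : ∀ k, v k * (starRingEnd ℂ) (p k + s * (if k = j then e else 0)) =
      v k * (starRingEnd ℂ) (p k) + (if k = j then (s:ℂ) * (v j * (starRingEnd ℂ) e) else 0) := by
    intro k
    split_ifs with h
    · subst h; simp; ring
    · simp
  simp_rw [this]
  rw [Finset.sum_add_distrib, Finset.sum_ite_eq' Finset.univ j]
  simp

def IFX (n : ℕ) (j : Fin n) : IField n where
  D := XS n j
  V p := (vX n j p.1, 0)
  hD f p := by
    have : ((vX n j p.1, 0) : Sg n) = eXS n j + (2 * (p.1.1 j).im) • eTS n := by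
      simp [vX, eXS, eTS]
    rw [this, map_add, map_smul]
    simp [XS, dirD]
  hV p s := by simp [vX, eX, eT]
  hG v p s := by
    ext i
    · simp [GS, gm, vX, eX, eT, add_assoc]
    · have := sum_aux v.1 p.1.1 j s 1
      simp only [GS, gm, vX, eX, eT, Prod.fst_add, Prod.snd_add, Prod.smul_fst, Prod.smul_snd,
        Pi.add_apply, Pi.smul_apply, Complex.real_smul, smul_zero, add_zero, zero_add, smul_eq_mul, mul_one]
      rw [this]; simp; ring
    · simp [GS]
  hC m f hf := contDiffOn_XS hf j

def IFY (n : ℕ) (j : Fin n) : IField n where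
  D := YS n j
  V p := (vY n j p.1, 0)
  hD f p := by
    have : ((vY n j p.1, 0) : Sg n) = eYS n j + (-(2 * (p.1.1 j).re)) • eTS n := by
      simp [vY, eYS, eTS]
    rw [this, map_add, map_smul]
    simp [YS, dirD]; ring
  hV p s := by simp [vY, eY, eT]
  hG v p s := by
    ext i
    · simp [GS, gm, vY, eY, eT, add_assoc]
    · have := sum_aux v.1 p.1.1 j s Complex.I
      simp only [GS, gm, vY, eY, eT, Prod.fst_add, Prod.snd_add, Prod.smul_fst, Prod.smul_snd,
        Pi.add_apply, Pi.smul_apply, Complex.real_smul, smul_zero, add_zero, zero_add, smul_eq_mul, mul_one]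
      rw [this]; simp; ring
    · simp [GS]
  hC m f hf := contDiffOn_YS hf j

def IFT (n : ℕ) : IField n where
  D := TS n
  V _ := eTS n
  hD f p := rfl
  hV p s := rfl
  hG v p s := by
    ext i
    · simp [GS, gm, eTS, eT]
    · simp [GS, gm, eTS, eT]; ring
    · simp [GS, eTS]
  hC m f hf := contDiffOn_dirS hf _

def IFA (n : ℕ) : IField n where
  D := DA n
  V _ := eA n
  hD f p := rfl
  hV p s := rfl
  hG v p s := by
    ext i
    · simp [GS, gm, eA]
    · simp [GS, gm, eA]
    · simp [GS, eA]
  hC m f hf := contDiffOn_dirS hf _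

/-- derivative along the field -/
lemma IField.line {n : ℕ} (I : IField n) {W : Sg n → ℂ} {p : Sg n} {s : ℝ}
    (hW : DifferentiableAt ℝ W (p + s • I.V p)) :
    HasDerivAt (fun s : ℝ => W (p + s • I.V p)) (I.D W (p + s • I.V p)) s := by
  have h2 : HasDerivAt (fun s : ℝ => p + s • I.V p) (I.V p) s := by
    simpa using ((hasDerivAt_id s).smul_const (I.V p)).const_add p
  have := hW.hasFDerivAt.comp_hasDerivAt s h2
  rw [I.hD, I.hV]
  exact this

/-- smoothing -/
def sm {n : ℕ} (φ : Hn n → ℂ) (W : Sg n → ℂ) (p : Sg n) : ℂ := ∫ v, φ v * W (GS v p)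

lemma sm_line {n : ℕ} (I : IField n) {W : Sg n → ℂ} (hW : ContDiffOn ℝ 1 W {p : Sg n | 0 < p.2})
    {φ : Hn n → ℂ} (hφ : Continuous φ) (hc : HasCompactSupport φ) {p : Sg n} (hp : 0 < p.2) :
    HasDerivAt (fun s : ℝ => sm φ W (p + s • I.V p)) (sm φ (I.D W) p) 0 := by
  have hDW : ContinuousOn (I.D W) {p : Sg n | 0 < p.2} := (I.hC 0 W (by simpa using hW)).continuousOn
  have hline : Continuous (fun s : ℝ => p + s • I.V p) := by fun_prop
  have hS : {s : ℝ | 0 < (p + s • I.V p).2} ∈ 𝓝 (0:ℝ) := by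
    refine (isOpen_lt continuous_const (continuous_snd.comp hline)).mem_nhds ?_
    simpa using hp
  obtain ⟨δ, hδ, hδS⟩ := Metric.nhds_basis_closedBall.mem_iff.1 hS
  have hmemG : ∀ v : Hn n, ∀ q : Sg n, 0 < q.2 → 0 < (GS v q).2 := fun v q hq => hq
  have hcontG : ContinuousOn (fun q : Hn n × ℝ => I.D W (GS q.1 (p + q.2 • I.V p)))
      (univ ×ˢ Metric.closedBall 0 δ) := by
    refine hDW.comp (continuous_GS.comp (continuous_fst.prodMk (hline.comp continuous_snd))).continuousOn ?_
    rintro ⟨v, s⟩ ⟨_, hs⟩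
    exact hδS hs
  have hcontW : ∀ s ∈ Metric.closedBall (0:ℝ) δ, Continuous (fun v => φ v * W (GS v (p + s • I.V p))) := by
    intro s hs
    refine hφ.mul ?_
    rw [← continuousOn_univ]
    refine hW.continuousOn.comp (continuous_GS.comp (continuous_id.prodMk continuous_const)).continuousOn ?_
    intro v _; exact hδS hs
  have hcontDW : ∀ s ∈ Metric.closedBall (0:ℝ) δ, Continuous (fun v => φ v * I.D W (GS v (p + s • I.V p))) := by
    intro s hs
    refine hφ.mul ?_
    rw [← continuousOn_univ]
    refine hDW.comp (continuous_GS.comp (continuous_id.prodMk continuous_const)).continuousOn ?_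
    intro v _; exact hδS hs
  obtain ⟨C, hC⟩ := ((show IsCompact (tsupport φ) from hc).prod (isCompact_closedBall (0:ℝ) δ)).exists_bound_of_continuousOn
    (hcontG.mono (prod_mono (subset_univ _) subset_rfl))
  have h := hasDerivAt_integral_of_dominated_loc_of_deriv_le (μ := (volume : Measure (Hn n)))
    (F := fun s v => φ v * W (GS v (p + s • I.V p)))
    (F' := fun s v => φ v * I.D W (GS v (p + s • I.V p)))
    (x₀ := (0:ℝ)) (s := Metric.ball 0 δ) (bound := fun v => ‖φ v‖ * C) (Metric.ball_mem_nhds _ hδ) ?_ ?_ ?_ ?_ ?_ ?_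
  · have h2 := h.2
    simp only [zero_smul, add_zero] at h2
    exact h2
  · filter_upwards [Metric.ball_mem_nhds _ hδ] with s hs
    exact (hcontW s (Metric.ball_subset_closedBall hs)).aestronglyMeasurable
  · exact (hcontW 0 (Metric.mem_closedBall_self hδ.le)).integrable_of_hasCompactSupport hc.mul_right
  · exact (hcontDW 0 (Metric.mem_closedBall_self hδ.le)).aestronglyMeasurable
  · refine Eventually.of_forall (fun v s hs => ?_)
    rw [norm_mul]
    by_cases hv : v ∈ tsupport φ
    · gcongr
      exact hC (v, s) ⟨hv, Metric.ball_subset_closedBall hs⟩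
    · simp [image_eq_zero_of_notMem_tsupport hv]
  · exact (hφ.norm.mul continuous_const).integrable_of_hasCompactSupport (hc.norm.mul_right)
  · refine Eventually.of_forall (fun v s hs => ?_)
    refine HasDerivAt.const_mul _ ?_
    have e : ∀ s : ℝ, GS v (p + s • I.V p) = GS v p + s • I.V (GS v p) := I.hG v p
    simp_rw [e]
    refine I.line ?_
    rw [← e]
    exact diffAt_of_S hW (hδS (Metric.ball_subset_closedBall hs))

/-- two-jet along a line -/
def J2 (g : ℝ → ℝ) (d1 d2 : ℝ) : Prop :=
  ∃ g' : ℝ → ℝ, (∀ᶠ s in 𝓝 (0:ℝ), HasDerivAt g (g' s) s) ∧ g' 0 = d1 ∧ HasDerivAt g' d2 0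

lemma J2.add {g h : ℝ → ℝ} {a b c d : ℝ} (h1 : J2 g a b) (h2 : J2 h c d) :
    J2 (fun s => g s + h s) (a + c) (b + d) := by
  obtain ⟨g', hg, rfl, hg2⟩ := h1
  obtain ⟨h', hh, rfl, hh2⟩ := h2
  refine ⟨fun s => g' s + h' s, ?_, rfl, hg2.add hh2⟩
  filter_upwards [hg, hh] with s h3 h4 using h3.add h4

lemma J2.const_mul {g : ℝ → ℝ} {a b : ℝ} (c : ℝ) (h1 : J2 g a b) :
    J2 (fun s => c * g s) (c * a) (c * b) := by
  obtain ⟨g', hg, rfl, hg2⟩ := h1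
  refine ⟨fun s => c * g' s, ?_, rfl, hg2.const_mul c⟩
  filter_upwards [hg] with s h3 using h3.const_mul c

lemma J2.max {g : ℝ → ℝ} {a b : ℝ} (h : J2 g a b) (hm : IsLocalMax g 0) : a = 0 ∧ b ≤ 0 := by
  obtain ⟨g', hg, rfl, hg2⟩ := h
  have h0 : g' 0 = 0 := hm.hasDerivAt_eq_zero hg.self_of_nhds
  refine ⟨h0, ?_⟩
  by_contra hb
  push Not at hb
  have hd : deriv g =ᶠ[𝓝 0] g' := by filter_upwards [hg] with s hs using hs.deriv
  have hmin : IsLocalMin g 0 := by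
    refine isLocalMin_of_deriv_deriv_pos ?_ ?_ ?_
    · rw [hd.deriv_eq, hg2.deriv]; exact hb
    · rw [hd.self_of_nhds, h0]
    · exact hg.self_of_nhds.continuousAt
  have hconst : g =ᶠ[𝓝 0] fun _ => g 0 := by
    filter_upwards [hm, hmin] with s h1 h2 using le_antisymm h1 h2
  have hg'0 : g' =ᶠ[𝓝 0] fun _ => 0 := by
    filter_upwards [hg, eventually_eventually_nhds.2 hconst] with s h1 h2
    rw [← h1.deriv, EventuallyEq.deriv_eq (f := fun _ => g 0) h2]; simp
  have : b = 0 := by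
    rw [← hg2.deriv, hg'0.deriv_eq]; simp
  linarith

lemma J2_re {n : ℕ} (I : IField n) {W : Sg n → ℂ} {W1 : Sg n → ℂ} {w2 : ℂ} (c : ℂ) {p : Sg n} (hp : 0 < p.2)
    (h1 : ∀ q : Sg n, 0 < q.2 → HasDerivAt (fun s : ℝ => W (q + s • I.V q)) (W1 q) 0)
    (h2 : HasDerivAt (fun s : ℝ => W1 (p + s • I.V p)) w2 0) :
    J2 (fun s : ℝ => (c * W (p + s • I.V p)).re) (c * W1 p).re (c * w2).re := by
  have re' : ∀ {g : ℝ → ℂ} {g' : ℂ} {s : ℝ}, HasDerivAt g g' s →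
      HasDerivAt (fun s => (c * g s).re) (c * g').re s := by
    intro g g' s h
    exact Complex.reCLM.hasFDerivAt.comp_hasDerivAt s (h.const_mul c)
  refine ⟨fun s => (c * W1 (p + s • I.V p)).re, ?_, by simp, re' h2⟩
  have hline : Continuous (fun s : ℝ => p + s • I.V p) := by fun_prop
  have hS : {s : ℝ | 0 < (p + s • I.V p).2} ∈ 𝓝 (0:ℝ) := by
    refine (isOpen_lt continuous_const (continuous_snd.comp hline)).mem_nhds ?_
    simpa using hp
  filter_upwards [hS] with s hs
  refine re' ?_
  have h3 := h1 _ hs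
  rw [I.hV] at h3
  have h4 : HasDerivAt (fun x : ℝ => x - s) 1 s := (hasDerivAt_id s).sub_const s
  have h5 := HasDerivAt.scomp (𝕜 := ℝ) (h := fun x : ℝ => x - s) s (g₁ := fun r : ℝ => W (p + s • I.V p + r • I.V p))
    (by simpa using h3) h4
  rw [one_smul] at h5
  refine h5.congr_of_eventuallyEq (Eventually.of_forall fun x => ?_)
  change W (p + x • I.V p) = W (p + s • I.V p + (x - s) • I.V p)
  rw [add_assoc, ← add_smul, add_sub_cancel]
end

section

lemma sm_contOn {n : ℕ} {φ : Hn n → ℂ} (hφ : Continuous φ) (hc : HasCompactSupport φ)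
    {u : Sg n → ℂ} (hu : ContinuousOn u {p : Sg n | 0 < p.2}) :
    ContinuousOn (sm φ u) {p : Sg n | 0 < p.2} := by
  unfold sm
  refine continuousOn_integral_of_compact_support (k := tsupport φ) hc ?_ ?_
  · refine ContinuousOn.mul (hφ.comp continuous_snd).continuousOn ?_
    refine hu.comp (continuous_GS.comp (continuous_snd.prodMk continuous_fst)).continuousOn ?_
    rintro ⟨p, v⟩ ⟨hp, _⟩
    exact hp
  · intro p v _ hv
    simp [image_eq_zero_of_notMem_tsupport hv]

lemma cont_slice {n : ℕ} {u : Sg n → ℂ} (hu : ContinuousOn u {p : Sg n | 0 < p.2}) {a : ℝ} (ha : 0 < a) :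
    Continuous (fun w : Hn n => u (w, a)) := by
  rw [← continuousOn_univ]
  exact hu.comp (by fun_prop) (fun w _ => ha)

lemma sm_eq {n : ℕ} (φ : Hn n → ℂ) (u : Sg n → ℂ) (p : Sg n) :
    sm φ u p = ∫ v, φ (gm v (ginv p.1)) * u (v, p.2) := by
  rw [← integral_gm_right p.1]
  unfold sm GS
  simp_rw [gm_ginv_cancel]

lemma sm_bound {n : ℕ} {φ : Hn n → ℂ} (hφ : Continuous φ) (hc : HasCompactSupport φ)
    {u : Sg n → ℂ} {C : ℝ} (hC : ∀ p : Sg n, 0 < p.2 → ‖u p‖ ≤ C) {p : Sg n} (hp : 0 < p.2) :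
    ‖sm φ u p‖ ≤ ∫ v, ‖φ v‖ * C := by
  unfold sm
  refine norm_integral_le_of_norm_le ?_ (Eventually.of_forall (fun v => ?_))
  · exact (hφ.norm.mul continuous_const).integrable_of_hasCompactSupport (hc.norm.mul_right)
  · rw [norm_mul]
    gcongr
    exact hC _ hp

lemma sm_lim {n : ℕ} {φ : Hn n → ℂ} (hφ : Continuous φ) (hc : HasCompactSupport φ)
    {u : Sg n → ℂ} (hu : ContinuousOn u {p : Sg n | 0 < p.2}) {C : ℝ}
    (hC : ∀ p : Sg n, 0 < p.2 → ‖u p‖ ≤ C)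
    (hbv : IsBoundaryValue n u (fun _ => 0)) (w0 : Hn n) :
    Tendsto (sm φ u) (𝓝[{p : Sg n | 0 < p.2}] (w0, 0)) (𝓝 0) := by
  -- translates
  set φt : Hn n → Hn n → ℂ := fun w v => φ (gm v (ginv w)) with hφt
  have hct : ∀ w, Continuous (φt w) := fun w => hφ.comp (continuous_gm_right _)
  have hcst : ∀ w, HasCompactSupport (φt w) := fun w =>
    hc.comp_homeomorph (gmRightHomeo (ginv w))
  have hInteg : ∀ w, Integrable (φt w) := fun w => (hct w).integrable_of_hasCompactSupport (hcst w)
  have h1 : Tendsto (fun a : ℝ => ∫ v, u (v, a) * φt w0 v) (𝓝[>] 0) (𝓝 0) := by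
    have := hbv (φt w0) (hInteg w0)
    simpa using this
  have h2 : Tendsto (fun w => ∫ v, ‖φt w v - φt w0 v‖) (𝓝 w0) (𝓝 0) := by
    have hco : ContinuousOn (fun w => ∫ v, ‖φt w v - φt w0 v‖) (Metric.closedBall w0 1) := by
      refine continuousOn_integral_of_compact_support
        (k := (fun q : Hn n × Hn n => gm q.1 q.2) '' (tsupport φ ×ˢ Metric.closedBall w0 1)) ?_ ?_ ?_
      · exact ((show IsCompact (tsupport φ) from hc).prod (isCompact_closedBall w0 1)).image continuous_gm
      · refine Continuous.continuousOn ?_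
        refine Continuous.norm (Continuous.sub ?_ ?_)
        · exact hφ.comp (continuous_gm.comp (continuous_snd.prodMk (continuous_ginv.comp continuous_fst)))
        · exact (hct w0).comp continuous_snd
      · intro w v hw hv
        have : ∀ w ∈ Metric.closedBall w0 1, φt w v = 0 := by
          intro w hw
          by_contra h
          apply hv
          refine ⟨(gm v (ginv w), w), ⟨subset_tsupport _ h, hw⟩, gm_ginv_cancel' v w⟩
        rw [this w hw, this w0 (Metric.mem_closedBall_self zero_le_one)]; simp
    have := (hco.continuousAt (Metric.closedBall_mem_nhds w0 one_pos)).tendsto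
    simpa using this
  rw [tendsto_zero_iff_norm_tendsto_zero] at h1 ⊢
  have t1 : Tendsto (fun p : Sg n => p.2) (𝓝[{p : Sg n | 0 < p.2}] (w0, 0)) (𝓝[>] 0) := by
    refine tendsto_nhdsWithin_iff.2 ⟨?_, ?_⟩
    · exact (continuous_snd.tendsto ((w0, 0) : Sg n)).mono_left nhdsWithin_le_nhds
    · filter_upwards [self_mem_nhdsWithin] with p hp using hp
  have t2 : Tendsto (fun p : Sg n => p.1) (𝓝[{p : Sg n | 0 < p.2}] (w0, 0)) (𝓝 w0) :=
    (continuous_fst.tendsto ((w0, 0) : Sg n)).mono_left nhdsWithin_le_nhds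
  have h3 := (h1.comp t1).add ((h2.comp t2).mul_const C)
  simp only [zero_mul, add_zero] at h3
  refine squeeze_zero' (Eventually.of_forall (fun _ => norm_nonneg _)) ?_ h3
  filter_upwards [self_mem_nhdsWithin] with p hp
  have hp : 0 < p.2 := hp
  simp only [Function.comp]
  rw [sm_eq]
  have cs := cont_slice hu hp
  have i1 : Integrable (fun v => u (v, p.2) * φt w0 v) :=
    (cs.mul (hct w0)).integrable_of_hasCompactSupport (hcst w0).mul_left
  have hcd : HasCompactSupport (fun v => φt p.1 v - φt w0 v) := (hcst p.1).sub (hcst w0)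
  have i2 : Integrable (fun v => (φt p.1 v - φt w0 v) * u (v, p.2)) :=
    (((hct p.1).sub (hct w0)).mul cs).integrable_of_hasCompactSupport hcd.mul_right
  have e : ∫ v, φ (gm v (ginv p.1)) * u (v, p.2) = (∫ v, u (v, p.2) * φt w0 v)
      + ∫ v, (φt p.1 v - φt w0 v) * u (v, p.2) := by
    rw [← integral_add i1 i2]
    congr 1; ext v; simp only [hφt]; ring
  rw [e]
  refine (norm_add_le _ _).trans (add_le_add_right ?_ _)
  rw [← integral_mul_const]
  refine norm_integral_le_of_norm_le ?_ (Eventually.of_forall (fun v => ?_))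
  · exact ((((hct p.1).sub (hct w0)).norm).integrable_of_hasCompactSupport hcd.norm).mul_const C
  · rw [norm_mul]
    gcongr
    exact hC _ hp

lemma sm_Lalpha {n : ℕ} {φ : Hn n → ℂ} (hφ : Continuous φ) (hc : HasCompactSupport φ)
    {u : Sg n → ℂ} (hu : ContDiffOn ℝ 2 u {p : Sg n | 0 < p.2}) {α : ℝ}
    (hL : ∀ p : Sg n, 0 < p.2 → Lalpha n α u p = 0) {p : Sg n} (hp : 0 < p.2) :
    -(α : ℂ) * (p.2 : ℂ) * (-(1/4) * ∑ j, (sm φ (XS n j (XS n j u)) p + sm φ (YS n j (YS n j u)) p)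
      + (n : ℂ) * sm φ (DA n u) p)
    + (p.2 : ℂ) ^ 2 * (sm φ (DA n (DA n u)) p + sm φ (TS n (TS n u)) p) = 0 := by
  have h2 : ContDiffOn ℝ (1+1) u {p : Sg n | 0 < p.2} := by rw [one_add_one_eq_two]; exact hu
  have h1 : ContDiffOn ℝ (0+1) u {p : Sg n | 0 < p.2} := hu.of_le (by norm_num)
  have hInteg : ∀ {W : Sg n → ℂ}, ContinuousOn W {p : Sg n | 0 < p.2} →
      Integrable (fun v => φ v * W (GS v p)) := by
    intro W hW
    refine Continuous.integrable_of_hasCompactSupport (hφ.mul ?_) hc.mul_right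
    rw [← continuousOn_univ]
    exact hW.comp (continuous_GS.comp (continuous_id.prodMk continuous_const)).continuousOn (fun v _ => hp)
  have I2 : ∀ I : IField n, Integrable (fun v => φ v * I.D (I.D u) (GS v p)) := fun I =>
    hInteg (I.hC 0 _ (by rw [zero_add]; exact I.hC 1 u h2)).continuousOn
  have iX := fun j => I2 (IFX n j)
  have iY := fun j => I2 (IFY n j)
  have iT := I2 (IFT n)
  have iA := I2 (IFA n)
  have iA1 : Integrable (fun v => φ v * DA n u (GS v p)) := hInteg ((IFA n).hC 0 u h1).continuousOn
  simp only [IFX, IFY, IFT, IFA] at iX iY iT iA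
  have h0 : ∀ v, 0 = -(α : ℂ) * (p.2 : ℂ) * (-(1/4) * ∑ j, (φ v * (XS n j (XS n j u)) (GS v p)
        + φ v * (YS n j (YS n j u)) (GS v p))
      + (n : ℂ) * (φ v * (DA n u) (GS v p)))
    + (p.2 : ℂ) ^ 2 * (φ v * (DA n (DA n u)) (GS v p) + φ v * (TS n (TS n u)) (GS v p)) := by
    intro v
    have := hL (GS v p) hp
    unfold Lalpha LS0 at this
    have e : (GS v p).2 = p.2 := rfl
    rw [e] at this
    rw [← mul_zero (φ v), ← this]
    simp only [← mul_add, ← Finset.mul_sum]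
    ring
  have h3 : (0:ℂ) = ∫ v : Hn n, (0:ℂ) := by simp
  rw [h3]
  have h4 := integral_congr_ae (μ := (volume : Measure (Hn n))) (Eventually.of_forall h0)
  rw [h4]
  have iS : Integrable (fun v => ∑ j, (φ v * (XS n j (XS n j u)) (GS v p)
        + φ v * (YS n j (YS n j u)) (GS v p))) := integrable_finsetSum _ (fun j _ => (iX j).add (iY j))
  have iXY : ∀ j, Integrable (fun v => φ v * (XS n j (XS n j u)) (GS v p)
        + φ v * (YS n j (YS n j u)) (GS v p)) := fun j => (iX j).add (iY j)
  have j1 : Integrable (fun v => -(1/4) * ∑ j, (φ v * (XS n j (XS n j u)) (GS v p)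
        + φ v * (YS n j (YS n j u)) (GS v p)) + (n : ℂ) * (φ v * (DA n u) (GS v p))) :=
    (iS.const_mul _).add (iA1.const_mul _)
  have j2 : Integrable (fun v => φ v * (DA n (DA n u)) (GS v p) + φ v * (TS n (TS n u)) (GS v p)) :=
    iA.add iT
  rw [integral_add (j1.const_mul _) (j2.const_mul _),
    integral_const_mul, integral_const_mul, integral_add (iS.const_mul _) (iA1.const_mul _),
    integral_const_mul, integral_const_mul, integral_add iA iT,
    integral_finsetSum _ (fun j _ => iXY j)]
  simp_rw [fun j => integral_add (iX j) (iY j)]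
  rfl

/-- barrier -/
def tauB (n : ℕ) (p : Sg n) : ℂ := 1 - Complex.I * (psi n p).2
def GB (n : ℕ) (z : Vn n) : ℂ := Complex.log (1 - Complex.I * z.2)

lemma tauB_re {n : ℕ} (p : Sg n) : (tauB n p).re = 1 + p.2 + ∑ j, ‖p.1.1 j‖^2 := by
  simp only [tauB, psi, Complex.sub_re, Complex.one_re, Complex.mul_re, Complex.I_re, Complex.I_im,
    Complex.add_re, Complex.add_im, Complex.mul_im, Complex.ofReal_re, Complex.ofReal_im]
  ring
lemma tauB_im {n : ℕ} (p : Sg n) : (tauB n p).im = - p.1.2 := by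
  simp only [tauB, psi, Complex.sub_im, Complex.one_im, Complex.mul_re, Complex.I_re, Complex.I_im,
    Complex.add_re, Complex.add_im, Complex.mul_im, Complex.ofReal_re, Complex.ofReal_im]
  ring

lemma GB_diff (n : ℕ) : DifferentiableOn ℂ (GB n) (Un n) := by
  intro z hz
  refine DifferentiableAt.differentiableWithinAt ?_
  unfold GB
  refine DifferentiableAt.clog (by fun_prop) ?_
  left
  have : ∑ j, ‖z.1 j‖ ^ 2 < z.2.im := hz
  have h2 : 0 ≤ ∑ j, ‖z.1 j‖ ^ 2 := Finset.sum_nonneg (fun _ _ => by positivity)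
  simp only [Complex.sub_re, Complex.one_re, Complex.mul_re, Complex.I_re, Complex.I_im]
  linarith

lemma GB_re {n : ℕ} (p : Sg n) : (GB n (psi n p)).re = Real.log ‖tauB n p‖ := by
  rw [GB, Complex.log_re]; rfl

lemma contDiff_psi (n : ℕ) (m : WithTop ℕ∞) : ContDiff ℝ m (psi n) := by
  have e : ∀ z : ℂ, ‖z‖^2 = z.re^2 + z.im^2 := by
    intro z; rw [← Complex.normSq_eq_norm_sq, Complex.normSq_apply]; ring
  unfold psi
  simp_rw [e]
  refine ContDiff.prodMk (by fun_prop) ?_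
  refine ContDiff.add (Complex.ofRealCLM.contDiff.comp (by fun_prop)) (contDiff_const.mul ?_)
  refine Complex.ofRealCLM.contDiff.comp ?_
  refine ContDiff.add contDiff_snd (ContDiff.sum (fun j _ => ?_))
  have h : ContDiff ℝ m (fun p : Sg n => p.1.1 j) := by fun_prop
  exact ((Complex.reCLM.contDiff.comp h).pow 2).add ((Complex.imCLM.contDiff.comp h).pow 2)

lemma holo_contDiff {n : ℕ} {G : Vn n → ℂ} (hG : DifferentiableOn ℂ G (Un n)) (m : ℕ) :
    ContDiffOn ℝ m (fun p => G (psi n p)) {p : Sg n | 0 < p.2} :=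
  ContDiffOn.comp ((osgood (isOpen_Un n) m hG).restrict_scalars ℝ) (contDiff_psi n m).contDiffOn
    (fun _ hp => psi_mem hp)

lemma compact_K (n : ℕ) (E : ℝ) : IsCompact {p : Sg n | 0 ≤ p.2 ∧ ‖tauB n p‖ ≤ E} := by
  have hct : Continuous (tauB n) := by
    unfold tauB
    exact continuous_const.sub (continuous_const.mul (continuous_snd.comp (contDiff_psi n 0).continuous))
  refine Metric.isCompact_of_isClosed_isBounded ?_ ?_
  · exact (isClosed_le continuous_const continuous_snd).inter (isClosed_le hct.norm continuous_const)
  · refine (Metric.isBounded_closedBall (x := (0 : Sg n)) (r := E)).subset ?_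
    rintro p ⟨hp, hE⟩
    have hre := (Complex.re_le_norm (tauB n p)).trans hE
    have him := (Complex.abs_im_le_norm (tauB n p)).trans hE
    rw [tauB_re] at hre
    rw [tauB_im, abs_neg] at him
    have h0 : 0 ≤ ∑ j, ‖p.1.1 j‖ ^ 2 := Finset.sum_nonneg (fun _ _ => by positivity)
    have hE0 : 0 ≤ E := (norm_nonneg _).trans hE
    rw [mem_closedBall_zero_iff]
    refine max_le (max_le ?_ him) ?_
    · refine (pi_norm_le_iff_of_nonneg hE0).2 (fun j => ?_)
      have := Finset.single_le_sum (f := fun j => ‖p.1.1 j‖^2) (fun _ _ => by positivity) (Finset.mem_univ j)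
      nlinarith [sq_nonneg (‖p.1.1 j‖ - 1)]
    · rw [Real.norm_eq_abs, abs_of_nonneg hp]; linarith
end

section

lemma IField.congr {n : ℕ} (I : IField n) {U W : Sg n → ℂ} (h : ∀ q : Sg n, 0 < q.2 → U q = W q)
    {p : Sg n} (hp : 0 < p.2) : I.D U p = I.D W p := by
  rw [I.hD, I.hD]
  have : U =ᶠ[𝓝 p] W := by
    filter_upwards [(isOpen_S n).mem_nhds hp] with q hq using h q hq
  rw [this.fderiv_eq]

lemma IField.D_lin {n : ℕ} (I : IField n) {U W : Sg n → ℂ} (c : ℂ)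
    (hU : ContDiffOn ℝ 1 U {p : Sg n | 0 < p.2}) (hW : ContDiffOn ℝ 1 W {p : Sg n | 0 < p.2})
    {p : Sg n} (hp : 0 < p.2) :
    I.D (fun q => U q + c * W q) p = I.D U p + c * I.D W p := by
  have h1 := diffAt_of_S hU hp
  have h2 := diffAt_of_S hW hp
  rw [I.hD, I.hD, I.hD]
  rw [fderiv_fun_add h1 (h2.const_mul c), fderiv_const_mul h2]
  simp

lemma IField.D2_lin {n : ℕ} (I : IField n) {U W : Sg n → ℂ} (c : ℂ)
    (hU : ContDiffOn ℝ 2 U {p : Sg n | 0 < p.2}) (hW : ContDiffOn ℝ 2 W {p : Sg n | 0 < p.2})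
    {p : Sg n} (hp : 0 < p.2) :
    I.D (I.D (fun q => U q + c * W q)) p = I.D (I.D U) p + c * I.D (I.D W) p := by
  have e : (2 : WithTop ℕ∞) = 1 + 1 := one_add_one_eq_two.symm
  have hU1 := hU.of_le (one_le_two)
  have hW1 := hW.of_le (one_le_two)
  rw [← I.D_lin c (I.hC 1 _ (e ▸ hU)) (I.hC 1 _ (e ▸ hW)) hp]
  exact I.congr (fun q hq => I.D_lin c hU1 hW1 hq) hp

lemma Lalpha_lin {n : ℕ} {U W : Sg n → ℂ} (c : ℂ) (α : ℝ)
    (hU : ContDiffOn ℝ 2 U {p : Sg n | 0 < p.2}) (hW : ContDiffOn ℝ 2 W {p : Sg n | 0 < p.2})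
    {p : Sg n} (hp : 0 < p.2) :
    Lalpha n α (fun q => U q + c * W q) p = Lalpha n α U p + c * Lalpha n α W p := by
  have hU1 := hU.of_le (one_le_two)
  have hW1 := hW.of_le (one_le_two)
  have eX := fun j => (IFX n j).D2_lin c hU hW hp
  have eY := fun j => (IFY n j).D2_lin c hU hW hp
  have eT := (IFT n).D2_lin c hU hW hp
  have eA := (IFA n).D2_lin c hU hW hp
  have eA1 := (IFA n).D_lin c hU1 hW1 hp
  simp only [IFX, IFY, IFT, IFA] at eX eY eT eA eA1
  unfold Lalpha LS0
  simp_rw [eX, eY]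
  rw [eT, eA, eA1]
  have : ∑ j, (XS n j (XS n j U) p + c * XS n j (XS n j W) p + (YS n j (YS n j U) p + c * YS n j (YS n j W) p))
    = (∑ j, (XS n j (XS n j U) p + YS n j (YS n j U) p)) + c * ∑ j, (XS n j (XS n j W) p + YS n j (YS n j W) p) := by
    rw [Finset.mul_sum, ← Finset.sum_add_distrib]
    refine Finset.sum_congr rfl (fun j _ => by ring)
  rw [this]
  ring

lemma Lalpha_a {n : ℕ} (α : ℝ) (p : Sg n) :
    Lalpha n α (fun q => (q.2 : ℂ)) p = -(α : ℂ) * (p.2 : ℂ) * n := by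
  have h : ∀ I : IField n, I.D (fun q => (q.2 : ℂ)) = fun p => (((I.V p).2 : ℝ) : ℂ) := by
    intro I
    ext p
    rw [I.hD]
    have : HasFDerivAt (fun q : Sg n => (q.2 : ℂ)) (Complex.ofRealCLM ∘L ContinuousLinearMap.snd ℝ (Hn n) ℝ) p :=
      (Complex.ofRealCLM ∘L ContinuousLinearMap.snd ℝ (Hn n) ℝ).hasFDerivAt
    rw [this.fderiv]; simp
  have h0 : ∀ (I : IField n) (c : ℂ), I.D (fun q => c) p = 0 := by
    intro I c
    rw [I.hD]; simp
  have eX := fun j => h (IFX n j)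
  have eY := fun j => h (IFY n j)
  have eT := h (IFT n)
  have eA := h (IFA n)
  have fX := fun j => h0 (IFX n j) 0
  have fY := fun j => h0 (IFY n j) 0
  have fT := h0 (IFT n) 0
  have fA := h0 (IFA n) 1
  simp only [IFX, IFY, IFT, IFA] at eX eY eT eA fX fY fT fA
  unfold Lalpha LS0
  simp_rw [eX, eY, eT, eA]
  simp only [eTS, _root_.eA, Complex.ofReal_zero, Complex.ofReal_one, fX, fY, fT, fA]
  simp

def Bar (n : ℕ) (p : Sg n) : ℂ := GB n (psi n p) + 1 * (p.2 : ℂ)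

lemma Bar_smooth (n : ℕ) : ContDiffOn ℝ 2 (Bar n) {p : Sg n | 0 < p.2} := by
  unfold Bar
  refine ContDiffOn.add (holo_contDiff (GB_diff n) 2) (ContDiff.contDiffOn ?_)
  exact contDiff_const.mul (Complex.ofRealCLM.contDiff.comp contDiff_snd)

lemma Bar_L {n : ℕ} (α : ℝ) {p : Sg n} (hp : 0 < p.2) : Lalpha n α (Bar n) p = -(α : ℂ) * (p.2 : ℂ) * n := by
  unfold Bar
  rw [Lalpha_lin (W := fun p : Sg n => (p.2 : ℂ)) 1 α (holo_contDiff (GB_diff n) 2)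
    (Complex.ofRealCLM.contDiff.comp contDiff_snd).contDiffOn hp, holo_Lalpha (GB_diff n) hp, Lalpha_a]
  ring

lemma Bar_re {n : ℕ} (p : Sg n) : (Bar n p).re = Real.log ‖tauB n p‖ + p.2 := by
  simp [Bar, GB_re]

lemma one_le_tauB {n : ℕ} {p : Sg n} (hp : 0 ≤ p.2) : 1 ≤ ‖tauB n p‖ := by
  refine le_trans ?_ (Complex.re_le_norm _)
  rw [tauB_re]
  have h0 : 0 ≤ ∑ j, ‖p.1.1 j‖ ^ 2 := Finset.sum_nonneg (fun _ _ => by positivity)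
  linarith

lemma no_max {n : ℕ} (hn : 1 ≤ n) {φ : Hn n → ℂ} (hφ : Continuous φ) (hc : HasCompactSupport φ)
    {u : Sg n → ℂ} (hu : ContDiffOn ℝ 2 u {p : Sg n | 0 < p.2}) {α : ℝ} (hα : 0 < α)
    (hL : ∀ p : Sg n, 0 < p.2 → Lalpha n α u p = 0) {p : Sg n} (hp : 0 < p.2) (c : ℂ) {ε : ℝ} (hε : 0 < ε)
    (hmax : ∀ q : Sg n, 0 < q.2 → (c * sm φ u q).re - ε * (Bar n q).re ≤ (c * sm φ u p).re - ε * (Bar n p).re) :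
    False := by
  have e : (2 : WithTop ℕ∞) = 1 + 1 := one_add_one_eq_two.symm
  have hu1 := hu.of_le (one_le_two)
  have hB := Bar_smooth n
  have hB1 := hB.of_le (one_le_two)
  have key : ∀ I : IField n,
      (c * sm φ (I.D u) p).re - ε * (I.D (Bar n) p).re = 0 ∧
      (c * sm φ (I.D (I.D u)) p).re - ε * (I.D (I.D (Bar n)) p).re ≤ 0 := by
    intro I
    have hline : Continuous (fun s : ℝ => p + s • I.V p) := by fun_prop
    have hS : {s : ℝ | 0 < (p + s • I.V p).2} ∈ 𝓝 (0:ℝ) := by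
      refine (isOpen_lt continuous_const (continuous_snd.comp hline)).mem_nhds ?_
      simpa using hp
    have lineB : ∀ {W : Sg n → ℂ}, ContDiffOn ℝ 1 W {p : Sg n | 0 < p.2} → ∀ q : Sg n, 0 < q.2 →
        HasDerivAt (fun s : ℝ => W (q + s • I.V q)) (I.D W q) 0 := by
      intro W hW q hq
      have := I.line (W := W) (p := q) (s := 0) (by simpa using diffAt_of_S hW hq)
      simpa using this
    have j1 := J2_re I c hp (W := sm φ u) (fun q hq => sm_line I hu1 hφ hc hq)
      (sm_line I (I.hC 1 u (e ▸ hu)) hφ hc hp)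
    have j2 := J2_re I (-(ε:ℂ)) hp (W := Bar n) (lineB hB1) (lineB (I.hC 1 _ (e ▸ hB)) p hp)
    have j := (j1.add j2).max (by
      filter_upwards [hS] with s hs
      have := hmax _ hs
      simp only [← Complex.ofReal_neg, Complex.re_ofReal_mul, zero_smul, add_zero]
      linarith)
    simp only [← Complex.ofReal_neg, Complex.re_ofReal_mul] at j
    exact ⟨by linarith [j.1], by linarith [j.2]⟩
  have kX := fun j => (key (IFX n j)).2
  have kY := fun j => (key (IFY n j)).2
  have kT := (key (IFT n)).2
  have kA := (key (IFA n)).2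
  have kA1 := (key (IFA n)).1
  simp only [IFX, IFY, IFT, IFA] at kX kY kT kA kA1
  have hs := sm_Lalpha hφ hc hu hL hp
  have hb := Bar_L (n := n) α hp
  unfold Lalpha LS0 at hb
  -- sums
  have r1 := congrArg (fun z => (c * z).re) hs
  have r2 := congrArg (fun z => z.re) hb
  have q1 : (c * (-(α : ℂ) * (p.2 : ℂ) * (-(1/4) * ∑ j, (sm φ (XS n j (XS n j u)) p + sm φ (YS n j (YS n j u)) p)
      + (n : ℂ) * sm φ (DA n u) p)
    + (p.2 : ℂ) ^ 2 * (sm φ (DA n (DA n u)) p + sm φ (TS n (TS n u)) p))).re =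
    α * p.2 / 4 * (∑ j, ((c * sm φ (XS n j (XS n j u)) p).re + (c * sm φ (YS n j (YS n j u)) p).re))
     - α * p.2 * n * (c * sm φ (DA n u) p).re + p.2^2 * ((c * sm φ (DA n (DA n u)) p).re + (c * sm φ (TS n (TS n u)) p).re) := by
    rw [← Complex.ofReal_inj.2 rfl, show (∑ j, ((c * sm φ (XS n j (XS n j u)) p).re + (c * sm φ (YS n j (YS n j u)) p).re))
      = (c * ∑ j, (sm φ (XS n j (XS n j u)) p + sm φ (YS n j (YS n j u)) p)).re by
        rw [Finset.mul_sum, Complex.re_sum]; simp [mul_add]]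
    generalize (∑ j, (sm φ (XS n j (XS n j u)) p + sm φ (YS n j (YS n j u)) p)) = A
    have : (c * (-(α : ℂ) * (p.2 : ℂ) * (-(1/4) * A
      + (n : ℂ) * sm φ (DA n u) p)
      + (p.2 : ℂ) ^ 2 * (sm φ (DA n (DA n u)) p + sm φ (TS n (TS n u)) p))) =
      ((α * p.2 / 4 : ℝ) : ℂ) * (c * A) - ((α * p.2 * n : ℝ) : ℂ) * (c * sm φ (DA n u) p)
      + ((p.2^2 : ℝ) : ℂ) * (c * sm φ (DA n (DA n u)) p + c * sm φ (TS n (TS n u)) p) := by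
      push_cast; ring
    rw [this]
    simp only [Complex.add_re, Complex.sub_re, Complex.re_ofReal_mul]
  have q2 : ((-(α : ℂ) * (p.2 : ℂ) * (-(1/4) * ∑ j, ((XS n j (XS n j (Bar n))) p + (YS n j (YS n j (Bar n))) p)
      + (n : ℂ) * (DA n (Bar n)) p)
    + (p.2 : ℂ) ^ 2 * ((DA n (DA n (Bar n))) p + (TS n (TS n (Bar n))) p))).re =
    α * p.2 / 4 * (∑ j, (((XS n j (XS n j (Bar n))) p).re + ((YS n j (YS n j (Bar n))) p).re))
     - α * p.2 * n * ((DA n (Bar n)) p).re + p.2^2 * (((DA n (DA n (Bar n))) p).re + ((TS n (TS n (Bar n))) p).re) := by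
    rw [show (∑ j, (((XS n j (XS n j (Bar n))) p).re + ((YS n j (YS n j (Bar n))) p).re))
      = (∑ j, ((XS n j (XS n j (Bar n))) p + (YS n j (YS n j (Bar n))) p)).re by
        rw [Complex.re_sum]; simp]
    generalize (∑ j, ((XS n j (XS n j (Bar n))) p + (YS n j (YS n j (Bar n))) p)) = A
    have : ((-(α : ℂ) * (p.2 : ℂ) * (-(1/4) * A
      + (n : ℂ) * (DA n (Bar n)) p)
      + (p.2 : ℂ) ^ 2 * ((DA n (DA n (Bar n))) p + (TS n (TS n (Bar n))) p))) =
      ((α * p.2 / 4 : ℝ) : ℂ) * (A) - ((α * p.2 * n : ℝ) : ℂ) * ((DA n (Bar n)) p)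
      + ((p.2^2 : ℝ) : ℂ) * ((DA n (DA n (Bar n))) p + (TS n (TS n (Bar n))) p) := by
      push_cast; ring
    rw [this]
    simp only [Complex.add_re, Complex.sub_re, Complex.re_ofReal_mul]
  simp only [mul_zero, Complex.zero_re] at r1
  rw [q1] at r1
  have q3 : (-(α : ℂ) * (p.2 : ℂ) * n).re = -(α * p.2 * n) := by
    rw [show (-(α : ℂ) * (p.2 : ℂ) * n) = ((-(α * p.2 * n) : ℝ) : ℂ) by push_cast; ring, Complex.ofReal_re]
  rw [q2, q3] at r2
  have hsum : (∑ j, ((c * sm φ (XS n j (XS n j u)) p).re + (c * sm φ (YS n j (YS n j u)) p).re))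
     - ε * (∑ j, (((XS n j (XS n j (Bar n))) p).re + ((YS n j (YS n j (Bar n))) p).re)) ≤ 0 := by
    rw [Finset.mul_sum, ← Finset.sum_sub_distrib]
    refine Finset.sum_nonpos (fun j _ => ?_)
    have := kX j
    have := kY j
    linarith
  generalize (∑ j, ((c * sm φ (XS n j (XS n j u)) p).re + (c * sm φ (YS n j (YS n j u)) p).re)) = S1 at *
  generalize (∑ j, (((XS n j (XS n j (Bar n))) p).re + ((YS n j (YS n j (Bar n))) p).re)) = S2 at *
  have hn' : (0:ℝ) < n := by exact_mod_cast hn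
  have t1 : 0 < ε * (α * p.2 * n) := by positivity
  have t2 : α * p.2 / 4 * (S1 - ε * S2) ≤ 0 := mul_nonpos_of_nonneg_of_nonpos (by positivity) hsum
  have t3 := mul_nonpos_of_nonneg_of_nonpos (sq_nonneg p.2) (add_nonpos kA kT)
  have t4 : α * p.2 * n * ((c * sm φ (DA n u) p).re - ε * (DA n (Bar n) p).re) = 0 := by rw [kA1, mul_zero]
  nlinarith [t1, t2, t3, t4, r1, r2]

lemma sm_le {n : ℕ} (hn : 1 ≤ n) {φ : Hn n → ℂ} (hφ : Continuous φ) (hc : HasCompactSupport φ)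
    {u : Sg n → ℂ} (hu : ContDiffOn ℝ 2 u {p : Sg n | 0 < p.2}) {α : ℝ} (hα : 0 < α)
    (hL : ∀ p : Sg n, 0 < p.2 → Lalpha n α u p = 0) {C : ℝ} (hC : ∀ p : Sg n, 0 < p.2 → ‖u p‖ ≤ C)
    (hbv : IsBoundaryValue n u (fun _ => 0))
    {p : Sg n} (hp : 0 < p.2) (c : ℂ) {ε : ℝ} (hε : 0 < ε) :
    (c * sm φ u p).re - ε * (Real.log ‖tauB n p‖ + p.2) ≤ 0 := by
  classical
  by_contra hpos
  push Not at hpos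
  set g : Sg n → ℝ := fun q => if 0 < q.2 then (c * sm φ u q).re else 0 with hg
  set Ψ : Sg n → ℝ := fun q => g q - ε * (Real.log ‖tauB n q‖ + q.2) with hΨ
  set M : ℝ := ‖c‖ * ∫ v, ‖φ v‖ * C
  set K : Set (Sg n) := {p : Sg n | 0 ≤ p.2 ∧ ‖tauB n p‖ ≤ Real.exp (M/ε)} with hK
  have hM : ∀ q : Sg n, 0 < q.2 → (c * sm φ u q).re ≤ M := by
    intro q hq
    refine (Complex.re_le_norm _).trans ?_
    rw [norm_mul]
    exact mul_le_mul_of_nonneg_left (sm_bound hφ hc hC hq) (norm_nonneg _)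
  have hlog : ∀ q : Sg n, 0 ≤ q.2 → 0 ≤ Real.log ‖tauB n q‖ := fun q hq => Real.log_nonneg (one_le_tauB hq)
  have hout : ∀ q : Sg n, 0 < q.2 → q ∉ K → Ψ q ≤ 0 := by
    intro q hq hqK
    have h1 : Real.exp (M/ε) < ‖tauB n q‖ := by
      by_contra h
      exact hqK ⟨hq.le, not_lt.1 h⟩
    have h2 : M/ε < Real.log ‖tauB n q‖ := (Real.lt_log_iff_exp_lt (by linarith [one_le_tauB hq.le])).2 h1
    have h3 := hM q hq
    rw [div_lt_iff₀ hε] at h2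
    simp only [hΨ, hg, if_pos hq]
    nlinarith
  have hΨp : ∀ q : Sg n, 0 < q.2 → Ψ q = (c * sm φ u q).re - ε * (Bar n q).re := by
    intro q hq
    simp only [hΨ, hg, if_pos hq, Bar_re]
  have hct : Continuous (tauB n) := by
    unfold tauB
    exact continuous_const.sub (continuous_const.mul (continuous_snd.comp (contDiff_psi n 0).continuous))
  have hgc : ContinuousOn g {q : Sg n | 0 ≤ q.2} := by
    intro q hq
    have hq : 0 ≤ q.2 := hq
    rcases hq.eq_or_lt with h0 | hq0
    · have hl := sm_lim hφ hc hu.continuousOn hC hbv q.1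
      have hq' : (q.1, (0:ℝ)) = q := by rw [h0]
      rw [hq'] at hl
      have hl2 : Tendsto (fun q => (c * sm φ u q).re) (𝓝[{p : Sg n | 0 < p.2}] q) (𝓝 0) := by
        have := (Complex.continuous_re.tendsto _).comp (hl.const_mul c)
        simp only [mul_zero, Complex.zero_re] at this
        exact this
      have hg0 : g q = 0 := by simp [hg, ← h0]
      rw [ContinuousWithinAt, hg0]
      rw [Metric.tendsto_nhds] at hl2 ⊢
      intro δ hδ
      have := hl2 δ hδ
      rw [eventually_nhdsWithin_iff] at this ⊢
      filter_upwards [this] with r hr hr0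
      by_cases h : 0 < r.2
      · simp only [hg, if_pos h]; exact hr h
      · simp only [hg, if_neg h, dist_self]; exact hδ
    · refine ContinuousAt.continuousWithinAt ?_
      have h1 : ContinuousAt (sm φ u) q := (sm_contOn hφ hc hu.continuousOn).continuousAt ((isOpen_S n).mem_nhds hq0)
      have h2 : ContinuousAt (fun q => (c * sm φ u q).re) q :=
        Complex.continuous_re.continuousAt.comp (continuousAt_const.mul h1)
      refine h2.congr ?_
      filter_upwards [(isOpen_S n).mem_nhds hq0] with r hr
      have hr : 0 < r.2 := hr
      simp only [hg, if_pos hr]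
  have hΨc : ContinuousOn Ψ K := by
    refine (hgc.mono (fun q hq => hq.1)).sub (continuousOn_const.mul (ContinuousOn.add ?_ continuous_snd.continuousOn))
    refine ContinuousOn.log hct.norm.continuousOn (fun q hq => ?_)
    have := one_le_tauB hq.1
    positivity
  have hpΨ : 0 < Ψ p := by simpa only [hΨ, hg, if_pos hp] using hpos
  have hpK : p ∈ K := by
    by_contra h
    exact absurd (hout p hp h) (not_le.2 hpΨ)
  obtain ⟨q, hqK, hq⟩ := (compact_K n (Real.exp (M/ε))).exists_isMaxOn ⟨p, hpK⟩ hΨc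
  have hΨq : 0 < Ψ q := hpΨ.trans_le (hq hpK)
  have hq0 : 0 < q.2 := by
    by_contra h
    have h1 : q.2 = 0 := le_antisymm (not_lt.1 h) hqK.1
    have h2 := hlog q hqK.1
    simp only [hΨ, hg, h1, add_zero, lt_irrefl, if_false, zero_sub] at hΨq
    nlinarith
  refine no_max hn hφ hc hu hα hL hq0 c hε (fun r hr => ?_)
  rw [← hΨp r hr, ← hΨp q hq0]
  by_cases hrK : r ∈ K
  · exact hq hrK
  · exact (hout r hr hrK).trans hΨq.le

lemma sm_zero {n : ℕ} (hn : 1 ≤ n) {φ : Hn n → ℂ} (hφ : Continuous φ) (hc : HasCompactSupport φ)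
    {u : Sg n → ℂ} (hu : ContDiffOn ℝ 2 u {p : Sg n | 0 < p.2}) {α : ℝ} (hα : 0 < α)
    (hL : ∀ p : Sg n, 0 < p.2 → Lalpha n α u p = 0) {C : ℝ} (hC : ∀ p : Sg n, 0 < p.2 → ‖u p‖ ≤ C)
    (hbv : IsBoundaryValue n u (fun _ => 0))
    {p : Sg n} (hp : 0 < p.2) : sm φ u p = 0 := by
  have h : ∀ c : ℂ, (c * sm φ u p).re ≤ 0 := by
    intro c
    by_contra h
    push Not at h
    have hT : 0 < Real.log ‖tauB n p‖ + p.2 := by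
      have := Real.log_nonneg (one_le_tauB hp.le); linarith
    have := sm_le hn hφ hc hu hα hL hC hbv hp c (ε := (c * sm φ u p).re / (2 * (Real.log ‖tauB n p‖ + p.2))) (by positivity)
    have e : (c * sm φ u p).re / (2 * (Real.log ‖tauB n p‖ + p.2)) * (Real.log ‖tauB n p‖ + p.2) = (c * sm φ u p).re / 2 := by
      field_simp
    rw [e] at this
    linarith
  have := h ((starRingEnd ℂ) (sm φ u p))
  rw [mul_comm, Complex.mul_conj, Complex.ofReal_re] at this
  exact Complex.normSq_eq_zero.1 (le_antisymm this (Complex.normSq_nonneg _))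

lemma uniqueness {n : ℕ} (hn : 1 ≤ n)
    {u : Sg n → ℂ} (hu : ContDiffOn ℝ 2 u {p : Sg n | 0 < p.2}) {α : ℝ} (hα : 0 < α)
    (hL : ∀ p : Sg n, 0 < p.2 → Lalpha n α u p = 0) {C : ℝ} (hC : ∀ p : Sg n, 0 < p.2 → ‖u p‖ ≤ C)
    (hbv : IsBoundaryValue n u (fun _ => 0))
    {p : Sg n} (hp : 0 < p.2) : u p = 0 := by
  have cs := cont_slice hu.continuousOn hp
  have h : ∀ᵐ w ∂(volume : Measure (Hn n)), u (w, p.2) = 0 := by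
    refine ae_eq_zero_of_integral_contDiff_smul_eq_zero cs.locallyIntegrable ?_
    intro g hg hgc
    have hgc' : HasCompactSupport (fun v => (g v : ℂ)) := hgc.comp_left (g := fun x : ℝ => (x : ℂ)) (by simp)
    have := sm_zero hn (φ := fun v => (g v : ℂ)) (Complex.continuous_ofReal.comp hg.continuous) hgc' hu hα hL hC hbv
      (p := (0, p.2)) hp
    rw [sm_eq] at this
    have e : ∀ v : Hn n, gm v (ginv 0) = v := by intro v; ext <;> simp [gm, ginv]
    simp_rw [e] at this
    simpa [Complex.real_smul] using this
  have h2 : (fun w : Hn n => u (w, p.2)) = fun _ => 0 :=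
    (Continuous.ae_eq_iff_eq volume cs continuous_const).1 h
  exact congrFun h2 p.1
end

section

lemma commXY {n : ℕ} {φ : Hn n → ℂ} (hφ : ContDiff ℝ 2 φ) (k : Fin n) (p : Hn n) :
    XH n k (YH n k φ) p - YH n k (XH n k φ) p = -4 * TH n φ p := by
  have e1 : XH n k φ = fun q => fderiv ℝ φ q (vX n k q) := funext (XH_eq n k φ)
  have e2 : YH n k φ = fun q => fderiv ℝ φ q (vY n k q) := funext (YH_eq n k φ)
  have hd : HasFDerivAt (fderiv ℝ φ) (fderiv ℝ (fderiv ℝ φ) p) p :=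
    ((hφ.fderiv_right (m := 1) (by norm_num)).differentiable one_ne_zero p).hasFDerivAt
  have hsym := (hφ.contDiffAt (x := p)).isSymmSndFDerivAt (by simp)
  have hpk : HasFDerivAt (fun q : Hn n => q.1 k)
    ((ContinuousLinearMap.proj (R := ℝ) (φ := fun _ : Fin n => ℂ) k) ∘L ContinuousLinearMap.fst ℝ (Fin n → ℂ) ℝ) p :=
    ((ContinuousLinearMap.proj (R := ℝ) (φ := fun _ : Fin n => ℂ) k) ∘L ContinuousLinearMap.fst ℝ (Fin n → ℂ) ℝ).hasFDerivAt
  have him := Complex.imCLM.hasFDerivAt.comp p hpk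
  have hre := Complex.reCLM.hasFDerivAt.comp p hpk
  have hX : HasFDerivAt (fun q => vX n k q) _ p := (((him.const_mul 2).smul_const (eT n))).const_add (eX n k)
  have hY : HasFDerivAt (fun q => vY n k q) _ p := (((hre.const_mul 2).neg.smul_const (eT n))).const_add (eY n k)
  have h1 := (hd.clm_apply hX).fderiv
  have h2 := (hd.clm_apply hY).fderiv
  rw [XH_eq, YH_eq, e1, e2, h1, h2]
  have hs := hsym (vX n k p) (vY n k p)
  simp only [add_apply, ContinuousLinearMap.flip_apply, ContinuousLinearMap.comp_apply,
    ContinuousLinearMap.smulRight_apply, map_smul]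
  rw [hs]
  simp [vX, vY, eX, eY, eT, TH, dirD]
  ring

def Zd (n : ℕ) (k : Fin n) (φ : Hn n → ℂ) (p : Hn n) : ℂ := (1/2) * (XH n k φ p - Complex.I * YH n k φ p)

lemma Zd_eq {n : ℕ} (k : Fin n) {φ : Hn n → ℂ} {p : Hn n} {L : Hn n →L[ℝ] ℂ} (h : HasFDerivAt φ L p) :
    Zd n k φ p = (1/2) * (L (vX n k p) - Complex.I * L (vY n k p)) := by
  rw [Zd, XH_eq, YH_eq, h.fderiv]
lemma Zb_eq {n : ℕ} (k : Fin n) {φ : Hn n → ℂ} {p : Hn n} {L : Hn n →L[ℝ] ℂ} (h : HasFDerivAt φ L p) :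
    ZbarH n k φ p = (1/2) * (L (vX n k p) + Complex.I * L (vY n k p)) := by
  rw [ZbarH, XH_eq, YH_eq, h.fderiv]

lemma LH_Z {n : ℕ} {φ : Hn n → ℂ} (hφ : ContDiff ℝ 2 φ) (p : Hn n) :
    LH n (-(n:ℝ)) φ p = - ∑ k, ZbarH n k (Zd n k φ) p := by
  have h2 : ContDiff ℝ (1+1) φ := by rw [one_add_one_eq_two]; exact hφ
  have hk : ∀ k, ZbarH n k (Zd n k φ) p = (1/4) * (XH n k (XH n k φ) p + YH n k (YH n k φ) p) + Complex.I * TH n φ p := by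
    intro k
    have hX := (((contDiff_XH h2 k).differentiable one_ne_zero) p).hasFDerivAt
    have hY := (((contDiff_YH h2 k).differentiable one_ne_zero) p).hasFDerivAt
    have hZ : HasFDerivAt (Zd n k φ) _ p := (hX.sub (hY.const_mul Complex.I)).const_mul (1/2)
    rw [Zb_eq k hZ]
    have hc := commXY hφ k p
    rw [XH_eq n k (YH n k φ), YH_eq n k (XH n k φ)] at hc
    rw [XH_eq n k (XH n k φ), YH_eq n k (YH n k φ)]
    simp only [smul_apply, sub_apply, smul_eq_mul]
    linear_combination (-Complex.I/4) * hc - (1/4) * (fderiv ℝ (YH n k φ) p) (vY n k p) * Complex.I_sq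
  simp_rw [hk]
  rw [LH, Finset.sum_add_distrib (f := fun k => (1/4 : ℂ) * _), ← Finset.mul_sum]
  simp only [Finset.sum_const, Finset.card_univ, Fintype.card_fin, nsmul_eq_mul]
  push_cast
  ring

/-- the conjugate kernel denominator -/
def sg {n : ℕ} (z : Vn n) (v : Hn n) : ℂ :=
  Complex.I * (starRingEnd ℂ) z.2 + ∑ k, (v.1 k * (starRingEnd ℂ) (v.1 k) - 2 * (starRingEnd ℂ) (z.1 k) * v.1 k)
    - Complex.I * (v.2 : ℂ)

def AA {n : ℕ} (z : Vn n) : ℝ := z.2.im - ∑ k, ‖z.1 k‖^2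

def ww {n : ℕ} (z : Vn n) (k : Fin n) (v : Hn n) : ℂ := v.1 k - z.1 k

lemma AA_pos {n : ℕ} {z : Vn n} (hz : z ∈ Un n) : 0 < AA z := sub_pos.2 hz

lemma sg_re {n : ℕ} (z : Vn n) (v : Hn n) : (sg z v).re = AA z + ∑ k, ‖ww z k v‖^2 := by
  have : ∀ k, ‖ww z k v‖^2 = (v.1 k * (starRingEnd ℂ) (v.1 k) - 2 * (starRingEnd ℂ) (z.1 k) * v.1 k).re + ‖z.1 k‖^2 := by
    intro k
    rw [← Complex.normSq_eq_norm_sq, ← Complex.normSq_eq_norm_sq, Complex.normSq_apply, Complex.normSq_apply]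
    simp [ww]; ring
  simp_rw [this]
  rw [Finset.sum_add_distrib, ← Complex.re_sum]
  simp [sg, AA]

lemma sg_re_pos {n : ℕ} {z : Vn n} (hz : z ∈ Un n) (v : Hn n) : AA z ≤ (sg z v).re := by
  rw [sg_re]
  have h0 : 0 ≤ ∑ k, ‖ww z k v‖^2 := Finset.sum_nonneg (fun _ _ => by positivity)
  linarith

lemma sg_norm_ge {n : ℕ} {z : Vn n} (hz : z ∈ Un n) (v : Hn n) : AA z ≤ ‖sg z v‖ :=
  (sg_re_pos hz v).trans (Complex.re_le_norm _)

lemma sg_ne {n : ℕ} {z : Vn n} (hz : z ∈ Un n) (v : Hn n) : sg z v ≠ 0 := by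
  have h1 := sg_norm_ge hz v
  have h2 := AA_pos hz
  exact norm_pos_iff.1 (by linarith)

lemma two_sum_ww {n : ℕ} (z : Vn n) (v : Hn n) :
    2 * ∑ k, ww z k v * (starRingEnd ℂ) (ww z k v) = sg z v + (starRingEnd ℂ) (sg z v) - 2 * AA z := by
  rw [Complex.add_conj, sg_re]
  simp_rw [Complex.mul_conj, Complex.normSq_eq_norm_sq]
  push_cast
  ring

def pk (n : ℕ) (k : Fin n) : Hn n →L[ℝ] ℂ :=
  (ContinuousLinearMap.proj (R := ℝ) (φ := fun _ : Fin n => ℂ) k) ∘L ContinuousLinearMap.fst ℝ (Fin n → ℂ) ℝ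
def cj : ℂ →L[ℝ] ℂ := Complex.conjCLE.toContinuousLinearMap
lemma cj_apply (z : ℂ) : cj z = (starRingEnd ℂ) z := rfl

def dsg {n : ℕ} (z : Vn n) (v : Hn n) : Hn n →L[ℝ] ℂ :=
  (∑ k, ((v.1 k • (cj ∘L pk n k) + (starRingEnd ℂ) (v.1 k) • pk n k) - (2 * (starRingEnd ℂ) (z.1 k)) • pk n k))
   - Complex.I • (Complex.ofRealCLM ∘L ContinuousLinearMap.snd ℝ (Fin n → ℂ) ℝ)

lemma has_pk {n : ℕ} (k : Fin n) (v : Hn n) : HasFDerivAt (fun v : Hn n => v.1 k) (pk n k) v := (pk n k).hasFDerivAt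
lemma has_cpk {n : ℕ} (k : Fin n) (v : Hn n) :
    HasFDerivAt (fun v : Hn n => (starRingEnd ℂ) (v.1 k)) (cj ∘L pk n k) v := (cj ∘L pk n k).hasFDerivAt

lemma has_sg {n : ℕ} (z : Vn n) (v : Hn n) : HasFDerivAt (sg z) (dsg z v) v := by
  unfold sg dsg
  refine HasFDerivAt.sub ?_ ?_
  · refine HasFDerivAt.const_add _ ?_
    refine HasFDerivAt.fun_sum (fun k _ => ?_)
    exact ((has_pk k v).mul (has_cpk k v)).sub ((has_pk k v).const_mul _)
  · have : HasFDerivAt (fun v : Hn n => (v.2 : ℂ)) (Complex.ofRealCLM ∘L ContinuousLinearMap.snd ℝ (Fin n → ℂ) ℝ) v :=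
      (Complex.ofRealCLM ∘L ContinuousLinearMap.snd ℝ (Fin n → ℂ) ℝ).hasFDerivAt
    exact this.const_mul _

lemma pk_vX {n : ℕ} (j k : Fin n) (v : Hn n) : pk n j (vX n k v) = if j = k then 1 else 0 := by
  simp [pk, vX, eX, eT]
lemma pk_vY {n : ℕ} (j k : Fin n) (v : Hn n) : pk n j (vY n k v) = if j = k then Complex.I else 0 := by
  simp [pk, vY, eY, eT]

lemma dsg_vX {n : ℕ} (z : Vn n) (v : Hn n) (k : Fin n) :
    dsg z v (vX n k v) = 2 * (starRingEnd ℂ) (ww z k v) := by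
  have h2 : (vX n k v).2 = 2 * (v.1 k).im := by simp [vX, eX, eT]
  simp only [dsg, sub_apply, sum_apply, add_apply,
    smul_apply, ContinuousLinearMap.comp_apply, pk_vX, cj_apply, ContinuousLinearMap.coe_snd', h2,
    smul_eq_mul, Complex.ofRealCLM_apply]
  rw [Finset.sum_eq_single k (by intro j _ hj; simp [hj]) (by simp)]
  apply Complex.ext <;> simp [ww] <;> ring
lemma dsg_vY {n : ℕ} (z : Vn n) (v : Hn n) (k : Fin n) :
    dsg z v (vY n k v) = 2 * Complex.I * (starRingEnd ℂ) (ww z k v) := by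
  have h2 : (vY n k v).2 = -(2 * (v.1 k).re) := by simp [vY, eY, eT]
  simp only [dsg, sub_apply, sum_apply, add_apply,
    smul_apply, ContinuousLinearMap.comp_apply, pk_vY, cj_apply, ContinuousLinearMap.coe_snd', h2,
    smul_eq_mul, Complex.ofRealCLM_apply]
  rw [Finset.sum_eq_single k (by intro j _ hj; simp [hj]) (by simp)]
  apply Complex.ext <;> simp [ww] <;> ring

/-- building block -/
def EE {n : ℕ} (z : Vn n) (c : ℝ) (Θ : ℝ → ℝ) (p q : ℕ) (v : Hn n) : ℂ :=
  ((sg z v)⁻¹)^p * (((starRingEnd ℂ) (sg z v))⁻¹)^q * (Θ (c * Complex.normSq (sg z v)) : ℂ)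

def dTh (m : ℕ) (Θ : ℝ → ℝ) (s : ℝ) : ℝ := -m * Θ s + s * deriv Θ s

lemma has_invpow (p : ℕ) {x : ℂ} (hx : x ≠ 0) :
    HasDerivAt (fun x : ℂ => (x⁻¹)^p) (-p * (x⁻¹)^(p+1)) x := by
  have h := (hasDerivAt_inv hx).pow p
  refine h.congr_deriv ?_
  rcases p with _ | p
  · simp
  · simp only [Nat.add_sub_cancel, ← inv_pow]
    ring

lemma has_EE {n : ℕ} {z : Vn n} (hz : z ∈ Un n) (c : ℝ) {Θ : ℝ → ℝ} (hΘ : Differentiable ℝ Θ) (p q : ℕ) (v : Hn n) :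
    HasFDerivAt (EE z c Θ p q) (EE z c (dTh p Θ) (p+1) q v • dsg z v + EE z c (dTh q Θ) p (q+1) v • (cj ∘L dsg z v)) v := by
  have hs := has_sg z v
  have hne := sg_ne hz v
  have hne' : (starRingEnd ℂ) (sg z v) ≠ 0 := by simpa using hne
  have hcs : HasFDerivAt (fun v => (starRingEnd ℂ) (sg z v)) (cj ∘L dsg z v) v := cj.hasFDerivAt.comp v hs
  have h1 := ((has_invpow p hne).complexToReal_fderiv).comp v hs
  have h2 := ((has_invpow q hne').complexToReal_fderiv).comp v hcs
  have h3 : HasFDerivAt (fun v => Complex.normSq (sg z v)) (Complex.reCLM ∘L (sg z v • (cj ∘L dsg z v) + (starRingEnd ℂ) (sg z v) • dsg z v)) v := by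
    have := Complex.reCLM.hasFDerivAt.comp v (hs.mul hcs)
    refine this.congr_of_eventuallyEq (Eventually.of_forall fun v => ?_)
    simp [Complex.mul_conj]
  have h4 := Complex.ofRealCLM.hasFDerivAt.comp v (((hΘ _).hasDerivAt).comp_hasFDerivAt v (h3.const_mul c))
  have h5 := (h1.mul h2).mul h4
  refine HasFDerivAt.congr_fderiv h5 ?_
  refine ContinuousLinearMap.ext fun u => ?_
  have hre : ∀ d : ℂ, (((sg z v * (starRingEnd ℂ) d + (starRingEnd ℂ) (sg z v) * d).re : ℝ) : ℂ) = sg z v * (starRingEnd ℂ) d + (starRingEnd ℂ) (sg z v) * d := by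
    intro d
    apply Complex.ext <;> simp; ring
  simp only [EE, dTh, add_apply, smul_apply, ContinuousLinearMap.comp_apply, cj_apply,
    smul_eq_mul, Pi.mul_apply, Function.comp, ContinuousLinearMap.one_apply, Complex.ofRealCLM_apply, Complex.reCLM_apply, Complex.ofReal_mul, hre,
    Complex.ofReal_add, Complex.ofReal_neg, Complex.ofReal_natCast]
  have hn : ((Complex.normSq (sg z v) : ℝ) : ℂ) = sg z v * (starRingEnd ℂ) (sg z v) := (Complex.mul_conj _).symm
  rw [hn]
  generalize ((Θ (c * Complex.normSq (sg z v)) : ℝ) : ℂ) = t0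
  generalize ((deriv Θ (c * Complex.normSq (sg z v)) : ℝ) : ℂ) = t1
  generalize dsg z v u = d
  generalize (starRingEnd ℂ) (sg z v) = y at *
  generalize sg z v = x at *
  generalize (starRingEnd ℂ) d = d'
  have hx := mul_inv_cancel₀ hne
  have hy := mul_inv_cancel₀ hne'
  linear_combination (-(x⁻¹^p*y⁻¹^q*t1*c*x*d'))*hy - (x⁻¹^p*y⁻¹^q*t1*c*y*d)*hx
end

section

def mu {n : ℕ} (z : Vn n) (c0 c1 : ℂ) (j : Fin n) (v : Hn n) : ℂ := c0 + c1 * ww z j v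

lemma has_ww {n : ℕ} (z : Vn n) (k : Fin n) (v : Hn n) : HasFDerivAt (ww z k) (pk n k) v :=
  (has_pk k v).sub_const _
lemma has_cww {n : ℕ} (z : Vn n) (k : Fin n) (v : Hn n) :
    HasFDerivAt (fun v => (starRingEnd ℂ) (ww z k v)) (cj ∘L pk n k) v :=
  cj.hasFDerivAt.comp v (has_ww z k v)
lemma has_mu {n : ℕ} (z : Vn n) (c0 c1 : ℂ) (j : Fin n) (v : Hn n) :
    HasFDerivAt (mu z c0 c1 j) (c1 • pk n j) v := ((has_ww z j v).const_mul c1).const_add c0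

lemma contDiff_sg {n : ℕ} (z : Vn n) {m : WithTop ℕ∞} : ContDiff ℝ m (sg z) := by
  unfold sg
  have hk : ∀ k, ContDiff ℝ m (fun v : Hn n => v.1 k) := fun k => (pk n k).contDiff
  have hk' : ∀ k, ContDiff ℝ m (fun v : Hn n => (starRingEnd ℂ) (v.1 k)) := fun k => (cj ∘L pk n k).contDiff
  refine ContDiff.sub (contDiff_const.add (ContDiff.sum fun k _ => ((hk k).mul (hk' k)).sub (contDiff_const.mul (hk k)))) ?_
  exact contDiff_const.mul (Complex.ofRealCLM.contDiff.comp contDiff_snd)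

lemma contDiff_mu {n : ℕ} (z : Vn n) (c0 c1 : ℂ) (j : Fin n) {m : WithTop ℕ∞} : ContDiff ℝ m (mu z c0 c1 j) := by
  unfold mu ww
  have hk : ContDiff ℝ m (fun v : Hn n => v.1 j) := (pk n j).contDiff
  exact contDiff_const.add (contDiff_const.mul (hk.sub contDiff_const))

lemma contDiff_EE {n : ℕ} {z : Vn n} (hz : z ∈ Un n) (c : ℝ) {Θ : ℝ → ℝ} {m : WithTop ℕ∞} (hΘ : ContDiff ℝ m Θ) (p q : ℕ) :
    ContDiff ℝ m (EE z c Θ p q) := by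
  unfold EE
  have hs := contDiff_sg z (m := m)
  have hcs : ContDiff ℝ m (fun v => (starRingEnd ℂ) (sg z v)) := cj.contDiff.comp hs
  have hns : ContDiff ℝ m (fun v => Complex.normSq (sg z v)) := by
    have : (fun v => Complex.normSq (sg z v)) = fun v => Complex.reCLM (sg z v * (starRingEnd ℂ) (sg z v)) := by
      ext v; simp [Complex.mul_conj]
    rw [this]
    exact Complex.reCLM.contDiff.comp (hs.mul hcs)
  refine (((hs.inv (sg_ne hz)).pow p).mul ((hcs.inv (fun v => by simpa using sg_ne hz v)).pow q)).mul ?_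
  exact Complex.ofRealCLM.contDiff.comp (hΘ.comp (contDiff_const.mul hns))

lemma Zd_muE {n : ℕ} {z : Vn n} (hz : z ∈ Un n) (c0 c1 : ℂ) (j k : Fin n) (c : ℝ) {Θ : ℝ → ℝ} (hΘ : Differentiable ℝ Θ)
    (p q : ℕ) (v : Hn n) :
    Zd n k (fun v => mu z c0 c1 j v * EE z c Θ p q v) v =
      (if j = k then c1 else 0) * EE z c Θ p q v
      + mu z c0 c1 j v * (2 * (starRingEnd ℂ) (ww z k v)) * EE z c (dTh p Θ) (p+1) q v := by
  have h := (has_mu z c0 c1 j v).mul (has_EE hz c hΘ p q v)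
  have h' : HasFDerivAt (fun v => mu z c0 c1 j v * EE z c Θ p q v) _ v := h
  rw [Zd_eq k h']
  simp only [add_apply, smul_apply, ContinuousLinearMap.comp_apply, smul_eq_mul, pk_vX, pk_vY, dsg_vX, dsg_vY, cj_apply,
    map_mul, Complex.conj_I, Complex.conj_conj, map_ofNat]
  split_ifs
  · linear_combination (-mu z c0 c1 j v * EE z c (dTh p Θ) (p+1) q v * (starRingEnd ℂ) (ww z k v) 
      + mu z c0 c1 j v * EE z c (dTh q Θ) p (q+1) v * ww z k v - (1/2) * EE z c Θ p q v * c1) * Complex.I_sq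
  · linear_combination (-mu z c0 c1 j v * EE z c (dTh p Θ) (p+1) q v * (starRingEnd ℂ) (ww z k v) 
      + mu z c0 c1 j v * EE z c (dTh q Θ) p (q+1) v * ww z k v) * Complex.I_sq

lemma Zb_second {n : ℕ} {z : Vn n} (hz : z ∈ Un n) (c0 c1 d : ℂ) (j k : Fin n) (c : ℝ) {Θ : ℝ → ℝ} (hΘ : Differentiable ℝ Θ)
    {Θ1 : ℝ → ℝ} (hΘ1 : Differentiable ℝ Θ1) (p q : ℕ) (v : Hn n) :
    ZbarH n k (fun v => d * EE z c Θ p q v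
      + mu z c0 c1 j v * (2 * (starRingEnd ℂ) (ww z k v)) * EE z c Θ1 (p+1) q v) v =
      d * (2 * ww z k v * EE z c (dTh q Θ) p (q+1) v) + mu z c0 c1 j v * 2 * EE z c Θ1 (p+1) q v
      + mu z c0 c1 j v * (2 * (starRingEnd ℂ) (ww z k v)) * (2 * ww z k v) * EE z c (dTh q Θ1) (p+1) (q+1) v := by
  have h := ((has_EE hz c hΘ p q v).const_mul d).add
    (((has_mu z c0 c1 j v).mul ((has_cww z k v).const_mul 2)).mul (has_EE hz c hΘ1 (p+1) q v))
  have h' : HasFDerivAt (fun v => d * EE z c Θ p q v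
      + mu z c0 c1 j v * (2 * (starRingEnd ℂ) (ww z k v)) * EE z c Θ1 (p+1) q v) _ v := h
  rw [Zb_eq k h']
  simp only [add_apply, smul_apply, ContinuousLinearMap.comp_apply, smul_eq_mul, pk_vX, pk_vY, dsg_vX, dsg_vY, cj_apply,
    map_mul, Complex.conj_I, Complex.conj_conj, map_ofNat, if_true, map_one, Pi.mul_apply]
  generalize EE z c (dTh p Θ) (p+1) q v = e1
  generalize EE z c (dTh (p+1) Θ1) (p+1+1) q v = e3
  split_ifs
  all_goals
    ring_nf
    try simp only [Complex.I_sq]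
    try ring

lemma dTh_diff {Θ : ℝ → ℝ} {m : ℕ} (q : ℕ) (hΘ : ContDiff ℝ (m+1) Θ) : ContDiff ℝ m (dTh q Θ) := by
  unfold dTh
  have h1 : ContDiff ℝ m Θ := hΘ.of_le (by exact_mod_cast Nat.le_succ m)
  have h2 : ContDiff ℝ m (deriv Θ) := by
    have := (contDiff_succ_iff_deriv.1 hΘ).2.2
    exact this
  exact (contDiff_const.mul h1).add (contDiff_id.mul h2)

lemma LH_muE {n : ℕ} {z : Vn n} (hz : z ∈ Un n) (c0 c1 : ℂ) (j : Fin n) (c : ℝ) {Θ : ℝ → ℝ} (hΘ : ContDiff ℝ 2 Θ)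
    (p q : ℕ) (v : Hn n) :
    LH n (-(n:ℝ)) (fun v => mu z c0 c1 j v * EE z c Θ p q v) v =
     -(2 * c1 * ww z j v * EE z c (dTh q Θ) p (q+1) v + 2 * n * mu z c0 c1 j v * EE z c (dTh p Θ) (p+1) q v
      + 2 * (sg z v + (starRingEnd ℂ) (sg z v) - 2 * AA z) * mu z c0 c1 j v * EE z c (dTh q (dTh p Θ)) (p+1) (q+1) v) := by
  rw [LH_Z ((contDiff_mu z c0 c1 j).mul (contDiff_EE hz c hΘ p q))]
  have hd : Differentiable ℝ Θ := hΘ.differentiable two_ne_zero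
  have hd1 : Differentiable ℝ (dTh p Θ) :=
    (dTh_diff (m := 1) p (by rw [Nat.cast_one, one_add_one_eq_two]; exact hΘ)).differentiable (by simp)
  have e : ∀ k, Zd n k (fun v => mu z c0 c1 j v * EE z c Θ p q v) = fun v => 
      (if j = k then c1 else 0) * EE z c Θ p q v
      + mu z c0 c1 j v * (2 * (starRingEnd ℂ) (ww z k v)) * EE z c (dTh p Θ) (p+1) q v :=
    fun k => funext (Zd_muE hz c0 c1 j k c hd p q)
  simp_rw [e, fun k => Zb_second hz c0 c1 (if j = k then c1 else 0) j k c hd hd1 p q v]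
  congr 1
  rw [← two_sum_ww]
  simp only [ite_mul, zero_mul, Finset.sum_add_distrib, Finset.sum_ite_eq, Finset.mem_univ, if_true, Finset.sum_const,
    Finset.card_univ, Fintype.card_fin, nsmul_eq_mul, Finset.mul_sum, Finset.sum_mul]
  congr 1
  · ring
  · refine Finset.sum_congr rfl (fun k _ => by ring)

/-- translated kernel denominators -/
def s0 {n : ℕ} (A : ℝ) (u : Hn n) : ℂ := ((A + ∑ k, ‖u.1 k‖^2 : ℝ) : ℂ) - Complex.I * (u.2 : ℂ)

lemma s0_re {n : ℕ} (A : ℝ) (u : Hn n) : (s0 A u).re = A + ∑ k, ‖u.1 k‖^2 := by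
  simp [s0, -Complex.ofReal_add, -Complex.ofReal_sum]
lemma s0_im {n : ℕ} (A : ℝ) (u : Hn n) : (s0 A u).im = - u.2 := by
  simp [s0, -Complex.ofReal_add, -Complex.ofReal_sum]

def wz {n : ℕ} (z : Vn n) : Hn n := (z.1, z.2.re)

lemma sg_gm {n : ℕ} (z : Vn n) (u : Hn n) : sg z (gm (wz z) u) = s0 (AA z) u := by
  apply Complex.ext
  · rw [sg_re, s0_re]
    simp [ww, gm, wz]
  · simp only [sg, s0, gm, wz, AA, Complex.sub_im, Complex.add_im, Complex.im_sum, Complex.mul_im, Complex.I_re, Complex.I_im,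
      Complex.ofReal_re, Complex.ofReal_im, Complex.conj_re, Complex.conj_im, Complex.mul_re, Pi.add_apply, Complex.add_re]
    have : ∀ k, ((z.1 k).re + (u.1 k).re) * -((z.1 k).im + (u.1 k).im) + ((z.1 k).im + (u.1 k).im) * ((z.1 k).re + (u.1 k).re) -
        (((2:ℂ).re * (z.1 k).re - (2:ℂ).im * -(z.1 k).im) * ((z.1 k).im + (u.1 k).im) +
          ((2:ℂ).re * -(z.1 k).im + (2:ℂ).im * (z.1 k).re) * ((z.1 k).re + (u.1 k).re)) = 
          2 * ((z.1 k).re * -(u.1 k).im + (z.1 k).im * (u.1 k).re) := by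
      intro k
      simp; ring
    simp_rw [this]
    rw [← Finset.mul_sum]
    ring

lemma norm_sq_le_s0 {n : ℕ} {A : ℝ} (hA : 0 < A) (u : Hn n) : A + ‖u.1‖^2 ≤ ‖s0 A u‖ * 1 := by
  have h1 := Complex.re_le_norm (s0 A u)
  rw [s0_re] at h1
  have h0 : 0 ≤ ∑ k, ‖u.1 k‖ ^ 2 := Finset.sum_nonneg (fun _ _ => by positivity)
  have h2 : ‖u.1‖ ≤ √(∑ k, ‖u.1 k‖ ^ 2) := by
    refine (pi_norm_le_iff_of_nonneg (Real.sqrt_nonneg _)).2 (fun j => ?_)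
    refine Real.le_sqrt_of_sq_le ?_
    exact Finset.single_le_sum (f := fun j => ‖u.1 j‖^2) (fun _ _ => by positivity) (Finset.mem_univ j)
  have h3 : ‖u.1‖^2 ≤ ∑ k, ‖u.1 k‖ ^ 2 := by
    calc ‖u.1‖^2 ≤ (√(∑ k, ‖u.1 k‖ ^ 2))^2 := by gcongr
      _ = _ := Real.sq_sqrt h0
  linarith

lemma abs_le_s0 {n : ℕ} (A : ℝ) (u : Hn n) : |u.2| ≤ ‖s0 A u‖ := by
  have := Complex.abs_im_le_norm (s0 A u)
  rwa [s0_im, abs_neg] at this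

lemma continuous_s0 {n : ℕ} (A : ℝ) : Continuous (s0 A : Hn n → ℂ) := by
  unfold s0; fun_prop

lemma integrable_s0 {n : ℕ} {A : ℝ} (hA : 0 < A) :
    Integrable (fun u : Hn n => ‖s0 A u‖ ^ (-((n:ℝ) + 3/2))) := by
  -- a constant
  set B : ℝ := 2 + 2/A with hB
  have hB0 : 0 < B := by positivity
  have hs : ∀ u : Hn n, A ≤ ‖s0 A u‖ := fun u => by
    have := norm_sq_le_s0 hA u
    nlinarith [sq_nonneg ‖u.1‖]
  have b1 : ∀ u : Hn n, (1 + ‖u.1‖)^2 ≤ B * ‖s0 A u‖ := by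
    intro u
    have := norm_sq_le_s0 hA u
    have h2 : 2 ≤ 2/A * ‖s0 A u‖ := by
      calc (2:ℝ) = 2/A * A := by field_simp
        _ ≤ _ := by gcongr; exact hs u
    nlinarith [sq_nonneg (‖u.1‖ - 1)]
  have b2 : ∀ u : Hn n, (1 + ‖u.2‖) ≤ B * ‖s0 A u‖ := by
    intro u
    have := abs_le_s0 A u
    have h2 : 2 ≤ 2/A * ‖s0 A u‖ := by
      calc (2:ℝ) = 2/A * A := by field_simp
        _ ≤ _ := by gcongr; exact hs u
    rw [Real.norm_eq_abs]
    nlinarith [norm_nonneg (s0 A u)]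
  have i1 : Integrable (fun x : Fin n → ℂ => (1 + ‖x‖) ^ (-(2 * (n:ℝ) + 1/2))) :=
    integrable_one_add_norm (by
      have : Module.finrank ℝ (Fin n → ℂ) = n * 2 := by
        rw [Module.finrank_pi_fintype]; simp
      rw [this]; push_cast; linarith)
  have i2 : Integrable (fun x : ℝ => (1 + ‖x‖) ^ (-(5/4 : ℝ))) :=
    integrable_one_add_norm (by simp; norm_num)
  have i3 := (i1.mul_prod i2).const_mul (B ^ ((n:ℝ) + 3/2))
  refine Integrable.mono' i3 ?_ (Eventually.of_forall (fun u => ?_))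
  · refine Continuous.aestronglyMeasurable ?_
    exact (continuous_s0 A).norm.rpow_const (fun u => Or.inl (by linarith [hs u]))
  · have hsp : 0 < ‖s0 A u‖ := by linarith [hs u]
    rw [Real.norm_of_nonneg (by positivity)]
    have c1 : (B * ‖s0 A u‖) ^ (-((n:ℝ) + 1/4)) ≤ (1 + ‖u.1‖) ^ (-(2 * (n:ℝ) + 1/2)) := by
      have : (1 + ‖u.1‖) ^ (-(2 * (n:ℝ) + 1/2)) = ((1 + ‖u.1‖)^2) ^ (-((n:ℝ) + 1/4)) := by
        rw [← Real.rpow_natCast, ← Real.rpow_mul (by positivity)]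
        congr 1; push_cast; ring
      rw [this]
      exact Real.rpow_le_rpow_of_nonpos (by positivity) (b1 u) (by linarith [n.cast_nonneg (α := ℝ)])
    have c2 : (B * ‖s0 A u‖) ^ (-(5/4:ℝ)) ≤ (1 + ‖u.2‖) ^ (-(5/4 : ℝ)) :=
      Real.rpow_le_rpow_of_nonpos (by positivity) (b2 u) (by norm_num)
    have c3 : ‖s0 A u‖ ^ (-((n:ℝ) + 3/2)) = B ^ ((n:ℝ) + 3/2) * ((B * ‖s0 A u‖) ^ (-((n:ℝ) + 1/4)) * (B * ‖s0 A u‖) ^ (-(5/4:ℝ))) := by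
      rw [← Real.rpow_add (by positivity), Real.mul_rpow hB0.le hsp.le, ← mul_assoc, ← Real.rpow_add hB0]
      have : (n:ℝ) + 3/2 + (-(n + 1/4) + -(5/4)) = 0 := by ring
      rw [this, Real.rpow_zero, one_mul]
      congr 1; ring
    rw [c3]
    gcongr

lemma integrable_sg {n : ℕ} {z : Vn n} (hz : z ∈ Un n) :
    Integrable (fun v : Hn n => ‖sg z v‖ ^ (-((n:ℝ) + 3/2))) := by
  rw [← (gm_left_mp (wz z)).integrable_comp_emb (gmLeftHomeo (wz z)).measurableEmbedding]
  have := integrable_s0 (n := n) (AA_pos hz)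
  refine this.congr (Eventually.of_forall fun u => ?_)
  simp only [Function.comp]
  rw [sg_gm]

lemma compact_sg {n : ℕ} {z : Vn n} (hz : z ∈ Un n) (E : ℝ) : IsCompact {v : Hn n | ‖sg z v‖ ≤ E} := by
  have h1 : IsCompact {u : Hn n | ‖s0 (AA z) u‖ ≤ E} := by
    refine Metric.isCompact_of_isClosed_isBounded (isClosed_le (continuous_s0 _).norm continuous_const) ?_
    refine (Metric.isBounded_closedBall (x := (0 : Hn n)) (r := E + 1)).subset ?_
    intro u hu
    have hu : ‖s0 (AA z) u‖ ≤ E := hu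
    rw [mem_closedBall_zero_iff]
    have := norm_sq_le_s0 (AA_pos hz) u
    have h0 := AA_pos hz
    refine max_le ?_ ?_
    · nlinarith [sq_nonneg (‖u.1‖ - 1)]
    · rw [Real.norm_eq_abs]; linarith [abs_le_s0 (AA z) u]
  refine (h1.image (continuous_gm_left (wz z))).of_isClosed_subset
    (isClosed_le (contDiff_sg z (m := 0)).continuous.norm continuous_const) ?_
  intro v hv
  refine ⟨gm (ginv (wz z)) v, ?_, gm_ginv_cancel'' _ _⟩
  change ‖s0 _ _‖ ≤ E
  rw [← sg_gm, gm_ginv_cancel'']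
  exact hv
end

section

/-- the smooth cutoff -/
def th : ContDiffBump (0:ℝ) := ⟨1, 2, one_pos, one_lt_two⟩

lemma th_contDiff {m : ℕ∞} : ContDiff ℝ m (th : ℝ → ℝ) := th.contDiff

lemma dTh_hcs {Θ : ℝ → ℝ} (h : HasCompactSupport Θ) (m : ℕ) : HasCompactSupport (dTh m Θ) := by
  unfold dTh
  have h1 : HasCompactSupport (fun s => -(m:ℝ) * Θ s) := h.mul_left
  have h2 : HasCompactSupport (fun s => s * deriv Θ s) := h.deriv.mul_left
  exact h1.add h2

lemma bdd_of_hcs {Θ : ℝ → ℝ} (hc : Continuous Θ) (h : HasCompactSupport Θ) : ∃ B, 0 ≤ B ∧ ∀ s, |Θ s| ≤ B := by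
  obtain ⟨B, hB⟩ := h.exists_bound_of_continuous hc
  exact ⟨B, (norm_nonneg _).trans (hB 0), hB⟩

lemma dTh_const {Θ : ℝ → ℝ} {d : ℝ} (h : ∀ᶠ s in 𝓝 (0:ℝ), Θ s = d) (m : ℕ) :
    ∀ᶠ s in 𝓝 (0:ℝ), dTh m Θ s = -m * d := by
  filter_upwards [h.eventually_nhds] with s hs
  have : deriv Θ s = 0 := by
    have e : Θ =ᶠ[𝓝 s] fun _ => d := hs
    rw [e.deriv_eq]; simp
  rw [dTh, this, hs.self_of_nhds]; ring

lemma th_one : ∀ᶠ s in 𝓝 (0:ℝ), th s = 1 := th.eventuallyEq_one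

lemma norm_EE {n : ℕ} (z : Vn n) (c : ℝ) {Θ : ℝ → ℝ} {B : ℝ} (hB : ∀ s, |Θ s| ≤ B) (p q : ℕ) (v : Hn n) :
    ‖EE z c Θ p q v‖ ≤ B * (‖sg z v‖⁻¹)^(p+q) := by
  unfold EE
  rw [norm_mul, norm_mul, norm_pow, norm_pow, norm_inv, norm_inv, RCLike.norm_conj, ← pow_add, Complex.norm_real, mul_comm]
  gcongr
  exact hB _

lemma ww_le {n : ℕ} {z : Vn n} (hz : z ∈ Un n) (j : Fin n) (v : Hn n) : ‖ww z j v‖ ≤ √‖sg z v‖ := by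
  refine Real.le_sqrt_of_sq_le ?_
  have h1 := Complex.re_le_norm (sg z v)
  rw [sg_re] at h1
  have := AA_pos hz
  have h2 : ‖ww z j v‖^2 ≤ ∑ k, ‖ww z k v‖^2 :=
    Finset.single_le_sum (f := fun j => ‖ww z j v‖^2) (fun _ _ => by positivity) (Finset.mem_univ j)
  linarith

lemma sum_le {n : ℕ} {z : Vn n} (hz : z ∈ Un n) (v : Hn n) :
    ‖sg z v + (starRingEnd ℂ) (sg z v) - 2 * AA z‖ ≤ 2 * ‖sg z v‖ := by
  have h1 := Complex.re_le_norm (sg z v)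
  have h2 := sg_re_pos hz v
  have h3 := AA_pos hz
  have : sg z v + (starRingEnd ℂ) (sg z v) - 2 * AA z = ((2 * ((sg z v).re - AA z) : ℝ) : ℂ) := by
    rw [Complex.add_conj]; push_cast; ring
  rw [this, Complex.norm_real, Real.norm_of_nonneg (by linarith)]
  linarith

lemma mu_le {n : ℕ} {z : Vn n} (hz : z ∈ Un n) (c0 c1 : ℂ) (j : Fin n) (v : Hn n) :
    ‖mu z c0 c1 j v‖ ≤ (‖c0‖ / √(AA z) + ‖c1‖) * √‖sg z v‖ := by
  have h0 := AA_pos hz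
  have h1 : √(AA z) ≤ √‖sg z v‖ := Real.sqrt_le_sqrt (sg_norm_ge hz v)
  have h2 : 0 < √(AA z) := Real.sqrt_pos.2 h0
  calc ‖mu z c0 c1 j v‖ ≤ ‖c0‖ + ‖c1 * ww z j v‖ := norm_add_le _ _
    _ ≤ ‖c0‖ / √(AA z) * √‖sg z v‖ + ‖c1‖ * √‖sg z v‖ := by
        rw [norm_mul]
        have : ‖c0‖ = ‖c0‖ / √(AA z) * √(AA z) := by field_simp
        gcongr ?_ + ?_
        · rw [this]; gcongr
          rw [← this]
        · gcongr; exact ww_le hz j v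
    _ = _ := by ring

lemma pow_dom {A s : ℝ} (hA : 0 < A) (hs : A ≤ s) (n m : ℕ) (h : n + 1 ≤ m) :
    √s * (s⁻¹)^(m+1) ≤ (A⁻¹)^(m-n-1) * s ^ (-((n:ℝ) + 3/2)) := by
  have hs0 : 0 < s := hA.trans_le hs
  have e : m + 1 = (m-n-1) + (n+2) := by omega
  have e2 : √s * (s⁻¹)^(n+2) = s ^ (-((n:ℝ) + 3/2)) := by
    rw [Real.sqrt_eq_rpow, ← Real.rpow_natCast, ← Real.rpow_neg_one, ← Real.rpow_mul hs0.le, ← Real.rpow_add hs0]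
    congr 1; push_cast; ring
  rw [e, pow_add, ← e2]
  have : (s⁻¹)^(m-n-1) ≤ (A⁻¹)^(m-n-1) := by gcongr
  calc √s * ((s⁻¹)^(m-n-1) * (s⁻¹)^(n+2)) = (s⁻¹)^(m-n-1) * (√s * (s⁻¹)^(n+2)) := by ring
    _ ≤ _ := by gcongr

/-- limit expression -/
def GG {n : ℕ} (z : Vn n) (c0 c1 : ℂ) (j : Fin n) (p q : ℕ) (v : Hn n) : ℂ :=
  -(2 * c1 * ww z j v * (((sg z v)⁻¹)^p * (((starRingEnd ℂ) (sg z v))⁻¹)^(q+1) * (-q))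
    + 2 * n * mu z c0 c1 j v * (((sg z v)⁻¹)^(p+1) * (((starRingEnd ℂ) (sg z v))⁻¹)^q * (-p))
      + 2 * (sg z v + (starRingEnd ℂ) (sg z v) - 2 * AA z) * mu z c0 c1 j v *
        (((sg z v)⁻¹)^(p+1) * (((starRingEnd ℂ) (sg z v))⁻¹)^(q+1) * (q * p)))

lemma muE_hcs {n : ℕ} {z : Vn n} (hz : z ∈ Un n) (c0 c1 : ℂ) (j : Fin n) {c : ℝ} (hc : 0 < c) (p q : ℕ) :
    HasCompactSupport (fun v => mu z c0 c1 j v * EE z c th p q v) := by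
  refine HasCompactSupport.intro (compact_sg hz (√(2/c))) (fun v hv => ?_)
  have hv : ¬ ‖sg z v‖ ≤ √(2/c) := hv
  have : (th : ℝ → ℝ) (c * Complex.normSq (sg z v)) = 0 := by
    refine th.zero_of_le_dist ?_
    rw [dist_zero_right, Complex.normSq_eq_norm_sq, Real.norm_of_nonneg (by positivity)]
    change 2 ≤ _
    push Not at hv
    have := (Real.sqrt_lt' (by linarith [Real.sqrt_nonneg (2/c)])).1 hv
    rw [div_lt_iff₀ hc] at this
    linarith
  simp [EE, this]

lemma int_zero {n : ℕ} {z : Vn n} (hz : z ∈ Un n) {f : Hn n → ℂ} (hf : ContDiff ℝ 2 f) {C : ℝ} (hC : ∀ v, ‖f v‖ ≤ C)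
    (hL : ∀ w, LH n (n:ℝ) f w = 0) (c0 c1 : ℂ) (j : Fin n) (p q : ℕ) (hpq : n + 1 ≤ p + q) :
    ∫ v, f v * GG z c0 c1 j p q v = 0 := by
  have hA := AA_pos hz
  have hC0 : 0 ≤ C := (norm_nonneg _).trans (hC 0)
  have t2 : ContDiff ℝ 2 (th : ℝ → ℝ) := th_contDiff (m := 2)
  have t1 : ∀ m, ContDiff ℝ 1 (dTh m th) := fun m => dTh_diff (m := 1) m (by rw [Nat.cast_one, one_add_one_eq_two]; exact t2)
  have t0 : ∀ m m', ContDiff ℝ 0 (dTh m' (dTh m th)) := fun m m' => dTh_diff (m := 0) m' (by simpa using t1 m)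
  obtain ⟨B1, hB1, hB1'⟩ := bdd_of_hcs (t1 q).continuous (dTh_hcs th.hasCompactSupport q)
  obtain ⟨B2, hB2, hB2'⟩ := bdd_of_hcs (t1 p).continuous (dTh_hcs th.hasCompactSupport p)
  obtain ⟨B3, hB3, hB3'⟩ := bdd_of_hcs (t0 p q).continuous (dTh_hcs (dTh_hcs th.hasCompactSupport p) q)
  have hz0 : ∀ c : ℝ, 0 < c → ∫ v, f v * LH n (-(n:ℝ)) (fun v => mu z c0 c1 j v * EE z c th p q v) v = 0 := by
    intro c hc
    rw [← weak_identity hf ((contDiff_mu z c0 c1 j).mul (contDiff_EE hz c t2 p q)) (muE_hcs hz c0 c1 j hc p q) n]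
    simp [hL]
  have hmeas : ∀ c : ℝ, Continuous (fun v => f v * LH n (-(n:ℝ)) (fun v => mu z c0 c1 j v * EE z c th p q v) v) := fun c =>
    hf.continuous.mul (contDiff_LH ((contDiff_mu z c0 c1 j).mul (contDiff_EE hz c t2 p q)) _)
  set D := ‖c0‖ / √(AA z) + ‖c1‖ with hD
  have hD0 : 0 ≤ D := by positivity
  set M := 2 * ‖c1‖ * B1 + 2 * n * D * B2 + 4 * D * B3 with hM
  have hM0 : 0 ≤ M := by positivity
  have key : Tendsto (fun c : ℝ => ∫ v, f v * LH n (-(n:ℝ)) (fun v => mu z c0 c1 j v * EE z c th p q v) v) (𝓝[>] 0)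
      (𝓝 (∫ v, f v * GG z c0 c1 j p q v)) := by
    refine tendsto_integral_filter_of_dominated_convergence
      (fun v => C * (M * ((AA z)⁻¹^(p+q-n-1) * ‖sg z v‖ ^ (-((n:ℝ) + 3/2)))))
      (Eventually.of_forall fun c => (hmeas c).aestronglyMeasurable) (Eventually.of_forall fun c => Eventually.of_forall fun v => ?_)
      ((((integrable_sg hz).const_mul _).const_mul _).const_mul _) (Eventually.of_forall fun v => ?_)
    · rw [norm_mul, LH_muE hz c0 c1 j c t2, norm_neg]
      refine mul_le_mul (hC v) ?_ (norm_nonneg _) hC0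
      have hs0 : 0 < ‖sg z v‖ := hA.trans_le (sg_norm_ge hz v)
      have k0 := pow_dom hA (sg_norm_ge hz v) n (p+q) hpq
      have n1 : ‖2 * c1 * ww z j v * EE z c (dTh q th) p (q+1) v‖ ≤ 2 * ‖c1‖ * B1 * (√‖sg z v‖ * (‖sg z v‖⁻¹)^(p+q+1)) := by
        rw [norm_mul, norm_mul, norm_mul, Complex.norm_ofNat]
        calc _ ≤ 2 * ‖c1‖ * √‖sg z v‖ * (B1 * (‖sg z v‖⁻¹)^(p+(q+1))) := by
              gcongr
              · exact ww_le hz j v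
              · exact norm_EE z c hB1' _ _ v
          _ = _ := by rw [← add_assoc]; ring
      have n2 : ‖2 * n * mu z c0 c1 j v * EE z c (dTh p th) (p+1) q v‖ ≤ 2 * n * D * B2 * (√‖sg z v‖ * (‖sg z v‖⁻¹)^(p+q+1)) := by
        rw [norm_mul, norm_mul, norm_mul, Complex.norm_ofNat, Complex.norm_natCast]
        calc _ ≤ 2 * n * (D * √‖sg z v‖) * (B2 * (‖sg z v‖⁻¹)^(p+1+q)) := by
              gcongr
              · exact mu_le hz c0 c1 j v
              · exact norm_EE z c hB2' _ _ v
          _ = _ := by rw [show p+1+q = p+q+1 by ring]; ring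
      have n3 : ‖2 * (sg z v + (starRingEnd ℂ) (sg z v) - 2 * AA z) * mu z c0 c1 j v * EE z c (dTh q (dTh p th)) (p+1) (q+1) v‖
          ≤ 4 * D * B3 * (√‖sg z v‖ * (‖sg z v‖⁻¹)^(p+q+1)) := by
        rw [norm_mul, norm_mul, norm_mul, Complex.norm_ofNat]
        calc _ ≤ 2 * (2 * ‖sg z v‖) * (D * √‖sg z v‖) * (B3 * (‖sg z v‖⁻¹)^(p+1+(q+1))) := by
              gcongr
              · exact sum_le hz v
              · exact mu_le hz c0 c1 j v
              · exact norm_EE z c hB3' _ _ v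
          _ = _ := by
              rw [show p+1+(q+1) = p+q+1+1 by ring, pow_succ]
              have := mul_inv_cancel₀ hs0.ne'
              linear_combination 4 * D * √‖sg z v‖ * B3 * (‖sg z v‖⁻¹)^(p+q+1) * this
      calc _ ≤ _ := norm_add₃_le
        _ ≤ M * (√‖sg z v‖ * (‖sg z v‖⁻¹)^(p+q+1)) := by rw [hM]; linarith
        _ ≤ _ := by gcongr
    · refine Tendsto.congr' ?_ tendsto_const_nhds
      have hl : Tendsto (fun c : ℝ => c * Complex.normSq (sg z v)) (𝓝[>] 0) (𝓝 0) := by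
        have : Tendsto (fun c : ℝ => c * Complex.normSq (sg z v)) (𝓝 0) (𝓝 (0 * Complex.normSq (sg z v))) :=
          tendsto_id.mul_const _
        rw [zero_mul] at this
        exact this.mono_left nhdsWithin_le_nhds
      filter_upwards [hl.eventually (dTh_const th_one q), hl.eventually (dTh_const th_one p),
        hl.eventually (dTh_const (dTh_const th_one p) q)] with c h1 h2 h3
      rw [LH_muE hz c0 c1 j c t2]
      simp only [EE, h1, h2, h3, GG]
      push_cast
      ring
  refine tendsto_nhds_unique key (Tendsto.congr' ?_ tendsto_const_nhds)
  filter_upwards [self_mem_nhdsWithin] with c hc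
  exact (hz0 c hc).symm
end

section

lemma integrable_dom {n : ℕ} {z : Vn n} (hz : z ∈ Un n) {E : Type*} [NormedAddCommGroup E] [NormedSpace ℝ E] {g : Hn n → E}
    (hg : AEStronglyMeasurable g) {K : ℝ} (hK : 0 ≤ K)
    {m : ℕ} (hm : n + 1 ≤ m) (h : ∀ v, ‖g v‖ ≤ K * (√‖sg z v‖ * (‖sg z v‖⁻¹)^(m+1))) : Integrable g := by
  refine Integrable.mono' (((integrable_sg hz).const_mul ((AA z)⁻¹^(m-n-1))).const_mul K) hg
    (Eventually.of_forall fun v => (h v).trans ?_)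
  have := pow_dom (AA_pos hz) (sg_norm_ge hz v) n m hm
  gcongr

lemma pow_half {A s : ℝ} (hA : 0 < A) (hs : A ≤ s) (m : ℕ) : (s⁻¹)^m ≤ (√A)⁻¹ * (√s * (s⁻¹)^m) := by
  have h1 : 1 ≤ (√A)⁻¹ * √s := by
    rw [inv_mul_eq_div, one_le_div (Real.sqrt_pos.2 hA)]
    exact Real.sqrt_le_sqrt hs
  have h2 : 0 ≤ (s⁻¹)^m := by have := hA.le.trans hs; positivity
  nlinarith

/-- monomials in the inverse denominators -/
def XY {n : ℕ} (z : Vn n) (p q : ℕ) (v : Hn n) : ℂ := ((sg z v)⁻¹)^p * (((starRingEnd ℂ) (sg z v))⁻¹)^q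

lemma continuous_XY {n : ℕ} {z : Vn n} (hz : z ∈ Un n) (p q : ℕ) : Continuous (XY z p q) := by
  have hs := (contDiff_sg z (m := 0)).continuous
  unfold XY
  exact ((hs.inv₀ (sg_ne hz)).pow p).mul (((Complex.continuous_conj.comp hs).inv₀ (fun v => by simpa using sg_ne hz v)).pow q)

lemma norm_XY {n : ℕ} (z : Vn n) (p q : ℕ) (v : Hn n) : ‖XY z p q v‖ = (‖sg z v‖⁻¹)^(p+q) := by
  unfold XY
  rw [norm_mul, norm_pow, norm_pow, norm_inv, norm_inv, RCLike.norm_conj, ← pow_add]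

lemma continuous_ww {n : ℕ} (z : Vn n) (j : Fin n) : Continuous (ww z j) := by
  unfold ww; fun_prop

lemma integrable_fXY {n : ℕ} {z : Vn n} (hz : z ∈ Un n) {f : Hn n → ℂ} (hf : Continuous f) {C : ℝ} (hC : ∀ v, ‖f v‖ ≤ C)
    (p q : ℕ) (hpq : n + 2 ≤ p + q) : Integrable (fun v => f v * XY z p q v) := by
  have hC0 : 0 ≤ C := (norm_nonneg _).trans (hC 0)
  obtain ⟨m, hm⟩ : ∃ m, p + q = m + 1 := ⟨p+q-1, by omega⟩
  refine integrable_dom hz (hf.mul (continuous_XY hz p q)).aestronglyMeasurable (K := C * (√(AA z))⁻¹) (by positivity)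
    (m := m) (by omega) (fun v => ?_)
  rw [norm_mul, norm_XY, hm, mul_assoc]
  refine mul_le_mul (hC v) (pow_half (AA_pos hz) (sg_norm_ge hz v) _) (by positivity) hC0

lemma integrable_fwXY {n : ℕ} {z : Vn n} (hz : z ∈ Un n) {f : Hn n → ℂ} (hf : Continuous f) {C : ℝ} (hC : ∀ v, ‖f v‖ ≤ C)
    (j : Fin n) (p q : ℕ) (hpq : n + 2 ≤ p + q) : Integrable (fun v => f v * (ww z j v * XY z p q v)) := by
  have hC0 : 0 ≤ C := (norm_nonneg _).trans (hC 0)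
  obtain ⟨m, hm⟩ : ∃ m, p + q = m + 1 := ⟨p+q-1, by omega⟩
  refine integrable_dom hz (hf.mul ((continuous_ww z j).mul (continuous_XY hz p q))).aestronglyMeasurable (K := C) hC0
    (m := m) (by omega) (fun v => ?_)
  rw [norm_mul, norm_mul, norm_XY, hm]
  have := hC v
  have := ww_le hz j v
  gcongr

lemma zero_I0 {n : ℕ} (hn : 1 ≤ n) {z : Vn n} (hz : z ∈ Un n) {f : Hn n → ℂ} (hf : ContDiff ℝ 2 f) {C : ℝ} (hC : ∀ v, ‖f v‖ ≤ C)
    (hL : ∀ w, LH n (n:ℝ) f w = 0) :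
    ∫ v, f v * (XY z (n+1) (n+1) v - 2 * AA z * XY z (n+2) (n+1) v) = 0 := by
  have h := int_zero hz hf hC hL 1 0 ⟨0, hn⟩ (n+1) n (by omega)
  have e : ∀ v, f v * GG z 1 0 ⟨0, hn⟩ (n+1) n v = (-2 * n * (n+1) : ℂ) * (f v * (XY z (n+1) (n+1) v - 2 * AA z * XY z (n+2) (n+1) v)) := by
    intro v
    have hne := sg_ne hz v
    have hne' : (starRingEnd ℂ) (sg z v) ≠ 0 := by simpa using hne
    simp only [GG, mu, XY]
    generalize (starRingEnd ℂ) (sg z v) = y at *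
    generalize sg z v = x at *
    push_cast
    have hx := mul_inv_cancel₀ hne
    have hy := mul_inv_cancel₀ hne'
    linear_combination (-2*n*(n+1)*f v*x⁻¹^(n+1)*y⁻¹^(n+1))*hx + (-2*n*(n+1)*f v*x⁻¹^(n+2)*y⁻¹^n)*hy
  simp_rw [e] at h
  rw [integral_const_mul] at h
  refine (mul_eq_zero.1 h).resolve_left ?_
  have : (n:ℂ) ≠ 0 := by exact_mod_cast (by omega : n ≠ 0)
  have : (n:ℂ) + 1 ≠ 0 := by exact_mod_cast (by omega : n + 1 ≠ 0)
  simp [*]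

lemma zero_J {n : ℕ} {z : Vn n} (hz : z ∈ Un n) {f : Hn n → ℂ} (hf : ContDiff ℝ 2 f) {C : ℝ} (hC : ∀ v, ‖f v‖ ≤ C)
    (hL : ∀ w, LH n (n:ℝ) f w = 0) (j : Fin n) (k : ℕ) :
    ∫ v, f v * (ww z j v * XY z (k+2) (n+1) v) = 0 := by
  have hn : 1 ≤ n := by have := j.2; omega
  have hn0 : (n:ℂ) ≠ 0 := by exact_mod_cast (by omega : n ≠ 0)
  have hA : (AA z : ℂ) ≠ 0 := by exact_mod_cast (AA_pos hz).ne'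
  have e : ∀ k v, f v * GG z 0 1 j (k+1) n v = (-2 * n * k : ℂ) * (f v * (ww z j v * XY z (k+1) (n+1) v)) +
       (4 * n * AA z * (k+1) : ℂ) * (f v * (ww z j v * XY z (k+2) (n+1) v)) := by
    intro k v
    have hne := sg_ne hz v
    have hne' : (starRingEnd ℂ) (sg z v) ≠ 0 := by simpa using hne
    simp only [GG, mu, XY]
    generalize (starRingEnd ℂ) (sg z v) = y at *
    generalize sg z v = x at *
    push_cast
    have hx := mul_inv_cancel₀ hne
    have hy := mul_inv_cancel₀ hne'
    linear_combination (-2*n*(k+1)*f v*ww z j v*x⁻¹^(k+1)*y⁻¹^(n+1))*hx + (-2*n*(k+1)*f v*ww z j v*x⁻¹^(k+2)*y⁻¹^n)*hy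
  induction k with
  | zero =>
    have h := int_zero hz hf hC hL 0 1 j 1 n (by omega)
    have e0 := e 0
    simp only [Nat.cast_zero, mul_zero, zero_mul, zero_add, mul_one] at e0
    simp_rw [e0] at h
    rw [integral_const_mul] at h
    exact (mul_eq_zero.1 h).resolve_left (by simp [hn0, hA])
  | succ k ih =>
    have h := int_zero hz hf hC hL 0 1 j (k+1+1) n (by omega)
    simp_rw [e (k+1)] at h
    have i1 := (integrable_fwXY hz hf.continuous hC j (k+1+1) (n+1) (by omega)).const_mul (-2 * n * ((k+1 : ℕ) : ℂ))
    have i2 := (integrable_fwXY hz hf.continuous hC j (k+1+2) (n+1) (by omega)).const_mul (4 * n * AA z * (((k+1 : ℕ) : ℂ)+1))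
    rw [integral_add i1 i2, integral_const_mul, integral_const_mul, ih, mul_zero, zero_add] at h
    refine (mul_eq_zero.1 h).resolve_left ?_
    have : ((k+1 : ℕ) : ℂ) + 1 ≠ 0 := by exact_mod_cast (by omega : k+1+1 ≠ 0)
    simp only [ne_eq, mul_eq_zero, not_or]
    exact ⟨⟨⟨by norm_num, hn0⟩, hA⟩, this⟩

/-- the Poisson kernel -/
def PP {n : ℕ} (z : Vn n) (v : Hn n) : ℂ := (AA z : ℂ)^(n+1) * XY z (n+1) (n+1) v

def qk (n : ℕ) (k : Fin n) : Vn n →L[ℝ] ℂ :=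
  (ContinuousLinearMap.proj (R := ℝ) (φ := fun _ : Fin n => ℂ) k) ∘L ContinuousLinearMap.fst ℝ (Fin n → ℂ) ℂ
def sndc (n : ℕ) : Vn n →L[ℝ] ℂ := ContinuousLinearMap.snd ℝ (Fin n → ℂ) ℂ

def dAc {n : ℕ} (z : Vn n) : Vn n →L[ℝ] ℂ :=
  (Complex.ofRealCLM ∘L Complex.imCLM ∘L sndc n) - ∑ k, (z.1 k • (cj ∘L qk n k) + (starRingEnd ℂ) (z.1 k) • qk n k)
def dsz {n : ℕ} (v : Hn n) : Vn n →L[ℝ] ℂ :=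
  (Complex.I • (cj ∘L sndc n)) - ∑ k, (2 * v.1 k) • (cj ∘L qk n k)

lemma has_dAc {n : ℕ} (z : Vn n) : HasFDerivAt (fun z : Vn n => (AA z : ℂ)) (dAc z) z := by
  have e : (fun z : Vn n => (AA z : ℂ)) = fun z => (z.2.im : ℂ) - ∑ k, z.1 k * (starRingEnd ℂ) (z.1 k) := by
    ext z
    simp only [AA, Complex.mul_conj, Complex.normSq_eq_norm_sq]
    push_cast; rfl
  rw [e, dAc]
  refine HasFDerivAt.sub ((Complex.ofRealCLM ∘L Complex.imCLM ∘L sndc n).hasFDerivAt) ?_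
  refine HasFDerivAt.fun_sum (fun k _ => ?_)
  exact ((qk n k).hasFDerivAt (x := z)).mul ((cj ∘L qk n k).hasFDerivAt (x := z))

lemma has_dsz {n : ℕ} (z : Vn n) (v : Hn n) : HasFDerivAt (fun z : Vn n => sg z v) (dsz v) z := by
  have e : (fun z : Vn n => sg z v) = fun z => (dsz v z) + (∑ k, v.1 k * (starRingEnd ℂ) (v.1 k) - Complex.I * (v.2 : ℂ)) := by
    ext z
    simp only [sg, dsz, sub_apply, smul_apply, sum_apply, ContinuousLinearMap.comp_apply, cj_apply, smul_eq_mul,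
      Finset.sum_sub_distrib]
    have : ∀ k, qk n k z = z.1 k := fun k => rfl
    simp_rw [this]
    have : sndc n z = z.2 := rfl
    rw [this]
    have : ∀ k, 2 * (starRingEnd ℂ) (z.1 k) * v.1 k = 2 * v.1 k * (starRingEnd ℂ) (z.1 k) := fun k => by ring
    simp_rw [this]
    ring
  rw [e]
  exact (dsz v).hasFDerivAt.add_const _

def dPP {n : ℕ} (z : Vn n) (v : Hn n) : Vn n →L[ℝ] ℂ :=
  ((n+1) * (AA z : ℂ)^n * XY z (n+1) (n+1) v) • dAc z
   + (-(n+1) * (AA z : ℂ)^(n+1) * XY z (n+2) (n+1) v) • dsz v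
   + (-(n+1) * (AA z : ℂ)^(n+1) * XY z (n+1) (n+2) v) • (cj ∘L dsz v)

lemma has_PP {n : ℕ} {z : Vn n} (hz : z ∈ Un n) (v : Hn n) : HasFDerivAt (fun z => PP z v) (dPP z v) z := by
  have hs := has_dsz z v
  have hne := sg_ne hz v
  have hne' : (starRingEnd ℂ) (sg z v) ≠ 0 := by simpa using hne
  have hcs : HasFDerivAt (fun z => (starRingEnd ℂ) (sg z v)) (cj ∘L dsz v) z := cj.hasFDerivAt.comp z hs
  have h1 := ((has_invpow (n+1) hne).complexToReal_fderiv).comp z hs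
  have h2 := ((has_invpow (n+1) hne').complexToReal_fderiv).comp z hcs
  have h0 := (((hasDerivAt_pow (n+1) (AA z : ℂ))).complexToReal_fderiv).comp z (has_dAc z)
  have h5 := h0.mul (h1.mul h2)
  refine HasFDerivAt.congr_fderiv h5 ?_
  refine ContinuousLinearMap.ext fun u => ?_
  simp only [dPP, XY, add_apply, smul_apply, ContinuousLinearMap.comp_apply, cj_apply,
    smul_eq_mul, Pi.mul_apply, Function.comp, ContinuousLinearMap.one_apply]
  push_cast
  ring

lemma dbar_PP {n : ℕ} (z : Vn n) (v : Hn n) (u : Vn n) :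
    dPP z v (Complex.I • u) - Complex.I * dPP z v u = 
     -2 * Complex.I * ((n+1) * (AA z : ℂ)^n) * 
      ((Complex.I / 2 * (starRingEnd ℂ) u.2 - ∑ k, (starRingEnd ℂ) (u.1 k) * z.1 k) * 
         (XY z (n+1) (n+1) v - 2 * AA z * XY z (n+2) (n+1) v)
        + 2 * AA z * ∑ k, (starRingEnd ℂ) (u.1 k) * (ww z k v * XY z (n+2) (n+1) v)) := by
  have q1 : ∀ k u, qk n k u = u.1 k := fun k u => rfl
  have q2 : ∀ u, sndc n u = u.2 := fun u => rfl
  have a1 : dAc z (Complex.I • u) - Complex.I * dAc z u = -2 * Complex.I * 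
      (Complex.I / 2 * (starRingEnd ℂ) u.2 - ∑ k, (starRingEnd ℂ) (u.1 k) * z.1 k) := by
    simp only [dAc, sub_apply, sum_apply, add_apply, smul_apply, ContinuousLinearMap.comp_apply, q1, q2, cj_apply,
      smul_eq_mul, Prod.smul_fst, Prod.smul_snd, Pi.smul_apply, map_mul, Complex.conj_I, Complex.ofRealCLM_apply, Complex.imCLM_apply]
    have e1 : (((Complex.I * u.2).im : ℝ) : ℂ) - Complex.I * ((u.2.im : ℝ):ℂ) = (starRingEnd ℂ) u.2 := by
      apply Complex.ext <;> simp
    have e2 : ∑ x, (z.1 x * (-Complex.I * (starRingEnd ℂ) (u.1 x)) + (starRingEnd ℂ) (z.1 x) * (Complex.I * u.1 x)) =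
      Complex.I * ∑ x, (z.1 x * (starRingEnd ℂ) (u.1 x) + (starRingEnd ℂ) (z.1 x) * u.1 x) - 2 * Complex.I * ∑ k, (starRingEnd ℂ) (u.1 k) * z.1 k := by
      rw [Finset.mul_sum, Finset.mul_sum, ← Finset.sum_sub_distrib]
      exact Finset.sum_congr rfl fun k _ => by ring
    rw [e2]
    linear_combination e1 + (starRingEnd ℂ) u.2 * Complex.I_sq
  have a2 : dsz v (Complex.I • u) = - Complex.I * dsz v u := by
    simp only [dsz, sub_apply, sum_apply, add_apply, smul_apply, ContinuousLinearMap.comp_apply, q1, q2, cj_apply,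
      smul_eq_mul, Prod.smul_fst, Prod.smul_snd, Pi.smul_apply, map_mul, Complex.conj_I, mul_sub, Finset.mul_sum]
    congr 1
    · ring
    · exact Finset.sum_congr rfl fun k _ => by ring
  have a3 : dsz v u = 2 * (Complex.I / 2 * (starRingEnd ℂ) u.2 - ∑ k, (starRingEnd ℂ) (u.1 k) * z.1 k) -
       2 * ∑ k, (starRingEnd ℂ) (u.1 k) * ww z k v := by
    simp only [dsz, sub_apply, sum_apply, add_apply, smul_apply, ContinuousLinearMap.comp_apply, q1, q2, cj_apply,
      smul_eq_mul, ww, mul_sub, Finset.sum_sub_distrib, Finset.mul_sum]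
    have : ∀ k, 2 * v.1 k * (starRingEnd ℂ) (u.1 k) = 2 * ((starRingEnd ℂ) (u.1 k) * v.1 k) := fun k => by ring
    simp_rw [this]
    ring
  have a4 : ∑ k, (starRingEnd ℂ) (u.1 k) * (ww z k v * XY z (n+2) (n+1) v) = 
      (∑ k, (starRingEnd ℂ) (u.1 k) * ww z k v) * XY z (n+2) (n+1) v := by
    rw [Finset.sum_mul]; exact Finset.sum_congr rfl fun k _ => by ring
  simp only [dPP, add_apply, smul_apply, ContinuousLinearMap.comp_apply, cj_apply, smul_eq_mul]
  rw [a2, a4, map_mul, map_neg, Complex.conj_I]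
  generalize (∑ k, (starRingEnd ℂ) (u.1 k) * ww z k v) = W at *
  generalize (Complex.I / 2 * (starRingEnd ℂ) u.2 - ∑ k, (starRingEnd ℂ) (u.1 k) * z.1 k) = Q at *
  generalize (starRingEnd ℂ) (dsz v u) = cd
  linear_combination ((n+1) * (AA z : ℂ)^n * XY z (n+1) (n+1) v) * a1 + 
    2 * Complex.I * (n+1) * (AA z : ℂ)^(n+1) * XY z (n+2) (n+1) v * a3
end

section

lemma dsz_apply {n : ℕ} (v : Hn n) (u : Vn n) :
    dsz v u = Complex.I * (starRingEnd ℂ) u.2 - ∑ k, 2 * v.1 k * (starRingEnd ℂ) (u.1 k) := by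
  simp only [dsz, sub_apply, smul_apply, sum_apply, ContinuousLinearMap.comp_apply, cj_apply, smul_eq_mul]
  rfl

lemma sg_sub {n : ℕ} (z z0 : Vn n) (v : Hn n) : sg z v - sg z0 v = dsz v (z - z0) := by
  have : ∀ z : Vn n, sg z v = dsz v z + (∑ k, v.1 k * (starRingEnd ℂ) (v.1 k) - Complex.I * (v.2 : ℂ)) := by
    intro z
    rw [dsz_apply]
    simp only [sg, Finset.sum_sub_distrib]
    have : ∀ k, 2 * (starRingEnd ℂ) (z.1 k) * v.1 k = 2 * v.1 k * (starRingEnd ℂ) (z.1 k) := fun k => by ring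
    simp_rw [this]
    ring
  rw [map_sub, this z, this z0]; ring

lemma norm_dsz {n : ℕ} {z0 : Vn n} (hz : z0 ∈ Un n) : ∃ K, 0 < K ∧ ∀ v, ‖dsz v‖ ≤ K * ‖sg z0 v‖ := by
  have hA := AA_pos hz
  refine ⟨(1 + 2 * n * (1 + ‖z0‖)) / AA z0 + 2 * n, by positivity, fun v => ?_⟩
  have hs := sg_norm_ge hz v
  have hs0 := hA.trans_le hs
  refine ContinuousLinearMap.opNorm_le_bound _ (by positivity) (fun u => ?_)
  have hv : ∀ k, ‖v.1 k‖ ≤ 1 + ‖z0‖ + ‖sg z0 v‖ := by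
    intro k
    have h1 : ‖v.1 k‖ ≤ ‖ww z0 k v‖ + ‖z0.1 k‖ := by
      have : v.1 k = ww z0 k v + z0.1 k := by simp [ww]
      rw [this]; exact norm_add_le _ _
    have h2 := ww_le hz k v
    have h3 : ‖z0.1 k‖ ≤ ‖z0‖ := (norm_le_pi_norm z0.1 k).trans (norm_fst_le z0)
    have h4 : √‖sg z0 v‖ ≤ 1 + ‖sg z0 v‖ := by
      rw [Real.sqrt_le_left (by positivity)]; nlinarith
    linarith
  rw [dsz_apply]
  have hb : (1 + 2 * n * (1 + ‖z0‖)) ≤ (1 + 2 * n * (1 + ‖z0‖)) / AA z0 * ‖sg z0 v‖ := by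
    calc (1 + 2 * n * (1 + ‖z0‖)) = (1 + 2 * n * (1 + ‖z0‖)) / AA z0 * AA z0 := by field_simp
      _ ≤ _ := by gcongr
  calc _ ≤ ‖Complex.I * (starRingEnd ℂ) u.2‖ + ‖∑ k, 2 * v.1 k * (starRingEnd ℂ) (u.1 k)‖ := norm_sub_le _ _
    _ ≤ ‖u‖ + ∑ k : Fin n, 2 * (1 + ‖z0‖ + ‖sg z0 v‖) * ‖u‖ := by
      gcongr ?_ + ?_
      · rw [norm_mul, Complex.norm_I, one_mul, RCLike.norm_conj]; exact norm_snd_le u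
      · refine (norm_sum_le _ _).trans (Finset.sum_le_sum fun k _ => ?_)
        rw [norm_mul, norm_mul, RCLike.norm_conj, Complex.norm_ofNat]
        have h3 : ‖u.1 k‖ ≤ ‖u‖ := (norm_le_pi_norm u.1 k).trans (norm_fst_le u)
        have := hv k
        gcongr
    _ = (1 + 2 * n * (1 + ‖z0‖) + 2 * n * ‖sg z0 v‖) * ‖u‖ := by
      simp; ring
    _ ≤ _ := by
      gcongr
      linarith

lemma near_sg {n : ℕ} {z0 : Vn n} (hz : z0 ∈ Un n) :
    ∀ᶠ z in 𝓝 z0, ∀ v, ‖sg z v‖⁻¹ ≤ 2 * ‖sg z0 v‖⁻¹ := by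
  obtain ⟨K, hK, hKv⟩ := norm_dsz hz
  filter_upwards [Metric.ball_mem_nhds z0 (ε := 1/(2*K)) (by positivity)] with z hz' v
  rw [Metric.mem_ball, dist_eq_norm] at hz'
  have hs0 := (AA_pos hz).trans_le (sg_norm_ge hz v)
  have h1 : ‖sg z v - sg z0 v‖ ≤ ‖sg z0 v‖ / 2 := by
    rw [sg_sub]
    calc _ ≤ ‖dsz v‖ * ‖z - z0‖ := (dsz v).le_opNorm _
      _ ≤ (K * ‖sg z0 v‖) * (1/(2*K)) := by have := hKv v; gcongr
      _ = _ := by field_simp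
  have h2 : ‖sg z0 v‖ / 2 ≤ ‖sg z v‖ := by
    have := norm_sub_norm_le (sg z0 v) (sg z v)
    rw [norm_sub_rev] at this
    linarith
  calc ‖sg z v‖⁻¹ ≤ (‖sg z0 v‖ / 2)⁻¹ := by gcongr
    _ = _ := by rw [inv_div]; ring

lemma continuous_AA {n : ℕ} : Continuous (AA : Vn n → ℝ) := by unfold AA; fun_prop
lemma continuous_dAc {n : ℕ} : Continuous (dAc : Vn n → Vn n →L[ℝ] ℂ) := by
  unfold dAc
  refine continuous_const.sub (continuous_finsetSum _ fun k _ => ?_)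
  have h : Continuous (fun z : Vn n => z.1 k) := by fun_prop
  exact (h.smul continuous_const).add ((Complex.continuous_conj.comp h).smul continuous_const)
lemma continuous_dsz {n : ℕ} : Continuous (dsz : Hn n → Vn n →L[ℝ] ℂ) := by
  unfold dsz
  refine continuous_const.sub (continuous_finsetSum _ fun k _ => ?_)
  have h : Continuous (fun z : Hn n => 2 * z.1 k) := by fun_prop
  exact h.smul continuous_const
lemma continuous_dPP {n : ℕ} {z : Vn n} (hz : z ∈ Un n) : Continuous (dPP z) := by
  unfold dPP
  have h := fun p q => continuous_XY hz p q
  refine ((Continuous.smul (continuous_const.mul (h _ _)) continuous_const).add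
    (Continuous.smul (continuous_const.mul (h _ _)) continuous_dsz)).add
    (Continuous.smul (continuous_const.mul (h _ _)) (continuous_const.clm_comp continuous_dsz))

lemma near_dPP {n : ℕ} {z0 : Vn n} (hz : z0 ∈ Un n) :
    ∃ M, 0 ≤ M ∧ ∀ᶠ z in 𝓝 z0, ∀ v, ‖dPP z v‖ ≤ M * (‖sg z0 v‖⁻¹)^(2*n+2) := by
  obtain ⟨K, hK, hKv⟩ := norm_dsz hz
  have hA := AA_pos hz
  set B := AA z0 + 1
  set D := ‖dAc z0‖ + 1
  have hB : 0 < B := by positivity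
  have hD : 0 < D := by positivity
  refine ⟨(n+1) * B^n * 2^(2*n+2) * D + 2 * ((n+1) * B^(n+1) * 2^(2*n+3) * K), by positivity, ?_⟩
  have e1 : ∀ᶠ z in 𝓝 z0, AA z < B := continuous_AA.continuousAt.eventually_lt continuousAt_const (by simp [B])
  have e2 : ∀ᶠ z in 𝓝 z0, ‖dAc z‖ < D := continuous_dAc.norm.continuousAt.eventually_lt continuousAt_const (by simp [D])
  filter_upwards [near_sg hz, e1, e2, (isOpen_Un n).mem_nhds hz] with z h1 h2 h3 h4 v
  have hs0 := hA.trans_le (sg_norm_ge hz v)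
  have hs := (AA_pos h4).trans_le (sg_norm_ge h4 v)
  have hAz := AA_pos h4
  have hx : ∀ p q, ‖XY z p q v‖ ≤ 2^(p+q) * (‖sg z0 v‖⁻¹)^(p+q) := by
    intro p q
    rw [norm_XY, ← mul_pow]
    have := h1 v
    gcongr
  have hnn : ‖((n:ℂ)+1)‖ = (n:ℝ)+1 := by
    have : ((n:ℂ)+1) = ((n+1 : ℕ) : ℂ) := by push_cast; rfl
    rw [this, Complex.norm_natCast]; push_cast; rfl
  have hAn : ‖(AA z : ℂ)‖ = AA z := by rw [Complex.norm_real, Real.norm_of_nonneg hAz.le]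
  have hcj : ‖cj ∘L dsz v‖ ≤ K * ‖sg z0 v‖ := by
    refine le_trans ?_ (hKv v)
    refine ContinuousLinearMap.opNorm_le_bound _ (by positivity) fun u => ?_
    rw [ContinuousLinearMap.comp_apply, cj_apply, RCLike.norm_conj]
    exact (dsz v).le_opNorm u
  have hcancel : (‖sg z0 v‖⁻¹)^(2*n+3) * ‖sg z0 v‖ = (‖sg z0 v‖⁻¹)^(2*n+2) := by
    rw [pow_succ _ (2*n+2), mul_assoc, inv_mul_cancel₀ hs0.ne', mul_one]
  have n1 : ‖((n+1) * (AA z : ℂ)^n * XY z (n+1) (n+1) v) • dAc z‖ ≤ (n+1) * B^n * 2^(2*n+2) * D * (‖sg z0 v‖⁻¹)^(2*n+2) := by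
    rw [norm_smul, norm_mul, norm_mul, norm_pow, hnn, hAn]
    have h := hx (n+1) (n+1)
    rw [show n+1+(n+1) = 2*n+2 by ring] at h
    calc _ ≤ (n+1) * B^n * (2^(2*n+2) * (‖sg z0 v‖⁻¹)^(2*n+2)) * D := by gcongr
      _ = _ := by ring
  have n2 : ‖(-(n+1) * (AA z : ℂ)^(n+1) * XY z (n+2) (n+1) v) • dsz v‖ ≤ ((n+1) * B^(n+1) * 2^(2*n+3) * K) * (‖sg z0 v‖⁻¹)^(2*n+2) := by
    rw [norm_smul, norm_mul, norm_mul, norm_pow, norm_neg, hnn, hAn]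
    have h := hx (n+2) (n+1)
    rw [show n+2+(n+1) = 2*n+3 by ring] at h
    calc _ ≤ (n+1) * B^(n+1) * (2^(2*n+3) * (‖sg z0 v‖⁻¹)^(2*n+3)) * (K * ‖sg z0 v‖) := by
          have := hKv v
          gcongr
      _ = _ := by rw [← hcancel]; ring
  have n3 : ‖(-(n+1) * (AA z : ℂ)^(n+1) * XY z (n+1) (n+2) v) • (cj ∘L dsz v)‖ ≤ ((n+1) * B^(n+1) * 2^(2*n+3) * K) * (‖sg z0 v‖⁻¹)^(2*n+2) := by
    rw [norm_smul, norm_mul, norm_mul, norm_pow, norm_neg, hnn, hAn]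
    have h := hx (n+1) (n+2)
    rw [show n+1+(n+2) = 2*n+3 by ring] at h
    calc _ ≤ (n+1) * B^(n+1) * (2^(2*n+3) * (‖sg z0 v‖⁻¹)^(2*n+3)) * (K * ‖sg z0 v‖) := by
          gcongr
      _ = _ := by rw [← hcancel]; ring
  calc _ ≤ _ := norm_add₃_le
    _ ≤ _ := by linarith

lemma integrable_XYn {n : ℕ} {z : Vn n} (hz : z ∈ Un n) {m : ℕ} (hm : n + 2 ≤ m) : Integrable (fun v => (‖sg z v‖⁻¹)^m) := by
  have := (integrable_fXY hz (f := fun _ => 1) continuous_const (C := 1) (by simp) m 0 (by omega)).norm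
  simpa [norm_XY] using this

/-- Poisson integral -/
def hP {n : ℕ} (f : Hn n → ℂ) (z : Vn n) : ℂ := ∫ v, f v * PP z v

lemma continuous_PP {n : ℕ} {z : Vn n} (hz : z ∈ Un n) : Continuous (PP z) := continuous_const.mul (continuous_XY hz _ _)

lemma integrable_fPP {n : ℕ} {z : Vn n} (hz : z ∈ Un n) {f : Hn n → ℂ} (hf : Continuous f) {C : ℝ} (hC : ∀ v, ‖f v‖ ≤ C) :
    Integrable (fun v => f v * PP z v) := by
  have := (integrable_fXY hz hf hC (n+1) (n+1) (by omega)).const_mul ((AA z : ℂ)^(n+1))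
  refine this.congr (Eventually.of_forall fun v => ?_)
  simp only [PP]; ring

lemma has_hP {n : ℕ} {z : Vn n} (hz : z ∈ Un n) {f : Hn n → ℂ} (hf : Continuous f) {C : ℝ} (hC : ∀ v, ‖f v‖ ≤ C) :
    Integrable (fun v => f v • dPP z v) ∧ HasFDerivAt (hP f) (∫ v, f v • dPP z v) z := by
  have hC0 : 0 ≤ C := (norm_nonneg _).trans (hC 0)
  obtain ⟨M, hM, hev⟩ := near_dPP hz
  have bi : Integrable (fun v => C * (M * (‖sg z v‖⁻¹)^(2*n+2))) := ((integrable_XYn hz (by omega)).const_mul M).const_mul C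
  have bd : ∀ z', (∀ v, ‖dPP z' v‖ ≤ M * (‖sg z v‖⁻¹)^(2*n+2)) → ∀ v, ‖f v • dPP z' v‖ ≤ C * (M * (‖sg z v‖⁻¹)^(2*n+2)) := by
    intro z' h v
    rw [norm_smul]
    exact mul_le_mul (hC v) (h v) (norm_nonneg _) hC0
  have me : AEStronglyMeasurable (fun v => f v • dPP z v) := (hf.smul (continuous_dPP hz)).aestronglyMeasurable
  refine ⟨bi.mono' me (Eventually.of_forall (bd z hev.self_of_nhds)), ?_⟩
  refine hasFDerivAt_integral_of_dominated_of_fderiv_le (F := fun z v => f v * PP z v) (F' := fun z v => f v • dPP z v)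
    (hev.and ((isOpen_Un n).mem_nhds hz)) ?_ (integrable_fPP hz hf hC) me 
    (Eventually.of_forall fun v z' hz' => bd z' hz'.1 v) bi (Eventually.of_forall fun v z' hz' => ?_)
  · filter_upwards [(isOpen_Un n).mem_nhds hz] with z' hz'
    exact (hf.mul (continuous_PP hz')).aestronglyMeasurable
  · exact (has_PP hz'.2 v).const_mul (f v)

lemma diff_hP {n : ℕ} (hn : 1 ≤ n) {f : Hn n → ℂ} (hf : ContDiff ℝ 2 f) {C : ℝ} (hC : ∀ v, ‖f v‖ ≤ C)
    (hL : ∀ w, LH n (n:ℝ) f w = 0) : DifferentiableOn ℂ (hP f) (Un n) := by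
  intro z hz
  obtain ⟨hi, hd⟩ := has_hP hz hf.continuous hC
  set L := ∫ v, f v • dPP z v with hLdef
  have hap : ∀ u, L u = ∫ v, f v * dPP z v u := by
    intro u
    rw [hLdef, ContinuousLinearMap.integral_apply hi]
    rfl
  have hap_i : ∀ u, Integrable (fun v => f v * dPP z v u) := fun u => hi.apply_continuousLinearMap u
  have hI : ∀ u, L (Complex.I • u) = Complex.I * L u := by
    intro u
    rw [← sub_eq_zero, hap, hap, ← integral_const_mul, ← integral_sub (hap_i _) ((hap_i u).const_mul _)]
    set Q := (Complex.I / 2 * (starRingEnd ℂ) u.2 - ∑ k, (starRingEnd ℂ) (u.1 k) * z.1 k) with hQ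
    set N := -2 * Complex.I * ((n+1) * (AA z : ℂ)^n) with hN
    have e : ∀ v, f v * dPP z v (Complex.I • u) - Complex.I * (f v * dPP z v u) = 
       N * Q * (f v * (XY z (n+1) (n+1) v - 2 * AA z * XY z (n+2) (n+1) v)) +
        ∑ k, (N * (2 * AA z) * (starRingEnd ℂ) (u.1 k)) * (f v * (ww z k v * XY z (n+2) (n+1) v)) := by
      intro v
      have h := dbar_PP z v u
      rw [← hQ, ← hN] at h
      have : ∑ k, (N * (2 * AA z) * (starRingEnd ℂ) (u.1 k)) * (f v * (ww z k v * XY z (n+2) (n+1) v)) = 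
         N * (2 * AA z) * f v * ∑ k, (starRingEnd ℂ) (u.1 k) * (ww z k v * XY z (n+2) (n+1) v) := by
        rw [Finset.mul_sum]; exact Finset.sum_congr rfl fun k _ => by ring
      rw [this]
      linear_combination f v * h
    simp_rw [e]
    have i1 : Integrable (fun v => N * Q * (f v * (XY z (n+1) (n+1) v - 2 * AA z * XY z (n+2) (n+1) v))) := by
      have a1 := integrable_fXY hz hf.continuous hC (n+1) (n+1) (by omega)
      have a2 := (integrable_fXY hz hf.continuous hC (n+2) (n+1) (by omega)).const_mul (2 * AA z : ℂ)
      refine ((a1.sub a2).const_mul (N*Q)).congr (Eventually.of_forall fun v => ?_)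
      simp only [Pi.sub_apply]; ring
    have i2 : ∀ k, Integrable (fun v => (N * (2 * AA z) * (starRingEnd ℂ) (u.1 k)) * (f v * (ww z k v * XY z (n+2) (n+1) v))) :=
      fun k => (integrable_fwXY hz hf.continuous hC k (n+2) (n+1) (by omega)).const_mul _
    rw [integral_add i1 (integrable_finsetSum _ fun k _ => i2 k), integral_finsetSum _ (fun k _ => i2 k), integral_const_mul,
      zero_I0 hn hz hf hC hL, mul_zero, zero_add]
    refine Finset.sum_eq_zero fun k _ => ?_
    rw [integral_const_mul, zero_J hz hf hC hL k n, mul_zero]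
  let Lc : Vn n →L[ℂ] ℂ :=
    { toFun := L
      map_add' := L.map_add
      map_smul' := by
        intro c u
        have : c • u = c.re • u + c.im • (Complex.I • u) := by
          rw [← smul_assoc, ← Complex.coe_smul c.re, ← add_smul]
          congr 1
          rw [Complex.real_smul, Complex.re_add_im]
        rw [this, map_add, map_smul, map_smul, hI]
        simp only [Complex.real_smul, RingHom.id_apply, smul_eq_mul]
        conv_rhs => rw [← Complex.re_add_im c]
        ring
      cont := L.cont }
  exact (hasFDerivAt_of_restrictScalars ℝ hd (f' := Lc) rfl).differentiableAt.differentiableWithinAt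
end

section

/-- dilations -/
def dil {n : ℕ} (r : ℝ) (u : Hn n) : Hn n := (r • u.1, (r^2) • u.2)

def dilHomeo {n : ℕ} (r : ℝ) (hr : r ≠ 0) : Hn n ≃ₜ Hn n :=
  (Homeomorph.smulOfNeZero r hr).prodCongr (Homeomorph.smulOfNeZero (r^2) (pow_ne_zero 2 hr))

lemma map_dil {n : ℕ} {r : ℝ} (hr : 0 < r) :
    Measure.map (dil r : Hn n → Hn n) volume = ENNReal.ofReal ((r^(2*n+2))⁻¹) • volume := by
  have hf : Module.finrank ℝ (Fin n → ℂ) = 2 * n := by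
    rw [Module.finrank_pi_fintype]; simp [mul_comm]
  have e : (dil r : Hn n → Hn n) = Prod.map (fun x => r • x) (fun x => (r^2) • x) := rfl
  rw [e, Measure.volume_eq_prod, ← Measure.map_prod_map _ _ (measurable_const_smul r) (measurable_const_smul (r^2)),
    Measure.map_addHaar_smul _ hr.ne', Measure.map_addHaar_smul _ (pow_ne_zero 2 hr.ne'), Measure.prod_smul_left,
    Measure.prod_smul_right, smul_smul, ← ENNReal.ofReal_mul (by positivity)]
  congr 2
  rw [hf, Module.finrank_self, abs_of_pos (by positivity), abs_of_pos (by positivity)]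
  field_simp
  ring

lemma integral_dil {n : ℕ} {r : ℝ} (hr : 0 < r) (g : Hn n → ℂ) :
    ∫ u, g (dil r u) = ((r^(2*n+2))⁻¹ : ℝ) • ∫ u, g u := by
  have h := (dilHomeo (n := n) r hr.ne').measurableEmbedding.integral_map (μ := volume) g
  have h' : ∫ u, g (dil r u) = ∫ u, g u ∂(Measure.map (dil r : Hn n → Hn n) volume) := h.symm
  rw [h', map_dil hr, integral_smul_measure, ENNReal.toReal_ofReal (by positivity)]

lemma s0_dil {n : ℕ} (r : ℝ) (u : Hn n) : s0 (r^2) (dil r u) = ((r^2 : ℝ) : ℂ) * s0 1 u := by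
  apply Complex.ext
  · rw [s0_re, Complex.re_ofReal_mul, s0_re]
    simp [dil, mul_pow, ← Finset.mul_sum, mul_add]
  · rw [s0_im, Complex.im_ofReal_mul, s0_im]
    simp [dil]

def k1 {n : ℕ} (u : Hn n) : ℝ := (‖s0 1 u‖⁻¹)^(2*n+2)

lemma AA_psi {n : ℕ} (w : Hn n) (a : ℝ) : AA (psi n (w, a)) = a := by
  simp [AA, psi, -Complex.ofReal_add, -Complex.ofReal_sum]
lemma wz_psi {n : ℕ} (w : Hn n) (a : ℝ) : wz (psi n (w, a)) = w := by
  simp [wz, psi, -Complex.ofReal_add, -Complex.ofReal_sum]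

lemma s0_one_ge {n : ℕ} (u : Hn n) : 1 ≤ ‖s0 1 u‖ := by
  have := norm_sq_le_s0 one_pos u
  nlinarith [sq_nonneg ‖u.1‖]

lemma hP_psi {n : ℕ} (f : Hn n → ℂ) (w : Hn n) {r : ℝ} (hr : 0 < r) :
    hP f (psi n (w, r^2)) = ∫ u, f (gm w (dil r u)) * k1 u := by
  rw [hP, ← integral_gm_left w]
  have e1 : ∀ u, PP (psi n (w, r^2)) (gm w u) = ((r^2 * ‖s0 (r^2) u‖⁻¹^2 : ℝ) : ℂ)^(n+1) := by
    intro u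
    have h := sg_gm (psi n (w, r^2)) u
    rw [wz_psi, AA_psi] at h
    rw [PP, AA_psi, XY, h, ← mul_pow, ← mul_pow]
    congr 1
    rw [← mul_inv, Complex.mul_conj, Complex.normSq_eq_norm_sq]
    push_cast
    ring
  simp_rw [e1]
  have h2 := integral_dil hr (fun u => f (gm w u) * ((r^2 * ‖s0 (r^2) u‖⁻¹^2 : ℝ) : ℂ)^(n+1))
  have h3 : ∫ u, f (gm w u) * ((r^2 * ‖s0 (r^2) u‖⁻¹^2 : ℝ) : ℂ)^(n+1) = 
    ((r^(2*n+2) : ℝ) : ℂ) * ∫ u, f (gm w (dil r u)) * ((r^2 * ‖s0 (r^2) (dil r u)‖⁻¹^2 : ℝ) : ℂ)^(n+1) := by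
    rw [h2, Complex.real_smul, ← mul_assoc, ← Complex.ofReal_mul, mul_inv_cancel₀ (by positivity)]
    simp
  rw [h3, ← integral_const_mul]
  congr 1
  ext u
  have hs := s0_one_ge u
  have hs' : ‖s0 1 u‖ ≠ 0 := by linarith
  rw [s0_dil, norm_mul, Complex.norm_real, Real.norm_of_nonneg (by positivity), mul_left_comm, ← Complex.ofReal_pow, ← Complex.ofReal_mul]
  congr 2
  rw [k1, show 2*n+2 = 2*(n+1) by ring, pow_mul, pow_mul, ← mul_pow]
  congr 1
  field_simp

lemma continuous_k1 {n : ℕ} : Continuous (k1 : Hn n → ℝ) :=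
  ((continuous_s0 1).norm.inv₀ (fun u => by have := s0_one_ge u; linarith)).pow _

lemma integrable_k1 {n : ℕ} : Integrable (k1 : Hn n → ℝ) := by
  refine (integrable_s0 (n := n) one_pos).mono' continuous_k1.aestronglyMeasurable (Eventually.of_forall fun u => ?_)
  have hs := s0_one_ge u
  have hs' : 0 < ‖s0 1 u‖ := by linarith
  rw [k1, Real.norm_of_nonneg (by positivity), ← Real.rpow_neg_one, ← Real.rpow_natCast, ← Real.rpow_mul hs'.le]
  refine Real.rpow_le_rpow_of_exponent_le hs ?_
  push_cast
  have := n.cast_nonneg (α := ℝ)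
  linarith

lemma k1_pos {n : ℕ} (u : Hn n) : 0 < k1 u := by
  have := s0_one_ge u
  unfold k1; positivity

def kap (n : ℕ) : ℝ := ∫ u : Hn n, k1 u

lemma kap_pos (n : ℕ) : 0 < kap n := by
  unfold kap
  rw [integral_pos_iff_support_of_nonneg (fun u => (k1_pos u).le) integrable_k1]
  have : Function.support (k1 : Hn n → ℝ) = univ := by
    ext u; simp [(k1_pos u).ne']
  rw [this]
  exact Measure.measure_univ_pos.2 (NeZero.ne _)

lemma gm_dil_tendsto {n : ℕ} (w u : Hn n) : Tendsto (fun r : ℝ => gm w (dil r u)) (𝓝 0) (𝓝 w) := by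
  have hc : Continuous (fun r : ℝ => gm w (dil r u)) :=
    (continuous_gm_left w).comp (by unfold dil; fun_prop)
  have := hc.tendsto 0
  have e : gm w (dil 0 u) = w := by simp [gm, dil]
  rwa [e] at this

/-- normalized Poisson extension -/
def hN {n : ℕ} (f : Hn n → ℂ) (z : Vn n) : ℂ := ((kap n : ℂ))⁻¹ * hP f z

lemma norm_hN {n : ℕ} {f : Hn n → ℂ} {C : ℝ} (hC : ∀ v, ‖f v‖ ≤ C) (w : Hn n) {a : ℝ} (ha : 0 < a) :
    ‖hN f (psi n (w, a))‖ ≤ C := by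
  have hk := kap_pos n
  have hr := Real.sqrt_pos.2 ha
  have e := hP_psi f w hr
  rw [Real.sq_sqrt ha.le] at e
  rw [hN, e, norm_mul, norm_inv, Complex.norm_real, Real.norm_of_nonneg hk.le, inv_mul_le_iff₀ hk]
  calc _ ≤ ∫ u, C * k1 (n := n) u := by
        refine norm_integral_le_of_norm_le (integrable_k1.const_mul C) (Eventually.of_forall fun u => ?_)
        rw [norm_mul, Complex.norm_real, Real.norm_of_nonneg (k1_pos u).le]
        have := k1_pos u
        have := hC (gm w (dil (√a) u))
        gcongr
    _ = _ := by rw [integral_const_mul, kap, mul_comm]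

lemma hN_tendsto {n : ℕ} {f : Hn n → ℂ} (hf : Continuous f) {C : ℝ} (hC : ∀ v, ‖f v‖ ≤ C) (w : Hn n) :
    Tendsto (fun a : ℝ => hN f (psi n (w, a))) (𝓝[>] 0) (𝓝 (f w)) := by
  have hk := kap_pos n
  have h1 : Tendsto (fun r : ℝ => ∫ u, f (gm w (dil r u)) * k1 u) (𝓝 0) (𝓝 (∫ u : Hn n, f w * k1 u)) := by
    refine tendsto_integral_filter_of_dominated_convergence (fun u => C * k1 u) (Eventually.of_forall fun r => ?_)
      (Eventually.of_forall fun r => Eventually.of_forall fun u => ?_) (integrable_k1.const_mul C)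
      (Eventually.of_forall fun u => ?_)
    · have : Continuous (fun u : Hn n => f (gm w (dil r u))) :=
        hf.comp ((continuous_gm_left w).comp (by unfold dil; fun_prop))
      exact (this.mul (Complex.continuous_ofReal.comp continuous_k1)).aestronglyMeasurable
    · rw [norm_mul, Complex.norm_real, Real.norm_of_nonneg (k1_pos u).le]
      have := k1_pos u
      have := hC (gm w (dil r u))
      gcongr
    · exact ((hf.tendsto w).comp (gm_dil_tendsto w u)).mul_const _
  have e : ∫ u : Hn n, f w * (k1 u : ℂ) = f w * kap n := by
    rw [integral_const_mul, kap, integral_complex_ofReal]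
  rw [e] at h1
  have hsq : Tendsto (fun a : ℝ => √a) (𝓝[>] 0) (𝓝 0) := by
    have := Real.continuous_sqrt.tendsto 0
    rw [Real.sqrt_zero] at this
    exact this.mono_left nhdsWithin_le_nhds
  have h2 := (h1.comp hsq).const_mul ((kap n : ℂ)⁻¹)
  have hk' : (kap n : ℂ) ≠ 0 := by exact_mod_cast hk.ne'
  have e2 : (kap n : ℂ)⁻¹ * (f w * kap n) = f w := by field_simp
  rw [e2] at h2
  refine h2.congr' ?_
  filter_upwards [self_mem_nhdsWithin] with a ha
  have ha : 0 < a := ha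
  have e := hP_psi f w (Real.sqrt_pos.2 ha)
  rw [Real.sq_sqrt ha.le] at e
  rw [hN, e]; rfl

theorem backward {n : ℕ} (hn : 1 ≤ n) {α : ℝ} (hα : 0 < α) {F : Sg n → ℂ}
    {C0 : ℝ} (hC0 : ∀ p : Sg n, 0 < p.2 → ‖F p‖ ≤ C0)
    (hF : ContDiffOn ℝ 2 F {p : Sg n | 0 < p.2}) (hFharm : ∀ p : Sg n, 0 < p.2 → Lalpha n α F p = 0)
    {f : Hn n → ℂ} (hf : ContDiff ℝ 2 f) {C : ℝ} (hC : ∀ v, ‖f v‖ ≤ C) (hbv : IsBoundaryValue n F f)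
    (hL : ∀ w, LH n (n:ℝ) f w = 0) : IsHolo n F := by
  have hd : DifferentiableOn ℂ (hN f) (Un n) := (diff_hP hn hf hC hL).const_mul _
  have hcd : ContDiffOn ℝ 2 (fun p => hN f (psi n p)) {p : Sg n | 0 < p.2} := holo_contDiff hd 2
  have hu : ContDiffOn ℝ 2 (fun p => F p + (-1) * hN f (psi n p)) {p : Sg n | 0 < p.2} :=
    hF.add (contDiffOn_const.mul hcd)
  have hz : ∀ p : Sg n, 0 < p.2 → F p + (-1) * hN f (psi n p) = 0 := by
    intro p hp
    refine uniqueness hn hu hα (C := C0 + C) ?_ ?_ ?_ hp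
    · intro p hp
      rw [Lalpha_lin (-1) α hF hcd hp, hFharm p hp, holo_Lalpha hd hp]; simp
    · intro p hp
      refine (norm_add_le _ _).trans (add_le_add (hC0 p hp) ?_)
      rw [norm_mul, norm_neg, norm_one, one_mul]
      exact norm_hN hC p.1 hp
    · intro φ hφ
      have t1 := hbv φ hφ
      have t2 : Tendsto (fun a : ℝ => ∫ w : Hn n, hN f (psi n (w, a)) * φ w) (𝓝[>] (0:ℝ)) (𝓝 (∫ w, f w * φ w)) := by
        refine tendsto_integral_filter_of_dominated_convergence (fun w => C * ‖φ w‖) ?_ ?_ (hφ.norm.const_mul C)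
          (Eventually.of_forall fun w => (hN_tendsto hf.continuous hC w).mul_const _)
        · filter_upwards [self_mem_nhdsWithin] with a ha
          exact (cont_slice hcd.continuousOn ha).aestronglyMeasurable.mul hφ.aestronglyMeasurable
        · filter_upwards [self_mem_nhdsWithin] with a ha
          refine Eventually.of_forall fun w => ?_
          rw [norm_mul]
          have := norm_hN hC w ha
          gcongr
      have t3 := t1.sub t2
      simp only [zero_mul, integral_zero]
      rw [sub_self] at t3
      refine t3.congr' ?_
      filter_upwards [self_mem_nhdsWithin] with a ha
      have ha : 0 < a := ha
      have i1 : Integrable (fun w => F (w, a) * φ w) :=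
        hφ.bdd_mul (c := C0) (cont_slice hF.continuousOn ha).aestronglyMeasurable (Eventually.of_forall fun w => hC0 (w, a) ha)
      have i2 : Integrable (fun w => hN f (psi n (w, a)) * φ w) :=
        hφ.bdd_mul (c := C) (cont_slice hcd.continuousOn ha).aestronglyMeasurable (Eventually.of_forall fun w => norm_hN hC w ha)
      rw [← integral_sub i1 i2]
      congr 1
      ext w; ring
  refine hd.congr fun z hz' => ?_
  have hpos : 0 < z.2.im - ∑ j, ‖z.1 j‖^2 := sub_pos.2 hz'
  have e : psi n ((z.1, z.2.re), z.2.im - ∑ j, ‖z.1 j‖^2) = z := by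
    refine Prod.ext rfl ?_
    simp only [psi, sub_add_cancel]
    rw [mul_comm]; exact Complex.re_add_im _
  have h := hz ((z.1, z.2.re), z.2.im - ∑ j, ‖z.1 j‖^2) hpos
  rw [e] at h
  rw [Fu]
  linear_combination h
end

/-- A bounded smooth `L_α`-harmonic function `F` on `S` with smooth bounded
boundary value `f` is holomorphic if and only if `ℒ_n f = 0`. -/
theorem stmt1 (n : ℕ) (hn : 1 ≤ n) (α : ℝ) (hα : 0 < α)
    (F : Sg n → ℂ) (hFbdd : ∃ C, ∀ p : Sg n, 0 < p.2 → ‖F p‖ ≤ C)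
    (hFsmooth : ContDiffOn ℝ (⊤ : ℕ∞) F {p : Sg n | 0 < p.2})
    (hFharm : ∀ p : Sg n, 0 < p.2 → Lalpha n α F p = 0)
    (f : Hn n → ℂ) (hfsmooth : ContDiff ℝ (⊤ : ℕ∞) f) (hfbdd : BddFun f)
    (hbv : IsBoundaryValue n F f) :
    IsHolo n F ↔ ∀ w : Hn n, LH n (n : ℝ) f w = 0 := by
  obtain ⟨C0, hC0⟩ := hFbdd
  obtain ⟨C, hC⟩ := hfbdd
  exact ⟨fun hh w => forward n F hFsmooth f hfsmooth hbv hh w, fun hL =>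
    backward hn hα hC0 (hFsmooth.of_le two_le_inf) hFharm (hfsmooth.of_le two_le_inf) hC hbv hL⟩
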